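/- Let ν > n/2 − 1 and 2 ≤ p < ∞. Then the Bergman projection P_ν admits a bounded extension to L^p_ν (i.e. there is C with ‖P_ν f‖_{L^p_ν} ≤ C‖f‖_{L^p_ν} for all f ∈ L²_ν ∩ L^p_ν) if and only if the Hardy inequality holds for (p, ν), i.e. there is a constant C such that ∫_{T_Λ} |F(x+iy)|^p Δ(y)^{ν−n/2} dx dy ≤ C ∫_{T_Λ} |Δ(y) □F(x+iy)|^p Δ(y)^{ν−n/2} dx dy for every F ∈ A^p_ν. -/

import Mathlib

open MeasureTheory Complex Set
open scoped ENNReal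

noncomputable section

/-- The Lorentz form `Δ(y) = y₁² − y₂² − ⋯ − yₙ²` on `ℝⁿ`
(written as `2 y₀² − ∑ yᵢ²` with 0-based indexing). -/
def lor {n : ℕ} [NeZero n] (y : Fin n → ℝ) : ℝ := 2 * y 0 ^ 2 - ∑ i, y i ^ 2

/-- The holomorphic extension of the Lorentz form to `ℂⁿ`. -/
def lorC {n : ℕ} [NeZero n] (z : Fin n → ℂ) : ℂ := 2 * z 0 ^ 2 - ∑ i, z i ^ 2

/-- Componentwise imaginary part. -/
def imP {n : ℕ} (z : Fin n → ℂ) : Fin n → ℝ := fun i => (z i).im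

/-- The forward light cone `Λ`. -/
def cone (n : ℕ) [NeZero n] : Set (Fin n → ℝ) := {y | 0 < lor y ∧ 0 < y 0}

/-- The tube domain `T_Λ` over the forward light cone. -/
def tube (n : ℕ) [NeZero n] : Set (Fin n → ℂ) := {z | imP z ∈ cone n}

/-- The weighted measure `dV_ν = Δ(Im z)^{ν − n/2} dz` on `T_Λ`. -/
def dV (n : ℕ) [NeZero n] (ν : ℝ) : Measure (Fin n → ℂ) :=
  ((volume : Measure (Fin n → ℂ)).restrict (tube n)).withDensity
    (fun z => ENNReal.ofReal (lor (imP z) ^ (ν - (n : ℝ) / 2)))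

/-- `∫ |F|^p dV_ν` (as an extended nonnegative real). -/
def lpInt (n : ℕ) [NeZero n] (p ν : ℝ) (F : (Fin n → ℂ) → ℂ) : ℝ≥0∞ :=
  ∫⁻ z, ENNReal.ofReal (‖F z‖ ^ p) ∂(dV n ν)

/-- The `L^p_ν` norm `(∫ |F|^p dV_ν)^{1/p}`. -/
def lpNorm (n : ℕ) [NeZero n] (p ν : ℝ) (F : (Fin n → ℂ) → ℂ) : ℝ≥0∞ :=
  (lpInt n p ν F) ^ (1 / p)

/-- The Bergman space `A^p_ν`: holomorphic on `T_Λ` and in `L^p_ν`. -/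
def memA (n : ℕ) [NeZero n] (p ν : ℝ) (F : (Fin n → ℂ) → ℂ) : Prop :=
  DifferentiableOn ℂ F (tube n) ∧ lpInt n p ν F < ⊤

/-- Partial derivative `∂/∂zᵢ`. -/
def pd {n : ℕ} (i : Fin n) (F : (Fin n → ℂ) → ℂ) : (Fin n → ℂ) → ℂ :=
  fun z => fderiv ℂ F z (Pi.single i 1)

/-- The wave (Box) operator `□ = −(∂₁² − ∂₂² − ⋯ − ∂ₙ²)`, so that
`□ e^{i z·ξ} = Δ(ξ) e^{i z·ξ}`. -/
def BoxOp {n : ℕ} [NeZero n] (F : (Fin n → ℂ) → ℂ) : (Fin n → ℂ) → ℂ :=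
  fun z => -(2 * pd 0 (pd 0 F) z - ∑ i, pd i (pd i F) z)

/-- The (unnormalized) Bergman kernel `B_β(z,w) = Δ((z − w̄)/i)^{−(β+n)}`. -/
def berg (n : ℕ) [NeZero n] (β : ℝ) (z w : Fin n → ℂ) : ℂ :=
  lorC (fun i => (z i - (starRingEnd ℂ) (w i)) / Complex.I) ^ (-(β + (n : ℝ)) : ℂ)

/-- The Hardy inequality holds for `(p, ν)`:
`∫ |F|^p dV_ν ≤ C ∫ |Δ(Im z) □F(z)|^p dV_ν(z)` for all `F ∈ A^p_ν`. -/
def hardy (n : ℕ) [NeZero n] (p ν : ℝ) : Prop :=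
  ∃ C > (0 : ℝ), ∀ F, memA n p ν F →
    lpInt n p ν F ≤ ENNReal.ofReal C *
      lpInt n p ν (fun z => (lor (imP z) : ℂ) * BoxOp F z)

/-- `g` is the orthogonal projection of `f ∈ L²_ν` onto the closed subspace `A²_ν`:
`g ∈ A²_ν` and `f − g ⊥ A²_ν`. -/
def isProj (n : ℕ) [NeZero n] (ν : ℝ) (f g : (Fin n → ℂ) → ℂ) : Prop :=
  memA n 2 ν g ∧ ∀ h, memA n 2 ν h →
    ∫ z, f z * (starRingEnd ℂ) (h z) ∂(dV n ν) =
      ∫ z, g z * (starRingEnd ℂ) (h z) ∂(dV n ν)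

/-- The Bergman projection `P_ν` admits a bounded extension to `L^p_ν`:
`‖P_ν f‖_{L^p_ν} ≤ C ‖f‖_{L^p_ν}` for all `f ∈ L²_ν ∩ L^p_ν`. -/
def projBounded (n : ℕ) [NeZero n] (p ν : ℝ) : Prop :=
  ∃ C > (0 : ℝ), ∀ f g : (Fin n → ℂ) → ℂ,
    AEStronglyMeasurable f (dV n ν) → lpInt n 2 ν f < ⊤ → lpInt n p ν f < ⊤ →
    isProj n ν f g → lpNorm n p ν g ≤ ENNReal.ofReal C * lpNorm n p ν f

/-- A bounded (continuous) linear functional on `A^p_ν`. -/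
def isBddFunc (n : ℕ) [NeZero n] (p ν : ℝ) (γ : ((Fin n → ℂ) → ℂ) → ℂ) : Prop :=
  (∀ F G, memA n p ν F → memA n p ν G → γ (F + G) = γ F + γ G) ∧
  (∀ (c : ℂ) (F), memA n p ν F → γ (fun z => c * F z) = c * γ F) ∧
  ∃ C : ℝ, ∀ F, memA n p ν F → ‖γ F‖ ≤ C * (lpNorm n p ν F).toReal

set_option linter.unusedSectionVars false

/-- The Lorentz bilinear form. -/
def lb {n : ℕ} [NeZero n] (x y : Fin n → ℝ) : ℝ := 2 * (x 0 * y 0) - ∑ i, x i * y i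

/-- Componentwise real part. -/
def reP {n : ℕ} (z : Fin n → ℂ) : Fin n → ℝ := fun i => (z i).re

section geometry
variable {n : ℕ} [NeZero n]

lemma lor_comb (s t : ℝ) (x y : Fin n → ℝ) :
    lor (s • x + t • y) = s ^ 2 * lor x + 2 * (s * t) * lb x y + t ^ 2 * lor y := by
  have : ∑ i, (s * x i + t * y i) ^ 2
      = s ^ 2 * ∑ i, x i ^ 2 + 2 * (s * t) * ∑ i, x i * y i + t ^ 2 * ∑ i, y i ^ 2 := by
    simp only [Finset.mul_sum, ← Finset.sum_add_distrib]
    exact Finset.sum_congr rfl fun i _ => by ring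
  simp only [lor, lb, Pi.add_apply, Pi.smul_apply, smul_eq_mul, this]
  ring

lemma lor_add (x y : Fin n → ℝ) : lor (x + y) = lor x + 2 * lb x y + lor y := by
  have := lor_comb 1 1 x y
  simpa using this

lemma lor_smul (t : ℝ) (y : Fin n → ℝ) : lor (t • y) = t ^ 2 * lor y := by
  have := lor_comb t 0 y y
  simpa using this

lemma lor_nonpos {w : Fin n → ℝ} (h : w 0 = 0) : lor w ≤ 0 := by
  simp only [lor, h]
  have : 0 ≤ ∑ i, w i ^ 2 := Finset.sum_nonneg fun i _ => sq_nonneg _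
  linarith

lemma lb_key (x y : Fin n → ℝ) :
    y 0 ^ 2 * lor x + x 0 ^ 2 * lor y ≤ 2 * (x 0 * y 0) * lb x y := by
  have h := lor_comb (y 0) (-(x 0)) x y
  have h2 : lor (y 0 • x + (-(x 0)) • y) ≤ 0 := lor_nonpos (by simp; ring)
  rw [h] at h2
  linarith

lemma lb_pos {x y : Fin n → ℝ} (hx : x ∈ cone n) (hy : y ∈ cone n) : 0 < lb x y := by
  have h := lb_key x y
  have h1 : 0 < y 0 ^ 2 * lor x := mul_pos (pow_pos hy.2 2) hx.1
  have h2 : 0 < x 0 ^ 2 * lor y := mul_pos (pow_pos hx.2 2) hy.1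
  have h3 : 0 < 2 * (x 0 * y 0) := by have := mul_pos hx.2 hy.2; linarith
  by_contra hc
  have := mul_nonneg h3.le (neg_nonneg.2 (not_lt.1 hc))
  nlinarith

lemma cone_add {x y : Fin n → ℝ} (hx : x ∈ cone n) (hy : y ∈ cone n) : x + y ∈ cone n := by
  refine ⟨?_, by simpa using add_pos hx.2 hy.2⟩
  rw [lor_add]
  have := lb_pos hx hy
  have := hx.1
  have := hy.1
  linarith

lemma cone_smul {y : Fin n → ℝ} (hy : y ∈ cone n) {t : ℝ} (ht : 0 < t) : t • y ∈ cone n :=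
  ⟨by rw [lor_smul]; exact mul_pos (pow_pos ht 2) hy.1, by simpa using mul_pos ht hy.2⟩

lemma cone_convex : Convex ℝ (cone n) := by
  intro x hx y hy s t hs ht hst
  rcases hs.eq_or_lt with rfl | hs
  · have : t = 1 := by linarith
    subst this; simpa using hy
  rcases ht.eq_or_lt with rfl | ht
  · have : s = 1 := by linarith
    subst this; simpa using hx
  exact cone_add (cone_smul hx hs) (cone_smul hy ht)

lemma lor_continuous : Continuous (lor : (Fin n → ℝ) → ℝ) := by
  unfold lor; fun_prop

lemma imP_continuous : Continuous (imP : (Fin n → ℂ) → _) := by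
  unfold imP; fun_prop

lemma cone_isOpen : IsOpen (cone n) :=
  (isOpen_lt continuous_const lor_continuous).inter (isOpen_lt continuous_const (continuous_apply 0))

lemma tube_isOpen : IsOpen (tube n) := cone_isOpen.preimage imP_continuous

lemma imP_add (z w : Fin n → ℂ) : imP (z + w) = imP z + imP w := by ext i; simp [imP]

lemma imP_smul (t : ℝ) (z : Fin n → ℂ) : imP (t • z) = t • imP z := by ext i; simp [imP]

lemma tube_convex : Convex ℝ (tube n) := by
  intro x hx y hy s t hs ht hst
  change imP (s • x + t • y) ∈ cone n
  rw [imP_add, imP_smul, imP_smul]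
  exact cone_convex hx hy hs ht hst

lemma lorC_eq (z : Fin n → ℂ) :
    lorC z = ((lor (reP z) - lor (imP z) : ℝ) : ℂ) + ((2 * lb (reP z) (imP z) : ℝ) : ℂ) * I := by
  have : ∑ i, z i ^ 2 = ((∑ i, reP z i ^ 2 - ∑ i, imP z i ^ 2 : ℝ) : ℂ)
      + ((2 * ∑ i, reP z i * imP z i : ℝ) : ℂ) * I := by
    push_cast
    simp only [Finset.mul_sum, Finset.sum_mul, ← Finset.sum_add_distrib, ← Finset.sum_sub_distrib]
    refine Finset.sum_congr rfl fun i _ => ?_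
    have h := re_add_im (z i)
    conv_lhs => rw [← h]
    simp only [reP, imP]
    linear_combination ((z i).im : ℂ) ^ 2 * I_sq
  have h0 : z 0 ^ 2 = ((reP z 0 ^ 2 - imP z 0 ^ 2 : ℝ) : ℂ)
      + ((2 * (reP z 0 * imP z 0) : ℝ) : ℂ) * I := by
    have h := re_add_im (z 0)
    conv_lhs => rw [← h]
    simp only [reP, imP]
    push_cast
    linear_combination ((z 0).im : ℂ) ^ 2 * I_sq
  rw [lorC, this, h0, lor, lor, lb]
  push_cast
  ring

lemma lor_mul_le {x y : Fin n → ℝ} (hy : y ∈ cone n) : lor x * lor y ≤ lb x y ^ 2 := by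
  have h1 := lor_comb (lor y) (-(lb x y)) x y
  have hb : lb (lor y • x + (-(lb x y)) • y) y = 0 := by
    have e1 : lb (lor y • x + (-(lb x y)) • y) y = lor y * lb x y - lb x y * lb y y := by
      simp only [lb, Pi.add_apply, Pi.smul_apply, smul_eq_mul, Finset.sum_add_distrib, add_mul,
        mul_assoc, ← Finset.mul_sum]
      ring
    have e2 : lb y y = lor y := by simp only [lb, lor, pow_two]
    rw [e1, e2]; ring
  have hk := lb_key (lor y • x + (-(lb x y)) • y) y
  rw [hb, h1] at hk
  have hy1 := hy.1
  have hp : 0 < y 0 ^ 2 := pow_pos hy.2 2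
  have hq := mul_nonneg (sq_nonneg ((lor y • x + (-(lb x y)) • y) 0)) hy1.le
  have : y 0 ^ 2 * (lor y * (lor x * lor y - lb x y ^ 2)) ≤ 0 := by
    nlinarith
  have h3 : lor y * (lor x * lor y - lb x y ^ 2) ≤ 0 := by
    by_contra hc
    have := mul_pos hp (not_le.1 hc)
    linarith
  by_contra hc
  have := mul_pos hy1 (sub_pos.2 (not_le.1 hc))
  linarith

lemma lor_le_norm_lorC {z : Fin n → ℂ} (hz : z ∈ tube n) : lor (imP z) ≤ ‖lorC z‖ := by
  have hz' : imP z ∈ cone n := hz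
  refine le_of_sq_le_sq ?_ (norm_nonneg _)
  rw [← Complex.normSq_eq_norm_sq, lorC_eq, Complex.normSq_add_mul_I]
  have h := lor_mul_le (x := reP z) hz'
  have := hz'.1
  rcases le_total 0 (lor (reP z)) with h0 | h0
  · nlinarith [mul_nonneg this.le h0, sq_nonneg (lor (reP z))]
  · nlinarith [mul_nonneg this.le (neg_nonneg.2 h0), sq_nonneg (lor (reP z)), sq_nonneg (lb (reP z) (imP z))]

lemma neg_lorC_mem_slitPlane {z : Fin n → ℂ} (hz : z ∈ tube n) : - lorC z ∈ slitPlane := by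
  have hz' : imP z ∈ cone n := hz
  rw [mem_slitPlane_iff, lorC_eq]
  have h := lor_mul_le (x := reP z) hz'
  have := hz'.1
  by_cases hb : lb (reP z) (imP z) = 0
  · left
    rw [hb] at h ⊢
    simp only [neg_re, add_re, ofReal_re, mul_zero, ofReal_zero, zero_mul, zero_re]
    by_contra hc
    nlinarith
  · right
    simpa using hb

lemma differentiable_lorC : Differentiable ℂ (lorC : (Fin n → ℂ) → ℂ) := by
  unfold lorC; fun_prop

end geometry

/-- The first light-cone coordinate. -/
def la {m : ℕ} (y : Fin (m + 2) → ℝ) : ℝ := y 0 + y 1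

section group
variable {m : ℕ}

lemma lor_light (y : Fin (m + 2) → ℝ) :
    lor y = (y 0 + y 1) * (y 0 - y 1) - ∑ i : Fin m, y i.succ.succ ^ 2 := by
  simp only [lor, Fin.sum_univ_succ, Fin.succ_zero_eq_one]; ring

lemma mem_cone_iff {y : Fin (m + 2) → ℝ} : y ∈ cone (m + 2) ↔ 0 < lor y ∧ 0 < la y := by
  have h := lor_light y
  have hs : 0 ≤ ∑ i : Fin m, y i.succ.succ ^ 2 := Finset.sum_nonneg fun i _ => sq_nonneg _
  constructor
  · rintro ⟨h1, h2⟩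
    refine ⟨h1, ?_⟩
    have : 0 < (y 0 + y 1) * (y 0 - y 1) := by linarith
    rcases pos_and_pos_or_neg_and_neg_of_mul_pos this with h | h
    · exact h.1
    · linarith [h.1, h.2]
  · rintro ⟨h1, h2⟩
    refine ⟨h1, ?_⟩
    have : 0 < (y 0 + y 1) * (y 0 - y 1) := by linarith
    have := (mul_pos_iff_of_pos_left h2).1 this
    simp only [la] at h2
    linarith

/-- A real matrix acting on the Lorentz form and the first light coordinate by scalars. -/
structure IsG (G : Matrix (Fin (m + 2)) (Fin (m + 2)) ℝ) (A T : ℝ) : Prop where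
  A_pos : 0 < A
  T_pos : 0 < T
  lor_eq : ∀ v, lor (G.mulVec v) = T * lor v
  la_eq : ∀ v, la (G.mulVec v) = A * la v

/-- The base point of the cone. -/
def e0 (m : ℕ) : Fin (m + 2) → ℝ := Pi.single 0 1

lemma exists_isG {y : Fin (m + 2) → ℝ} (hy : y ∈ cone (m + 2)) :
    ∃ G, IsG G (la y) (lor y) ∧ G.mulVec (e0 m) = y := by
  obtain ⟨hT, hA⟩ := mem_cone_iff.1 hy
  set T := lor y with hTd
  set A := la y with hAd
  set s := Real.sqrt T with hs
  have hsT : s ^ 2 = T := Real.sq_sqrt hT.le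
  set Y : Fin m → ℝ := fun i => y i.succ.succ with hY
  have hTl : T = A * (y 0 - y 1) - ∑ i, Y i ^ 2 := lor_light y
  have hA' : y 0 + y 1 = A := rfl
  let b : (Fin (m + 2) → ℝ) → ℝ := fun v =>
    (T / A) * (v 0 - v 1) + 2 * (s / A) * ∑ i : Fin m, Y i * v i.succ.succ
      + (∑ i, Y i ^ 2) / A * (v 0 + v 1)
  let g : (Fin (m + 2) → ℝ) → (Fin (m + 2) → ℝ) := fun v =>
    Fin.cons ((A * (v 0 + v 1) + b v) / 2) (Fin.cons ((A * (v 0 + v 1) - b v) / 2)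
      (fun i => s * v i.succ.succ + (v 0 + v 1) * Y i))
  have b_add : ∀ v w, b (v + w) = b v + b w := fun v w => by
    simp only [b, Pi.add_apply, mul_add, Finset.sum_add_distrib]; ring
  have b_smul : ∀ (c : ℝ) v, b (c • v) = c * b v := fun c v => by
    simp only [b, Pi.smul_apply, smul_eq_mul]
    have : ∑ i : Fin m, Y i * (c * v i.succ.succ) = c * ∑ i : Fin m, Y i * v i.succ.succ := by
      rw [Finset.mul_sum]; exact Finset.sum_congr rfl fun i _ => by ring
    rw [this]; ring
  let gl : (Fin (m + 2) → ℝ) →ₗ[ℝ] (Fin (m + 2) → ℝ) :=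
    { toFun := g
      map_add' := fun v w => by
        ext i
        refine Fin.cases ?_ (fun i => Fin.cases ?_ (fun i => ?_) i) i
        · simp [g, b_add]; ring
        · simp [g, b_add]; ring
        · simp [g]; ring
      map_smul' := fun c v => by
        ext i
        refine Fin.cases ?_ (fun i => Fin.cases ?_ (fun i => ?_) i) i
        · simp [g, b_smul]; ring
        · simp [g, b_smul]; ring
        · simp [g]; ring }
  have hg : ∀ v, (LinearMap.toMatrix' gl).mulVec v = g v := fun v => by
    rw [← Matrix.toLin'_apply, Matrix.toLin'_toMatrix']; rfl
  have g0 : ∀ v, g v 0 = (A * (v 0 + v 1) + b v) / 2 := fun v => rfl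
  have g1 : ∀ v, g v 1 = (A * (v 0 + v 1) - b v) / 2 := fun v => rfl
  have g2 : ∀ v (i : Fin m), g v i.succ.succ = s * v i.succ.succ + (v 0 + v 1) * Y i :=
    fun v i => rfl
  refine ⟨LinearMap.toMatrix' gl, ⟨hA, hT, fun v => ?_, fun v => ?_⟩, ?_⟩
  · rw [hg, lor_light, lor_light v]
    simp only [g0, g1, g2]
    have : ∑ i : Fin m, (s * v i.succ.succ + (v 0 + v 1) * Y i) ^ 2
        = s ^ 2 * ∑ i : Fin m, v i.succ.succ ^ 2
          + 2 * s * (v 0 + v 1) * ∑ i : Fin m, Y i * v i.succ.succ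
          + (v 0 + v 1) ^ 2 * ∑ i, Y i ^ 2 := by
      simp only [Finset.mul_sum, ← Finset.sum_add_distrib]
      exact Finset.sum_congr rfl fun i _ => by ring
    rw [this, hsT]
    simp only [b]
    field_simp
    ring
  · rw [hg]; simp only [la, g0, g1]; ring
  · rw [hg]
    have e00 : e0 m 0 = 1 := by simp [e0]
    have e01 : e0 m 1 = 0 := by simp [e0]
    have e02 : ∀ i : Fin m, e0 m i.succ.succ = 0 := fun i => by simp [e0]
    have hb : b (e0 m) = y 0 - y 1 := by
      simp only [b, e00, e01, e02, mul_zero, Finset.sum_const_zero]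
      rw [hTl]; field_simp; ring
    ext i
    refine Fin.cases ?_ (fun i => Fin.cases ?_ (fun i => ?_) i) i
    · rw [g0, e00, e01, hb, ← hA']; ring
    · change g (e0 m) 1 = y 1
      rw [g1, e00, e01, hb, ← hA']; ring
    · rw [g2, e00, e01, e02]; simp [Y]

lemma e0_mem (m : ℕ) : e0 m ∈ cone (m + 2) := by
  constructor
  · rw [lor_light]; simp [e0]
  · simp [e0]

lemma lor_e0 (m : ℕ) : lor (e0 m) = 1 := by rw [lor_light]; simp [e0]

/-- The signature matrix of the Lorentz form. -/
def lsig (m : ℕ) : Matrix (Fin (m + 2)) (Fin (m + 2)) ℝ :=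
  Matrix.diagonal fun i => if i = 0 then 1 else -1

lemma lb_lsig (x y : Fin (m + 2) → ℝ) : lb x y = x ⬝ᵥ ((lsig m).mulVec y) := by
  simp only [lb, lsig, dotProduct, Matrix.mulVec_diagonal, Fin.sum_univ_succ]
  simp [Fin.succ_ne_zero]
  ring

namespace IsG
variable {G : Matrix (Fin (m + 2)) (Fin (m + 2)) ℝ} {A T : ℝ} (hG : IsG G A T)
include hG

lemma lb_eq (v w : Fin (m + 2) → ℝ) : lb (G.mulVec v) (G.mulVec w) = T * lb v w := by
  have h := hG.lor_eq (v + w)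
  rw [Matrix.mulVec_add, lor_add, lor_add, hG.lor_eq, hG.lor_eq] at h
  linarith

lemma cone_iff (v : Fin (m + 2) → ℝ) : G.mulVec v ∈ cone (m + 2) ↔ v ∈ cone (m + 2) := by
  rw [mem_cone_iff, mem_cone_iff, hG.lor_eq, hG.la_eq, mul_pos_iff_of_pos_left hG.A_pos,
    mul_pos_iff_of_pos_left hG.T_pos]

lemma transpose_mul : G.transpose * lsig m * G = T • lsig m := by
  ext i j
  have h := hG.lb_eq (Pi.single i 1) (Pi.single j 1)
  rw [lb_lsig, lb_lsig, Matrix.mulVec_mulVec, ← Matrix.vecMul_transpose, ← Matrix.dotProduct_mulVec,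
    Matrix.mulVec_mulVec, ← Matrix.mul_assoc] at h
  simpa using h

lemma det_sq : G.det ^ 2 = T ^ (m + 2) := by
  have h := congrArg Matrix.det hG.transpose_mul
  rw [Matrix.det_mul, Matrix.det_mul, Matrix.det_transpose, Matrix.det_smul, Fintype.card_fin] at h
  have he : (lsig m).det ≠ 0 := by
    rw [lsig, Matrix.det_diagonal]
    exact Finset.prod_ne_zero_iff.2 fun i _ => by split_ifs <;> norm_num
  have : (G.det ^ 2 - T ^ (m + 2)) * (lsig m).det = 0 := by linear_combination h
  rcases mul_eq_zero.1 this with h | h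
  · linarith
  · exact absurd h he

lemma mul_transpose : G * lsig m * G.transpose = T • lsig m := by
  have hee : lsig m * lsig m = 1 := by
    rw [lsig, Matrix.diagonal_mul_diagonal, ← Matrix.diagonal_one]
    congr 1; ext i; split_ifs <;> norm_num
  have hT := hG.T_pos.ne'
  have h1 : (T⁻¹ • (lsig m * G.transpose * lsig m)) * G = 1 := by
    have := congrArg (fun X => T⁻¹ • (lsig m * X)) hG.transpose_mul
    simp only [Matrix.mul_smul, hee, smul_smul, inv_mul_cancel₀ hT, one_smul] at this
    rw [Matrix.smul_mul, ← this]; simp only [Matrix.mul_assoc]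
  have h2 := mul_eq_one_comm.1 h1
  rw [Matrix.mul_smul] at h2
  have h3 := congrArg (fun X => T • (X * lsig m)) h2
  simp only [Matrix.smul_mul, smul_smul, mul_inv_cancel₀ hT, one_smul, Matrix.one_mul] at h3
  rw [← h3]
  simp only [Matrix.mul_assoc, hee, Matrix.mul_one]

end IsG
end group

/-- Real vectors as complex vectors. -/
def ofR {n : ℕ} (x : Fin n → ℝ) : Fin n → ℂ := fun i => x i

/-- The affine map of the tube attached to a real matrix and a real translation. -/
def hmap {n : ℕ} (G : Matrix (Fin n) (Fin n) ℝ) (x : Fin n → ℝ) (z : Fin n → ℂ) : Fin n → ℂ :=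
  (G.map (fun r : ℝ => (r : ℂ))).mulVec z + ofR x

/-- The weight on the cone. -/
def wt {m : ℕ} (s t : ℝ) (y : Fin (m + 2) → ℝ) : ℝ := la y ^ s * lor y ^ t

/-- The weighted measure on the tube. -/
def wM (m : ℕ) (s t : ℝ) : Measure (Fin (m + 2) → ℂ) :=
  ((volume : Measure (Fin (m + 2) → ℂ)).restrict (tube (m + 2))).withDensity
    (fun z => ENNReal.ofReal (wt s t (imP z)))

/-- Half the dimension. -/
def hN (m : ℕ) : ℝ := ((m + 2 : ℕ) : ℝ) / 2

lemma dV_eq (m : ℕ) (ν : ℝ) : dV (m + 2) ν = wM m 0 (ν - hN m) := by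
  simp only [dV, wM, wt, Real.rpow_zero, one_mul, hN]

section basics
variable {m : ℕ}

lemma imP_add_ofR {n : ℕ} (z : Fin n → ℂ) (x : Fin n → ℝ) : imP (z + ofR x) = imP z := by
  ext i; simp [imP, ofR]

lemma reP_add_ofR {n : ℕ} (z : Fin n → ℂ) (x : Fin n → ℝ) : reP (z + ofR x) = reP z + x := by
  ext i; simp [reP, ofR]

lemma imP_mulVec {n : ℕ} (G : Matrix (Fin n) (Fin n) ℝ) (z : Fin n → ℂ) :
    imP ((G.map (fun r : ℝ => (r : ℂ))).mulVec z) = G.mulVec (imP z) := by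
  ext i; simp [imP, Matrix.mulVec, dotProduct]

lemma reP_mulVec {n : ℕ} (G : Matrix (Fin n) (Fin n) ℝ) (z : Fin n → ℂ) :
    reP ((G.map (fun r : ℝ => (r : ℂ))).mulVec z) = G.mulVec (reP z) := by
  ext i; simp [reP, Matrix.mulVec, dotProduct]

lemma imP_hmap {n : ℕ} (G : Matrix (Fin n) (Fin n) ℝ) (x : Fin n → ℝ) (z : Fin n → ℂ) :
    imP (hmap G x z) = G.mulVec (imP z) := by
  rw [hmap, imP_add_ofR, imP_mulVec]

lemma measurable_wt (s t : ℝ) : Measurable (wt s t : (Fin (m + 2) → ℝ) → ℝ) := by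
  have h1 : Measurable (la : (Fin (m + 2) → ℝ) → ℝ) :=
    ((measurable_pi_apply 0).add (measurable_pi_apply 1))
  exact (h1.pow_const s).mul (lor_continuous.measurable.pow_const t)

lemma wt_pos (s t : ℝ) {y : Fin (m + 2) → ℝ} (hy : y ∈ cone (m + 2)) : 0 < wt s t y := by
  obtain ⟨h1, h2⟩ := mem_cone_iff.1 hy
  exact mul_pos (Real.rpow_pos_of_pos h2 _) (Real.rpow_pos_of_pos h1 _)

lemma measurable_tube {n : ℕ} [NeZero n] : MeasurableSet (tube n) := tube_isOpen.measurableSet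

lemma measurable_wt_imP (s t : ℝ) :
    Measurable fun z : Fin (m + 2) → ℂ => ENNReal.ofReal (wt s t (imP z)) :=
  ((measurable_wt s t).comp imP_continuous.measurable).ennreal_ofReal

lemma lintegral_wM (s t : ℝ) (f : (Fin (m + 2) → ℂ) → ℝ≥0∞) :
    ∫⁻ z, f z ∂(wM m s t) = ∫⁻ z in tube (m + 2), ENNReal.ofReal (wt s t (imP z)) * f z := by
  rw [wM, lintegral_withDensity_eq_lintegral_mul_non_measurable _ (measurable_wt_imP s t)]
  · rfl
  · exact Filter.Eventually.of_forall fun _ => ENNReal.ofReal_lt_top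

lemma lintegral_wM_mul (s t s' t' : ℝ) (f : (Fin (m + 2) → ℂ) → ℝ≥0∞) :
    ∫⁻ z, ENNReal.ofReal (wt s' t' (imP z)) * f z ∂(wM m s t)
      = ∫⁻ z, f z ∂(wM m (s + s') (t + t')) := by
  rw [lintegral_wM, lintegral_wM]
  refine setLIntegral_congr_fun measurable_tube fun z hz => ?_
  obtain ⟨h1, h2⟩ := mem_cone_iff.1 (show imP z ∈ cone (m + 2) from hz)
  rw [← mul_assoc, ← ENNReal.ofReal_mul (wt_pos s t hz).le]
  congr 2
  simp only [wt, Real.rpow_add h1, Real.rpow_add h2]; ring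

lemma ae_wM (s t : ℝ) : ∀ᵐ z ∂(wM m s t), z ∈ tube (m + 2) :=
  (withDensity_absolutelyContinuous _ _).ae_le (ae_restrict_mem measurable_tube)

lemma ae_wM_iff (s t : ℝ) {P : (Fin (m + 2) → ℂ) → Prop} :
    (∀ᵐ z ∂(wM m s t), P z) ↔ ∀ᵐ z ∂(volume.restrict (tube (m + 2))), P z := by
  refine ⟨fun h => ?_, fun h => (withDensity_absolutelyContinuous _ _).ae_le h⟩
  rw [wM, ae_withDensity_iff (measurable_wt_imP s t)] at h
  filter_upwards [h, ae_restrict_mem measurable_tube] with z hz hz'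
  refine hz ?_
  have := wt_pos s t (show imP z ∈ cone (m + 2) from hz')
  simpa using this

namespace IsG
variable {G : Matrix (Fin (m + 2)) (Fin (m + 2)) ℝ} {A T : ℝ} (hG : IsG G A T)
include hG

lemma hmap_mem (x : Fin (m + 2) → ℝ) (z : Fin (m + 2) → ℂ) :
    hmap G x z ∈ tube (m + 2) ↔ z ∈ tube (m + 2) := by
  change imP (hmap G x z) ∈ cone (m + 2) ↔ imP z ∈ cone (m + 2)
  rw [imP_hmap, hG.cone_iff]

lemma lorC_mulVec (z : Fin (m + 2) → ℂ) :
    lorC ((G.map (fun r : ℝ => (r : ℂ))).mulVec z) = T * lorC z := by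
  rw [lorC_eq, lorC_eq, imP_mulVec, reP_mulVec, hG.lor_eq, hG.lor_eq, hG.lb_eq]
  push_cast; ring

lemma wt_hmap (s t : ℝ) (x : Fin (m + 2) → ℝ) {z : Fin (m + 2) → ℂ} (hz : z ∈ tube (m + 2)) :
    wt s t (imP (hmap G x z)) = wt s t (imP z) * (A ^ s * T ^ t) := by
  obtain ⟨h1, h2⟩ := mem_cone_iff.1 (show imP z ∈ cone (m + 2) from hz)
  rw [imP_hmap, wt, wt, hG.lor_eq, hG.la_eq, Real.mul_rpow hG.A_pos.le h2.le,
    Real.mul_rpow hG.T_pos.le h1.le]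
  ring

lemma det_ne : G.det ≠ 0 := by
  have h := hG.det_sq
  have := pow_pos hG.T_pos (m + 2)
  intro h0
  rw [h0] at h
  simp at h; linarith

lemma hmap_emb (x : Fin (m + 2) → ℝ) : MeasurableEmbedding (hmap G x) := by
  have hd : IsUnit (G.map (fun r : ℝ => (r : ℂ))) := by
    rw [Matrix.isUnit_iff_isUnit_det]
    have : (G.map (fun r : ℝ => (r : ℂ))).det = (G.det : ℂ) := by
      exact (RingHom.map_det Complex.ofRealHom G).symm
    rw [this, isUnit_iff_ne_zero]
    exact_mod_cast hG.det_ne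
  have hinj : Function.Injective (hmap G x) := by
    intro z w h
    have := add_right_cancel h
    exact Matrix.mulVec_injective_iff_isUnit.2 hd this
  have hc : Continuous (hmap G x) := by
    unfold hmap; fun_prop
  exact hc.measurableEmbedding hinj

lemma map_hmap_volume (x : Fin (m + 2) → ℝ) :
    Measure.map (hmap G x) volume = ENNReal.ofReal ((T ^ (m + 2))⁻¹) • volume := by
  set C : (Fin (m + 2) → ℂ) →ₗ[ℝ] (Fin (m + 2) → ℂ) :=
    (Matrix.toLin' (G.map (fun r : ℝ => (r : ℂ)))).restrictScalars ℝ with hC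
  have hdet : LinearMap.det C = T ^ (m + 2) := by
    rw [hC, LinearMap.det_restrictScalars, LinearMap.det_toLin']
    have : (G.map (fun r : ℝ => (r : ℂ))).det = (G.det : ℂ) := by
      exact (RingHom.map_det Complex.ofRealHom G).symm
    rw [this, Algebra.norm_complex_apply, Complex.normSq_ofReal, ← pow_two, hG.det_sq]
  have hm := Measure.map_linearMap_addHaar_eq_smul_addHaar (μ := (volume : Measure (Fin (m + 2) → ℂ)))
    (f := C) (by rw [hdet]; exact (pow_pos hG.T_pos _).ne')
  have hcomp : hmap G x = (fun z => z + ofR x) ∘ C := by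
    ext z i; rfl
  rw [hcomp, ← Measure.map_map (by fun_prop) (C.continuous_of_finiteDimensional.measurable), hm,
    Measure.map_smul, hdet, (measurePreserving_add_right volume (ofR x)).map_eq,
    abs_of_pos (inv_pos.2 (pow_pos hG.T_pos _))]

lemma lintegral_hmap (s t : ℝ) (x : Fin (m + 2) → ℝ) (f : (Fin (m + 2) → ℂ) → ℝ≥0∞) :
    ∫⁻ z, f (hmap G x z) ∂(wM m s t)
      = ENNReal.ofReal ((A ^ s * T ^ t * T ^ (m + 2))⁻¹) * ∫⁻ z, f z ∂(wM m s t) := by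
  have hA : 0 < A ^ s := Real.rpow_pos_of_pos hG.A_pos _
  have hT : 0 < T ^ t := Real.rpow_pos_of_pos hG.T_pos _
  have hT2 := pow_pos hG.T_pos (m + 2)
  have hpos : 0 < A ^ s * T ^ t := mul_pos hA hT
  rw [lintegral_wM, lintegral_wM, ← lintegral_indicator measurable_tube,
    ← lintegral_indicator measurable_tube]
  set F : (Fin (m + 2) → ℂ) → ℝ≥0∞ :=
    (tube (m + 2)).indicator fun z => ENNReal.ofReal (wt s t (imP z)) * f z with hF
  have h1 : ∀ z, (tube (m + 2)).indicator
      (fun z => ENNReal.ofReal (wt s t (imP z)) * f (hmap G x z)) z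
      = ENNReal.ofReal ((A ^ s * T ^ t)⁻¹) * F (hmap G x z) := by
    intro z
    by_cases hz : z ∈ tube (m + 2)
    · rw [indicator_of_mem hz, hF, indicator_of_mem ((hG.hmap_mem x z).2 hz), hG.wt_hmap s t x hz,
        ← mul_assoc, ← ENNReal.ofReal_mul (inv_pos.2 hpos).le]
      congr 2
      field_simp
    · rw [indicator_of_notMem hz, hF, indicator_of_notMem (by rwa [hG.hmap_mem]), mul_zero]
  rw [lintegral_congr h1, lintegral_const_mul' _ _ ENNReal.ofReal_ne_top,
    ← (hG.hmap_emb x).lintegral_map, hG.map_hmap_volume, lintegral_smul_measure, smul_eq_mul,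
    ← mul_assoc, ← ENNReal.ofReal_mul (inv_pos.2 hpos).le, mul_inv (A ^ s * T ^ t)]

lemma map_hmap_wM (s t : ℝ) (x : Fin (m + 2) → ℝ) :
    Measure.map (hmap G x) (wM m s t)
      = ENNReal.ofReal ((A ^ s * T ^ t * T ^ (m + 2))⁻¹) • wM m s t := by
  refine Measure.ext_of_lintegral _ fun f _ => ?_
  rw [(hG.hmap_emb x).lintegral_map, hG.lintegral_hmap, lintegral_smul_measure, smul_eq_mul]

end IsG
end basics

/-- The sesquiholomorphic difference `z − w̄`. -/
def zc {n : ℕ} (z w : Fin n → ℂ) : Fin n → ℂ := fun i => z i - (starRingEnd ℂ) (w i)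

/-- The kernel `Δ((z − w̄)/i)^{-a}`. -/
def lk {n : ℕ} [NeZero n] (a : ℝ) (z w : Fin n → ℂ) : ℂ := (-lorC (zc z w)) ^ (-(a : ℂ))

section kernel
variable {n : ℕ} [NeZero n]

lemma imP_zc (z w : Fin n → ℂ) : imP (zc z w) = imP z + imP w := by
  ext i; simp [imP, zc]

lemma zc_mem {z w : Fin n → ℂ} (hz : z ∈ tube n) (hw : w ∈ tube n) : zc z w ∈ tube n := by
  change imP (zc z w) ∈ cone n
  rw [imP_zc]; exact cone_add hz hw

lemma lorC_ne {z : Fin n → ℂ} (hz : z ∈ tube n) : lorC z ≠ 0 := by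
  have := slitPlane_ne_zero (neg_lorC_mem_slitPlane hz)
  simpa using this

lemma norm_lk (a : ℝ) {z w : Fin n → ℂ} (hz : z ∈ tube n) (hw : w ∈ tube n) :
    ‖lk a z w‖ = ‖lorC (zc z w)‖ ^ (-a) := by
  have h : -lorC (zc z w) ≠ 0 := neg_ne_zero.2 (lorC_ne (zc_mem hz hw))
  rw [lk, norm_cpow_of_ne_zero h]
  simp

lemma lk_ne (a : ℝ) {z w : Fin n → ℂ} (hz : z ∈ tube n) (hw : w ∈ tube n) : lk a z w ≠ 0 := by
  rw [← norm_pos_iff, norm_lk a hz hw]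
  exact Real.rpow_pos_of_pos (norm_pos_iff.2 (lorC_ne (zc_mem hz hw))) _

lemma lk_conj (a : ℝ) {z w : Fin n → ℂ} (hz : z ∈ tube n) (hw : w ∈ tube n) :
    (starRingEnd ℂ) (lk a z w) = lk a w z := by
  have h := neg_lorC_mem_slitPlane (zc_mem hz hw)
  have h1 : (starRingEnd ℂ) (-lorC (zc z w)) = -lorC (zc w z) := by
    have : ∀ i, (w i - (starRingEnd ℂ) (z i)) ^ 2 = ((starRingEnd ℂ) (z i) - w i) ^ 2 :=
      fun i => by ring
    simp only [lorC, zc, map_neg, map_sub, map_mul, map_sum, map_pow, Complex.conj_conj, this,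
      map_ofNat]
  rw [lk, lk, ← h1, conj_cpow _ _ (slitPlane_arg_ne_pi h)]
  simp

lemma lk_add (a b : ℝ) {z w : Fin n → ℂ} (hz : z ∈ tube n) (hw : w ∈ tube n) :
    lk (a + b) z w = lk a z w * lk b z w := by
  have h : -lorC (zc z w) ≠ 0 := neg_ne_zero.2 (lorC_ne (zc_mem hz hw))
  rw [lk, lk, lk, ← cpow_add _ _ h]
  push_cast; ring_nf

lemma lk_neg_one (z w : Fin n → ℂ) : lk (-1) z w = -lorC (zc z w) := by
  simp [lk]

lemma continuous_zc : Continuous fun q : (Fin n → ℂ) × (Fin n → ℂ) => zc q.1 q.2 := by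
  unfold zc
  refine continuous_pi fun i => ?_
  exact ((continuous_apply i).comp continuous_fst).sub
    (continuous_conj.comp ((continuous_apply i).comp continuous_snd))

lemma continuousOn_lk (a : ℝ) :
    ContinuousOn (fun q : (Fin n → ℂ) × (Fin n → ℂ) => lk a q.1 q.2) (tube n ×ˢ tube n) := by
  unfold lk
  refine ContinuousOn.cpow_const ?_ fun q hq => neg_lorC_mem_slitPlane (zc_mem hq.1 hq.2)
  exact (differentiable_lorC.continuous.comp continuous_zc).neg.continuousOn

/-- The signs of the Lorentz form. -/
def sg {n : ℕ} [NeZero n] (i : Fin n) : ℂ := if i = 0 then 1 else -1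

lemma sum_sg (f : Fin n → ℂ) : ∑ i, sg i * f i = 2 * f 0 - ∑ i, f i := by
  have : ∀ i, sg i * f i = (if i = 0 then 2 * f i else 0) - f i := fun i => by
    unfold sg; split_ifs <;> ring
  simp only [this, Finset.sum_sub_distrib, Finset.sum_ite_eq', Finset.mem_univ, if_true]

lemma sg_mul_self (i : Fin n) : sg i * sg i = 1 := by unfold sg; split_ifs <;> norm_num

lemma BoxOp_eq (F : (Fin n → ℂ) → ℂ) (z : Fin n → ℂ) :
    BoxOp F z = -∑ i, sg i * pd i (pd i F) z := by
  rw [BoxOp, sum_sg]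

lemma hasFDerivAt_lorC (z : Fin n → ℂ) :
    HasFDerivAt (lorC : (Fin n → ℂ) → ℂ)
      (∑ i, (2 * sg i * z i) • (ContinuousLinearMap.proj i : (Fin n → ℂ) →L[ℂ] ℂ)) z := by
  have h : (lorC : (Fin n → ℂ) → ℂ) = fun z => ∑ i, sg i * z i ^ 2 := by
    ext z; rw [sum_sg]; rfl
  rw [h]
  refine HasFDerivAt.fun_sum fun i _ => ?_
  have := ((hasFDerivAt_apply (𝕜 := ℂ) i z).pow 2).const_mul (sg i)
  refine this.congr_fderiv ?_
  ext v
  simp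
  ring

lemma hasFDerivAt_lk (a : ℝ) {z w : Fin n → ℂ} (hz : z ∈ tube n) (hw : w ∈ tube n) :
    HasFDerivAt (fun z => lk a z w)
      (∑ i, (2 * a * sg i * zc z w i * lk (a + 1) z w) •
        (ContinuousLinearMap.proj i : (Fin n → ℂ) →L[ℂ] ℂ)) z := by
  have h1 : HasFDerivAt (fun z => -lorC (zc z w)) _ z :=
    ((hasFDerivAt_lorC (zc z w)).comp z ((hasFDerivAt_id z).sub_const _)).neg
  have h2 := (((hasStrictDerivAt_id (-lorC (zc z w))).cpow_const (c := (-(a : ℂ)))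
    (neg_lorC_mem_slitPlane (zc_mem hz hw))).hasDerivAt).comp_hasFDerivAt z h1
  refine h2.congr_fderiv ?_
  have e : (-lorC (zc z w)) ^ (-(a : ℂ) - 1) = lk (a + 1) z w := by
    rw [lk]; push_cast; ring_nf
  rw [id, e]
  ext v
  simp [Finset.mul_sum]
  exact Finset.sum_congr rfl fun i _ => by ring

lemma differentiableOn_lk (a : ℝ) {w : Fin n → ℂ} (hw : w ∈ tube n) :
    DifferentiableOn ℂ (fun z => lk a z w) (tube n) := fun _ hz =>
  (hasFDerivAt_lk a hz hw).differentiableAt.differentiableWithinAt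

lemma pd_lk (a : ℝ) {z w : Fin n → ℂ} (hz : z ∈ tube n) (hw : w ∈ tube n) (i : Fin n) :
    pd i (fun z => lk a z w) z = 2 * a * sg i * (zc z w i * lk (a + 1) z w) := by
  rw [pd, (hasFDerivAt_lk a hz hw).fderiv]
  simp [Pi.single_apply]
  ring

lemma pd_congr {F G : (Fin n → ℂ) → ℂ} {z : Fin n → ℂ} (h : F =ᶠ[nhds z] G) (i : Fin n) :
    pd i F z = pd i G z := by
  rw [pd, pd, h.fderiv_eq]

lemma BoxOp_lk (a : ℝ) {z w : Fin n → ℂ} (hz : z ∈ tube n) (hw : w ∈ tube n) :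
    BoxOp (fun z => lk a z w) z = 4 * a * (a + 1 - n / 2) * lk (a + 1) z w := by
  have h2 : ∀ i, pd i (pd i (fun z => lk a z w)) z
      = 2 * a * sg i * lk (a + 1) z w + 4 * a * (a + 1) * (zc z w i) ^ 2 * lk (a + 1 + 1) z w := by
    intro i
    have h : pd i (fun z => lk a z w) =ᶠ[nhds z]
        fun z => 2 * a * sg i * (zc z w i * lk (a + 1) z w) := by
      filter_upwards [tube_isOpen.mem_nhds hz] with z hz using pd_lk a hz hw i
    rw [pd_congr h, pd]
    have hz1 : HasFDerivAt (fun z : Fin n → ℂ => zc z w i)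
        (ContinuousLinearMap.proj i : (Fin n → ℂ) →L[ℂ] ℂ) z :=
      (hasFDerivAt_apply (𝕜 := ℂ) i z).sub_const _
    have h3 := (hz1.mul (hasFDerivAt_lk (a + 1) hz hw)).const_mul (2 * a * sg i : ℂ)
    change fderiv ℂ (fun y => 2 * (a : ℂ) * sg i * ((fun z => zc z w i) * fun z => lk (a + 1) z w) y) z
      (Pi.single i 1) = _
    rw [h3.fderiv]
    have hs := sg_mul_self i
    simp [Pi.single_apply]
    linear_combination (4 * a * (a + 1) * (zc z w i) ^ 2 * lk (a + 1 + 1) z w) * hs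
  have hk : lorC (zc z w) * lk (a + 1 + 1) z w = -lk (a + 1) z w := by
    have : lk (a + 1) z w = lk (a + 1 + 1) z w * lk (-1) z w := by
      rw [← lk_add _ _ hz hw]; ring_nf
    rw [this, lk_neg_one]; ring
  have hl : lorC (zc z w) = ∑ i, sg i * (zc z w i) ^ 2 := by rw [sum_sg]; rfl
  rw [BoxOp_eq]
  have : ∀ i, sg i * pd i (pd i (fun z => lk a z w)) z
      = 2 * a * lk (a + 1) z w + 4 * a * (a + 1) * (sg i * (zc z w i) ^ 2) * lk (a + 1 + 1) z w := by
    intro i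
    rw [h2 i]
    linear_combination (2 * a * lk (a + 1) z w) * sg_mul_self i
  simp only [this, Finset.sum_add_distrib, ← Finset.sum_mul, ← Finset.mul_sum, ← hl,
    Finset.sum_const, Finset.card_univ, Fintype.card_fin, nsmul_eq_mul]
  linear_combination (-4 * a * (a + 1)) * hk

lemma norm_lk_le {a : ℝ} (ha : 0 ≤ a) {z w : Fin n → ℂ} (hz : z ∈ tube n) (hw : w ∈ tube n) :
    ‖lk a z w‖ ≤ lor (imP z + imP w) ^ (-a) := by
  rw [norm_lk a hz hw, ← imP_zc]
  exact Real.rpow_le_rpow_of_nonpos (zc_mem hz hw).1 (lor_le_norm_lorC (zc_mem hz hw)) (by linarith)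

end kernel

section covariance
variable {m : ℕ}

lemma zc_hmap (G : Matrix (Fin (m + 2)) (Fin (m + 2)) ℝ) (x : Fin (m + 2) → ℝ)
    (z w : Fin (m + 2) → ℂ) :
    zc (hmap G x z) (hmap G x w) = (G.map (fun r : ℝ => (r : ℂ))).mulVec (zc z w) := by
  ext i
  simp [zc, hmap, ofR, Matrix.mulVec, dotProduct, mul_sub, Finset.sum_sub_distrib]

lemma IsG.lk_hmap {G : Matrix (Fin (m + 2)) (Fin (m + 2)) ℝ} {A T : ℝ} (hG : IsG G A T) (a : ℝ)
    (x : Fin (m + 2) → ℝ) {z w : Fin (m + 2) → ℂ} (hz : z ∈ tube (m + 2)) (hw : w ∈ tube (m + 2)) :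
    lk a (hmap G x z) (hmap G x w) = ((T ^ (-a) : ℝ) : ℂ) * lk a z w := by
  have hne : -lorC (zc z w) ≠ 0 := neg_ne_zero.2 (lorC_ne (zc_mem hz hw))
  have hTne : (T : ℂ) ≠ 0 := by exact_mod_cast hG.T_pos.ne'
  rw [lk, zc_hmap, hG.lorC_mulVec, ← mul_neg, lk, cpow_def_of_ne_zero (mul_ne_zero hTne hne),
    log_ofReal_mul hG.T_pos hne, add_mul, Complex.exp_add, cpow_def_of_ne_zero hne,
    Real.rpow_def_of_pos hG.T_pos]
  push_cast; rfl

end covariance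

lemma lintegral_scale {A : ℝ} (hA : 0 < A) (f : ℝ → ℝ≥0∞) :
    ∫⁻ x, f x = ENNReal.ofReal A * ∫⁻ x, f (A * x) := by
  have hemb : MeasurableEmbedding (fun x : ℝ => A * x) :=
    (Homeomorph.mulLeft₀ A hA.ne').measurableEmbedding
  have h := hemb.lintegral_map (μ := volume) f
  rw [Real.map_volume_mul_left hA.ne', lintegral_smul_measure, abs_of_pos (inv_pos.2 hA)] at h
  rw [← h, smul_eq_mul, ← mul_assoc, ← ENNReal.ofReal_mul hA.le, mul_inv_cancel₀ hA.ne']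
  simp

lemma lintegral_scale_pi {m : ℕ} {R : ℝ} (hR : 0 < R) (f : (Fin m → ℝ) → ℝ≥0∞) :
    ∫⁻ x, f x = ENNReal.ofReal (R ^ m) * ∫⁻ x, f (R • x) := by
  have hemb : MeasurableEmbedding (fun x : Fin m → ℝ => R • x) :=
    (Homeomorph.smulOfNeZero R hR.ne').measurableEmbedding
  have h := hemb.lintegral_map (μ := volume) f
  rw [Measure.map_addHaar_smul volume hR.ne', lintegral_smul_measure] at h
  have hp : 0 < R ^ m := pow_pos hR m
  rw [← h, smul_eq_mul, ← mul_assoc, ← ENNReal.ofReal_mul hp.le, Module.finrank_fin_fun,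
    abs_of_pos (inv_pos.2 hp), mul_inv_cancel₀ hp.ne']
  simp

lemma beta_lt_top {p q : ℝ} (hp : -1 < p) (hq : p + 1 < q) :
    ∫⁻ x in Ioi (0 : ℝ), ENNReal.ofReal (x ^ p * (1 + x) ^ (-q)) < ⊤ := by
  rw [← Ioc_union_Ioi_eq_Ioi (zero_le_one' ℝ),
    lintegral_union measurableSet_Ioi Ioc_disjoint_Ioi_same]
  refine ENNReal.add_lt_top.2 ⟨?_, ?_⟩
  · have h1 : IntegrableOn (fun x : ℝ => x ^ p) (Ioc 0 1) := by
      have := (intervalIntegral.intervalIntegrable_rpow' (a := 0) (b := 1) hp)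
      rwa [intervalIntegrable_iff_integrableOn_Ioc_of_le zero_le_one] at this
    refine lt_of_le_of_lt (setLIntegral_mono' measurableSet_Ioc fun x hx => ?_) h1.lintegral_lt_top
    refine ENNReal.ofReal_le_ofReal (mul_le_of_le_one_right (Real.rpow_nonneg hx.1.le _) ?_)
    exact Real.rpow_le_one_of_one_le_of_nonpos (by linarith [hx.1]) (by linarith)
  · have h1 : IntegrableOn (fun x : ℝ => x ^ (p - q)) (Ioi 1) :=
      integrableOn_Ioi_rpow_of_lt (by linarith) zero_lt_one
    refine lt_of_le_of_lt (setLIntegral_mono' measurableSet_Ioi fun x hx => ?_) h1.lintegral_lt_top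
    have hx0 : 0 < x := lt_trans zero_lt_one hx
    refine ENNReal.ofReal_le_ofReal ?_
    rw [sub_eq_add_neg, Real.rpow_add hx0]
    gcongr ?_ * ?_
    exact Real.rpow_le_rpow_of_nonpos hx0 (by linarith) (by linarith)

lemma beta_scale {A : ℝ} (hA : 0 < A) (p q : ℝ) :
    ∫⁻ x in Ioi (0 : ℝ), ENNReal.ofReal (x ^ p * (A + x) ^ (-q))
      = ENNReal.ofReal (A ^ (p + 1 - q)) *
        ∫⁻ x in Ioi (0 : ℝ), ENNReal.ofReal (x ^ p * (1 + x) ^ (-q)) := by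
  rw [← lintegral_indicator measurableSet_Ioi, ← lintegral_indicator measurableSet_Ioi,
    lintegral_scale hA]
  have : ∀ x, (Ioi (0 : ℝ)).indicator (fun x => ENNReal.ofReal (x ^ p * (A + x) ^ (-q))) (A * x)
      = ENNReal.ofReal (A ^ (p - q)) *
        (Ioi (0 : ℝ)).indicator (fun x => ENNReal.ofReal (x ^ p * (1 + x) ^ (-q))) x := by
    intro x
    by_cases hx : 0 < x
    · rw [indicator_of_mem (show x ∈ Ioi 0 from hx), indicator_of_mem (show A * x ∈ Ioi 0 from mul_pos hA hx),
        ← ENNReal.ofReal_mul (by positivity)]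
      congr 1
      rw [show A + A * x = A * (1 + x) by ring, Real.mul_rpow hA.le hx.le,
        Real.mul_rpow hA.le (by linarith), sub_eq_add_neg, Real.rpow_add hA]
      ring
    · rw [indicator_of_notMem (show x ∉ Ioi 0 from hx), indicator_of_notMem, mul_zero]
      exact fun h => hx ((mul_pos_iff_of_pos_left hA).1 h)
  rw [lintegral_congr this, lintegral_const_mul' _ _ ENNReal.ofReal_ne_top, ← mul_assoc,
    ← ENNReal.ofReal_mul hA.le]
  congr 2
  rw [show p + 1 - q = 1 + (p - q) by ring, Real.rpow_add hA, Real.rpow_one]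

lemma sq_norm_le {m : ℕ} (x : Fin m → ℝ) : ‖x‖ ^ 2 ≤ ∑ i, x i ^ 2 := by
  have h0 : 0 ≤ ∑ i, x i ^ 2 := Finset.sum_nonneg fun i _ => sq_nonneg _
  have : ‖x‖ ≤ Real.sqrt (∑ i, x i ^ 2) := by
    refine (pi_norm_le_iff_of_nonneg (Real.sqrt_nonneg _)).2 fun i => ?_
    refine Real.le_sqrt_of_sq_le ?_
    rw [Real.norm_eq_abs, sq_abs]
    exact Finset.single_le_sum (f := fun i => x i ^ 2) (fun i _ => sq_nonneg _) (Finset.mem_univ i)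
  calc ‖x‖ ^ 2 ≤ Real.sqrt (∑ i, x i ^ 2) ^ 2 := by gcongr
    _ = _ := Real.sq_sqrt h0

lemma lintegral_one_add_sq_lt_top {m : ℕ} {a : ℝ} (ha : (m : ℝ) < 2 * a) :
    ∫⁻ x : Fin m → ℝ, ENNReal.ofReal ((1 + ∑ i, x i ^ 2) ^ (-a)) < ⊤ := by
  have ha0 : 0 < a := by have := Nat.cast_nonneg (α := ℝ) m; linarith
  have h := finite_integral_one_add_norm (E := Fin m → ℝ) (μ := volume) (r := 2 * a)
    (by rw [Module.finrank_fin_fun]; exact ha)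
  have hle : ∀ x : Fin m → ℝ, ENNReal.ofReal ((1 + ∑ i, x i ^ 2) ^ (-a))
      ≤ ENNReal.ofReal ((2 : ℝ) ^ a) * ENNReal.ofReal ((1 + ‖x‖) ^ (-(2 * a))) := by
    intro x
    rw [← ENNReal.ofReal_mul (by positivity)]
    refine ENNReal.ofReal_le_ofReal ?_
    have h1 := sq_norm_le x
    have h2 : (1 + ‖x‖) ^ 2 / 2 ≤ 1 + ∑ i, x i ^ 2 := by nlinarith [sq_nonneg (1 - ‖x‖)]
    have h3 : 0 < 1 + ‖x‖ := by positivity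
    calc (1 + ∑ i, x i ^ 2) ^ (-a) ≤ ((1 + ‖x‖) ^ 2 / 2) ^ (-a) :=
          Real.rpow_le_rpow_of_nonpos (by positivity) h2 (by linarith)
      _ = 2 ^ a * (1 + ‖x‖) ^ (-(2 * a)) := by
          rw [Real.div_rpow (by positivity) (by norm_num), Real.rpow_neg (by norm_num : (0:ℝ) ≤ 2),
            ← Real.rpow_natCast, ← Real.rpow_mul h3.le]
          push_cast
          rw [div_inv_eq_mul, mul_comm]
          ring_nf
  refine lt_of_le_of_lt (lintegral_mono hle) ?_
  rw [lintegral_const_mul' _ _ ENNReal.ofReal_ne_top]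
  exact ENNReal.mul_lt_top ENNReal.ofReal_lt_top h

lemma lintegral_add_sq_scale {m : ℕ} {R : ℝ} (hR : 0 < R) (a : ℝ) :
    ∫⁻ x : Fin m → ℝ, ENNReal.ofReal ((R + ∑ i, x i ^ 2) ^ (-a))
      = ENNReal.ofReal (R ^ ((m : ℝ) / 2 - a)) *
        ∫⁻ x : Fin m → ℝ, ENNReal.ofReal ((1 + ∑ i, x i ^ 2) ^ (-a)) := by
  have hs := Real.sqrt_pos.2 hR
  rw [lintegral_scale_pi hs]
  have : ∀ x : Fin m → ℝ, ENNReal.ofReal ((R + ∑ i, (Real.sqrt R • x) i ^ 2) ^ (-a))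
      = ENNReal.ofReal (R ^ (-a)) * ENNReal.ofReal ((1 + ∑ i, x i ^ 2) ^ (-a)) := by
    intro x
    have h0 : 0 ≤ ∑ i, x i ^ 2 := Finset.sum_nonneg fun i _ => sq_nonneg _
    rw [← ENNReal.ofReal_mul (by positivity), ← Real.mul_rpow hR.le (by positivity), mul_add,
      Finset.mul_sum]
    simp [mul_pow, Real.sq_sqrt hR.le]
  rw [lintegral_congr this, lintegral_const_mul' _ _ ENNReal.ofReal_ne_top, ← mul_assoc,
    ← ENNReal.ofReal_mul (by positivity)]
  congr 2
  rw [Real.sqrt_eq_rpow, ← Real.rpow_natCast, ← Real.rpow_mul hR.le, ← Real.rpow_add hR]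
  congr 1; ring

lemma lintegral_pi_split {m : ℕ} {f : (Fin (m + 2) → ℝ) → ℝ≥0∞} (hf : Measurable f) :
    ∫⁻ v, f v = ∫⁻ x : ℝ, ∫⁻ y : ℝ, ∫⁻ w : Fin m → ℝ, f (Fin.cons x (Fin.cons y w)) := by
  have key : ∀ {k : ℕ} {g : (Fin (k + 1) → ℝ) → ℝ≥0∞}, Measurable g →
      ∫⁻ v, g v = ∫⁻ x : ℝ, ∫⁻ w : Fin k → ℝ, g (Fin.cons x w) := by
    intro k g hg
    have hp := volume_preserving_piFinSuccAbove (fun _ : Fin (k + 1) => ℝ) 0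
    rw [← hp.symm.lintegral_comp hg, Measure.volume_eq_prod, lintegral_prod]
    · simp [MeasurableEquiv.piFinSuccAbove_symm_apply]
      rfl
    · exact (hg.comp (MeasurableEquiv.measurable _)).aemeasurable
  rw [key hf]
  refine lintegral_congr fun x => ?_
  rw [key]
  exact hf.comp (measurable_pi_iff.2 fun i => by
    refine Fin.cases ?_ (fun i => ?_) i
    · simp
    · simpa using measurable_pi_apply i)

lemma measurable_cons2 {m : ℕ} {α : Type*} [MeasurableSpace α] {a b : α → ℝ} {w : α → Fin m → ℝ}
    (ha : Measurable a) (hb : Measurable b) (hw : Measurable w) :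
    Measurable fun x => (Fin.cons (a x) (Fin.cons (b x) (w x)) : Fin (m + 2) → ℝ) := by
  refine measurable_pi_iff.2 fun i => ?_
  refine Fin.cases ?_ (fun i => Fin.cases ?_ (fun i => ?_) i) i
  · simpa using ha
  · simpa using hb
  · simpa using measurable_pi_iff.1 hw i

lemma lintegral_light {m : ℕ} {f : (Fin (m + 2) → ℝ) → ℝ≥0∞} (hf : Measurable f) :
    ∫⁻ v, f v = ∫⁻ A : ℝ, ∫⁻ w : Fin m → ℝ, ∫⁻ y : ℝ, f (Fin.cons (A - y) (Fin.cons y w)) := by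
  rw [lintegral_pi_split hf, lintegral_lintegral_swap]
  · have h1 : ∀ y : ℝ, ∫⁻ x : ℝ, ∫⁻ w : Fin m → ℝ, f (Fin.cons x (Fin.cons y w))
        = ∫⁻ A : ℝ, ∫⁻ w : Fin m → ℝ, f (Fin.cons (A - y) (Fin.cons y w)) := fun y =>
      (lintegral_sub_right_eq_self
        (fun x : ℝ => ∫⁻ w : Fin m → ℝ, f (Fin.cons x (Fin.cons y w))) y).symm
    rw [lintegral_congr h1, lintegral_lintegral_swap]
    · refine lintegral_congr fun A => ?_
      rw [lintegral_lintegral_swap]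
      exact (hf.comp (measurable_cons2 (by fun_prop) (by fun_prop) (by fun_prop))).aemeasurable
    · refine Measurable.aemeasurable ?_
      exact Measurable.lintegral_prod_right' (f := fun q : (ℝ × ℝ) × (Fin m → ℝ) =>
        f (Fin.cons (q.1.2 - q.1.1) (Fin.cons q.1.1 q.2)))
        (hf.comp (measurable_cons2 (by fun_prop) (by fun_prop) (by fun_prop)))
  · refine Measurable.aemeasurable ?_
    exact Measurable.lintegral_prod_right' (f := fun q : (ℝ × ℝ) × (Fin m → ℝ) =>
      f (Fin.cons q.1.1 (Fin.cons q.1.2 q.2)))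
      (hf.comp (measurable_cons2 (by fun_prop) (by fun_prop) (by fun_prop)))

lemma cone_integral_lt_top {m : ℕ} {s t α : ℝ} (h1 : (m : ℝ) < 2 * α) (h2 : t + 1 < α - m / 2)
    (h3 : -1 < t) (h4 : -1 < s + t + m / 2) (h5 : s + t + m / 2 + 1 < α - m / 2) :
    ∫⁻ v in cone (m + 2), ENNReal.ofReal (wt s t v * lor (e0 m + v) ^ (-α)) < ⊤ := by
  have hcm : MeasurableSet (cone (m + 2)) := cone_isOpen.measurableSet
  rw [← lintegral_indicator hcm, lintegral_light]
  swap
  · refine Measurable.indicator ?_ hcm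
    refine ((measurable_wt s t).mul ?_).ennreal_ofReal
    exact (lor_continuous.measurable.comp (measurable_const_add _)).pow_const _
  set F : (Fin (m + 2) → ℝ) → ℝ≥0∞ := (cone (m + 2)).indicator fun v =>
    ENNReal.ofReal (wt s t v * lor (e0 m + v) ^ (-α)) with hF
  set Cw : ℝ≥0∞ := ∫⁻ x : Fin m → ℝ, ENNReal.ofReal ((1 + ∑ i, x i ^ 2) ^ (-α)) with hCw
  have hCw_lt : Cw < ⊤ := lintegral_one_add_sq_lt_top h1
  set Ct : ℝ≥0∞ :=
    ∫⁻ x in Ioi (0 : ℝ), ENNReal.ofReal (x ^ t * (1 + x) ^ (-(α - m / 2))) with hCt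
  have hCt_lt : Ct < ⊤ := beta_lt_top h3 h2
  set CA : ℝ≥0∞ := ∫⁻ x in Ioi (0 : ℝ),
    ENNReal.ofReal (x ^ (s + t + m / 2) * (1 + x) ^ (-(α - m / 2))) with hCA
  have hCA_lt : CA < ⊤ := beta_lt_top h4 h5
  have hq : ∀ w : Fin m → ℝ, 0 ≤ ∑ i, w i ^ 2 := fun w => Finset.sum_nonneg fun i _ => sq_nonneg _
  have hla : ∀ (A y : ℝ) (w : Fin m → ℝ), la (Fin.cons (A - y) (Fin.cons y w)) = A := by
    intro A y w
    have : (Fin.cons (A - y) (Fin.cons y w) : Fin (m + 2) → ℝ) 1 = y := rfl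
    simp [la, this]
  have hlor : ∀ (x y : ℝ) (w : Fin m → ℝ), lor (Fin.cons x (Fin.cons y w))
      = (x + y) * (x - y) - ∑ i, w i ^ 2 := by
    intro x y w
    rw [lor_light]; rfl
  have hlor' : ∀ (x y : ℝ) (w : Fin m → ℝ), lor (e0 m + Fin.cons x (Fin.cons y w))
      = (1 + x + y) * (1 + x - y) - ∑ i, w i ^ 2 := by
    intro x y w
    have : e0 m + Fin.cons x (Fin.cons y w) = Fin.cons (1 + x) (Fin.cons y w) := by
      ext i
      refine Fin.cases ?_ (fun i => Fin.cases ?_ (fun i => ?_) i) i <;> simp [e0]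
    rw [this, hlor]
  have key : ∀ A : ℝ, ∫⁻ w : Fin m → ℝ, ∫⁻ y : ℝ, F (Fin.cons (A - y) (Fin.cons y w))
      = (Ioi (0 : ℝ)).indicator (fun A => ENNReal.ofReal (1 / 2) * Cw * Ct *
        ENNReal.ofReal (A ^ (s + t + m / 2) * (1 + A) ^ (-(α - m / 2)))) A := by
    intro A
    by_cases hA : 0 < A
    swap
    · rw [indicator_of_notMem (by exact hA)]
      have : ∀ (w : Fin m → ℝ) (y : ℝ), F (Fin.cons (A - y) (Fin.cons y w)) = 0 := by
        intro w y
        refine indicator_of_notMem (fun h => hA ?_) _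
        have := (mem_cone_iff.1 h).2
        rwa [hla] at this
      simp [this]
    rw [indicator_of_mem (show A ∈ Ioi 0 from hA)]
    have hA1 : 0 < 1 + A := by linarith
    have hFy : ∀ w : Fin m → ℝ, ∫⁻ y : ℝ, F (Fin.cons (A - y) (Fin.cons y w))
        = ENNReal.ofReal (1 / (2 * A)) * ∫⁻ τ in Ioi (0 : ℝ),
          ENNReal.ofReal (A ^ s * τ ^ t) *
            ENNReal.ofReal (A ^ α * ((1 + A) * (A + τ) + ∑ i, w i ^ 2) ^ (-α)) := by
      intro w
      rw [← lintegral_sub_left_eq_self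
        (fun y => F (Fin.cons (A - y) (Fin.cons y w))) ((A - (∑ i, w i ^ 2) / A) / 2),
        lintegral_scale (show 0 < 1 / (2 * A) by positivity),
        ← lintegral_indicator measurableSet_Ioi]
      congr 1
      refine lintegral_congr fun τ => ?_
      have e1 : lor (Fin.cons (A - ((A - (∑ i, w i ^ 2) / A) / 2 - 1 / (2 * A) * τ))
          (Fin.cons ((A - (∑ i, w i ^ 2) / A) / 2 - 1 / (2 * A) * τ) w)) = τ := by
        rw [hlor]; field_simp; ring
      have e2 : lor (e0 m + Fin.cons (A - ((A - (∑ i, w i ^ 2) / A) / 2 - 1 / (2 * A) * τ))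
          (Fin.cons ((A - (∑ i, w i ^ 2) / A) / 2 - 1 / (2 * A) * τ) w))
          = ((1 + A) * (A + τ) + ∑ i, w i ^ 2) / A := by
        rw [hlor']; field_simp; ring
      by_cases hτ : 0 < τ
      · rw [hF, indicator_of_mem (mem_cone_iff.2 ⟨by rwa [e1], by rwa [hla]⟩),
          indicator_of_mem (show τ ∈ Ioi 0 from hτ), wt, hla, e1, e2,
          ← ENNReal.ofReal_mul (by positivity)]
        congr 2
        have := hq w
        rw [Real.div_rpow (by positivity) hA.le, Real.rpow_neg hA.le, div_inv_eq_mul, mul_comm]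
      · rw [indicator_of_notMem (by exact hτ), hF, indicator_of_notMem]
        intro h
        have := h.1
        rw [e1] at this
        exact hτ this
    rw [lintegral_congr hFy, lintegral_const_mul' _ _ ENNReal.ofReal_ne_top,
      lintegral_lintegral_swap]
    swap
    · refine Measurable.aemeasurable ?_
      fun_prop
    have hτ : ∀ τ ∈ Ioi (0 : ℝ), ∫⁻ w : Fin m → ℝ, ENNReal.ofReal (A ^ s * τ ^ t) *
            ENNReal.ofReal (A ^ α * ((1 + A) * (A + τ) + ∑ i, w i ^ 2) ^ (-α))
        = ENNReal.ofReal (A ^ s * A ^ α * (1 + A) ^ (-(α - m / 2))) * Cw *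
          ENNReal.ofReal (τ ^ t * (A + τ) ^ (-(α - m / 2))) := by
      intro τ hτ
      have hτ' : 0 < τ := hτ
      simp_rw [ENNReal.ofReal_mul (Real.rpow_nonneg hA.le α)]
      rw [lintegral_const_mul' _ _ ENNReal.ofReal_ne_top,
        lintegral_const_mul' _ _ ENNReal.ofReal_ne_top,
        lintegral_add_sq_scale (by positivity), Real.mul_rpow (by positivity) (by positivity),
        show (m : ℝ) / 2 - α = -(α - m / 2) by ring, ← hCw,
        ENNReal.ofReal_mul (by positivity), ENNReal.ofReal_mul (by positivity),
        ENNReal.ofReal_mul (by positivity), ENNReal.ofReal_mul (by positivity),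
        ENNReal.ofReal_mul (by positivity)]
      ring
    rw [setLIntegral_congr_fun measurableSet_Ioi hτ, lintegral_const_mul, beta_scale hA, ← hCt]
    swap
    · fun_prop
    have e3 : A ^ (s + t + m / 2) * (1 + A) ^ (-(α - m / 2)) =
        A⁻¹ * (A ^ s * A ^ α * (1 + A) ^ (-(α - m / 2))) * A ^ (t + 1 - (α - m / 2)) := by
      rw [← Real.rpow_neg_one A, show s + t + (m : ℝ) / 2 = -1 + (s + α) + (t + 1 - (α - m / 2)) by ring,
        Real.rpow_add hA, Real.rpow_add hA, Real.rpow_add hA]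
      ring
    rw [e3, show 1 / (2 * A) = 1 / 2 * A⁻¹ by field_simp, ENNReal.ofReal_mul (by positivity),
      ENNReal.ofReal_mul (by positivity) (q := A ^ (t + 1 - (α - m / 2))),
      ENNReal.ofReal_mul (by positivity) (p := A⁻¹)]
    ring
  rw [lintegral_congr key, lintegral_indicator measurableSet_Ioi, lintegral_const_mul']
  · exact ENNReal.mul_lt_top (ENNReal.mul_lt_top (ENNReal.mul_lt_top ENNReal.ofReal_lt_top hCw_lt)
      hCt_lt) hCA_lt
  · exact (ENNReal.mul_lt_top (ENNReal.mul_lt_top ENNReal.ofReal_lt_top hCw_lt) hCt_lt).ne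

/-- The complex vector with given real and imaginary parts. -/
def cmk {n : ℕ} (x y : Fin n → ℝ) : Fin n → ℂ := fun i => (x i : ℂ) + (y i : ℂ) * I

section cmk
variable {n : ℕ}

lemma imP_cmk (x y : Fin n → ℝ) : imP (cmk x y) = y := by ext i; simp [imP, cmk]

lemma reP_cmk (x y : Fin n → ℝ) : reP (cmk x y) = x := by ext i; simp [reP, cmk]

lemma cmk_reP_imP (z : Fin n → ℂ) : cmk (reP z) (imP z) = z := by
  ext i; simp [cmk, reP, imP, Complex.re_add_im]

lemma measurePreserving_reP_imP :
    MeasurePreserving (fun z : Fin n → ℂ => (reP z, imP z)) :=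
  (volume_measurePreserving_arrowProdEquivProdArrow ℝ ℝ (Fin n)).comp
    (volume_preserving_pi fun _ => Complex.volume_preserving_equiv_real_prod)

lemma lintegral_reP_imP {f : (Fin n → ℝ) → (Fin n → ℝ) → ℝ≥0∞}
    (hf : Measurable (Function.uncurry f)) :
    ∫⁻ z : Fin n → ℂ, f (reP z) (imP z) = ∫⁻ y, ∫⁻ x, f x y := by
  have h := measurePreserving_reP_imP.lintegral_comp (f := Function.uncurry f) hf
  rw [Measure.volume_eq_prod, lintegral_prod_symm _ hf.aemeasurable] at h
  rw [show (∫⁻ z : Fin n → ℂ, f (reP z) (imP z))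
    = ∫⁻ z : Fin n → ℂ, Function.uncurry f (reP z, imP z) from rfl, h]
  rfl

lemma continuous_cmk : Continuous fun q : (Fin n → ℝ) × (Fin n → ℝ) => cmk q.1 q.2 := by
  unfold cmk; fun_prop

end cmk

section J
variable {m : ℕ}

/-- The base point of the tube. -/
def ie (m : ℕ) : Fin (m + 2) → ℂ := cmk 0 (e0 m)

lemma imP_ie : imP (ie m) = e0 m := imP_cmk _ _

lemma ie_mem : ie m ∈ tube (m + 2) := by
  change imP (ie m) ∈ cone (m + 2)
  rw [imP_ie]; exact e0_mem m

lemma exists_hmap {w : Fin (m + 2) → ℂ} (hw : w ∈ tube (m + 2)) :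
    ∃ G, IsG G (la (imP w)) (lor (imP w)) ∧ hmap G (reP w) (ie m) = w := by
  obtain ⟨G, hG, h⟩ := exists_isG (show imP w ∈ cone (m + 2) from hw)
  refine ⟨G, hG, ?_⟩
  rw [← cmk_reP_imP (hmap G (reP w) (ie m)), imP_hmap, imP_ie, h]
  have : reP (hmap G (reP w) (ie m)) = reP w := by
    rw [hmap, reP_add_ofR, reP_mulVec, ie, reP_cmk]; simp
  rw [this, cmk_reP_imP]

lemma one_add_sq_le_normSq_lorC (x : Fin (m + 2) → ℝ) :
    1 + ∑ i, x i ^ 2 ≤ ‖lorC (cmk x (e0 m))‖ ^ 2 := by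
  rw [← Complex.normSq_eq_norm_sq, lorC_eq, Complex.normSq_add_mul_I, reP_cmk, imP_cmk, lor_e0]
  have h1 : lb x (e0 m) = x 0 := by simp [lb, e0, Pi.single_apply]; ring
  have h2 : lor x = x 0 ^ 2 - ∑ i : Fin (m + 1), x i.succ ^ 2 := by
    rw [lor, Fin.sum_univ_succ]; ring
  have hq : 0 ≤ ∑ i : Fin (m + 1), x i.succ ^ 2 := Finset.sum_nonneg fun i _ => sq_nonneg _
  rw [h1, h2, Fin.sum_univ_succ]
  nlinarith [sq_nonneg (x 0 ^ 2 - ∑ i : Fin (m + 1), x i.succ ^ 2), sq_nonneg (x 0)]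

lemma lintegral_lorC_e0_lt_top {a : ℝ} (ha : ((m + 2 : ℕ) : ℝ) < a) :
    ∫⁻ x : Fin (m + 2) → ℝ, ENNReal.ofReal (‖lorC (cmk x (e0 m))‖ ^ (-a)) < ⊤ := by
  refine lt_of_le_of_lt (lintegral_mono fun x => ENNReal.ofReal_le_ofReal ?_)
    (lintegral_one_add_sq_lt_top (m := m + 2) (a := a / 2) (by linarith))
  have h := one_add_sq_le_normSq_lorC x
  have h0 : 0 < 1 + ∑ i, x i ^ 2 := by
    have : 0 ≤ ∑ i, x i ^ 2 := Finset.sum_nonneg fun i _ => sq_nonneg _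
    linarith
  have ha0 : 0 < a := lt_of_le_of_lt (Nat.cast_nonneg _) ha
  calc ‖lorC (cmk x (e0 m))‖ ^ (-a) = (‖lorC (cmk x (e0 m))‖ ^ 2) ^ (-(a / 2)) := by
        rw [← Real.rpow_natCast, ← Real.rpow_mul (norm_nonneg _)]; congr 1; push_cast; ring
    _ ≤ _ := Real.rpow_le_rpow_of_nonpos h0 h (by linarith)

lemma lintegral_lorC {a : ℝ} {Y : Fin (m + 2) → ℝ} (hY : Y ∈ cone (m + 2)) :
    ∫⁻ x : Fin (m + 2) → ℝ, ENNReal.ofReal (‖lorC (cmk x Y)‖ ^ (-a))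
      = ENNReal.ofReal (lor Y ^ (hN m - a)) *
        ∫⁻ x : Fin (m + 2) → ℝ, ENNReal.ofReal (‖lorC (cmk x (e0 m))‖ ^ (-a)) := by
  obtain ⟨G, hG, hGe⟩ := exists_isG hY
  have hT := hG.T_pos
  have hmap1 := Real.map_matrix_volume_pi_eq_smul_volume_pi hG.det_ne
  have hdet : |G.det| = lor Y ^ hN m := by
    have : |G.det| ^ 2 = (lor Y ^ hN m) ^ 2 := by
      rw [sq_abs, hG.det_sq, ← Real.rpow_natCast, ← Real.rpow_natCast, ← Real.rpow_mul hT.le, hN]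
      congr 1; push_cast; ring
    exact (sq_eq_sq₀ (abs_nonneg _) (Real.rpow_pos_of_pos hT _).le).1 this
  have hmeas : Measurable fun x : Fin (m + 2) → ℝ => ENNReal.ofReal (‖lorC (cmk x Y)‖ ^ (-a)) := by
    have : Continuous fun x : Fin (m + 2) → ℝ => lorC (cmk x Y) :=
      differentiable_lorC.continuous.comp (continuous_cmk.comp (continuous_id.prodMk continuous_const))
    exact (this.measurable.norm.pow_const _).ennreal_ofReal
  have hvol : (volume : Measure (Fin (m + 2) → ℝ)) =
      ENNReal.ofReal (lor Y ^ hN m) • Measure.map (Matrix.toLin' G) volume := by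
    rw [hmap1, smul_smul, abs_inv, hdet, ← ENNReal.ofReal_mul (Real.rpow_pos_of_pos hT _).le,
      mul_inv_cancel₀ (Real.rpow_pos_of_pos hT _).ne']
    simp
  conv_lhs => rw [hvol]
  rw [lintegral_smul_measure, lintegral_map hmeas
    (LinearMap.continuous_of_finiteDimensional _).measurable, smul_eq_mul,
    ← lintegral_const_mul' _ _ ENNReal.ofReal_ne_top, ← lintegral_const_mul' _ _ ENNReal.ofReal_ne_top]
  refine lintegral_congr fun x => ?_
  have h1 : cmk (Matrix.toLin' G x) Y = (G.map (fun r : ℝ => (r : ℂ))).mulVec (cmk x (e0 m)) := by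
    rw [← cmk_reP_imP ((G.map (fun r : ℝ => (r : ℂ))).mulVec _), imP_mulVec, reP_mulVec, imP_cmk,
      reP_cmk, hGe, Matrix.toLin'_apply]
  rw [h1, hG.lorC_mulVec, norm_mul, Complex.norm_real, Real.norm_of_nonneg hT.le,
    Real.mul_rpow hT.le (norm_nonneg _), ENNReal.ofReal_mul (by positivity), ← mul_assoc,
    ← ENNReal.ofReal_mul (by positivity), ← Real.rpow_add hT, sub_eq_add_neg]

lemma lintegral_lk_ie_lt_top {s t a : ℝ} (h1 : 2 * hN m < a) (h2 : s + t + 3 * hN m - 1 < a)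
    (h3 : t + 2 * hN m < a) (h4 : 0 < s + t + hN m) (h5 : -1 < t) :
    ∫⁻ z, ‖lk a z (ie m)‖ₑ ∂(wM m s t) < ⊤ := by
  have hNm : hN m = m / 2 + 1 := by rw [hN]; push_cast; ring
  set f : (Fin (m + 2) → ℝ) → (Fin (m + 2) → ℝ) → ℝ≥0∞ := fun x y =>
    (cone (m + 2)).indicator (fun y => ENNReal.ofReal (wt s t y)) y *
      ENNReal.ofReal (‖lorC (cmk x (e0 m + y))‖ ^ (-a)) with hf
  have hfm : Measurable (Function.uncurry f) := by
    refine Measurable.mul ?_ ?_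
    · exact ((measurable_wt s t).ennreal_ofReal.indicator cone_isOpen.measurableSet).comp
        measurable_snd
    · have : Continuous fun q : (Fin (m + 2) → ℝ) × (Fin (m + 2) → ℝ) =>
          lorC (cmk q.1 (e0 m + q.2)) :=
        differentiable_lorC.continuous.comp (continuous_cmk.comp
          (continuous_fst.prodMk (continuous_const.add continuous_snd)))
      exact (this.measurable.norm.pow_const _).ennreal_ofReal
  have e1 : ∫⁻ z, ‖lk a z (ie m)‖ₑ ∂(wM m s t) = ∫⁻ z, f (reP z) (imP z) := by
    rw [lintegral_wM, ← lintegral_indicator measurable_tube]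
    refine lintegral_congr fun z => ?_
    by_cases hz : z ∈ tube (m + 2)
    · have hz' : imP z ∈ cone (m + 2) := hz
      rw [indicator_of_mem hz, hf]
      simp only
      rw [indicator_of_mem hz', ← ofReal_norm, norm_lk a hz ie_mem]
      have hr : reP (zc z (ie m)) = reP z := by ext i; simp [reP, zc, ie, cmk]
      have hzc : zc z (ie m) = cmk (reP z) (e0 m + imP z) := by
        rw [← cmk_reP_imP (zc z (ie m)), imP_zc, imP_ie, add_comm (imP z), hr]
      rw [hzc]
    · have hz' : imP z ∉ cone (m + 2) := hz
      rw [indicator_of_notMem hz, hf]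
      simp only
      rw [indicator_of_notMem hz', zero_mul]
  set I0 := ∫⁻ x : Fin (m + 2) → ℝ, ENNReal.ofReal (‖lorC (cmk x (e0 m))‖ ^ (-a)) with hI0
  have hI0t : I0 < ⊤ := lintegral_lorC_e0_lt_top (by rw [hN] at h1; linarith)
  have e2 : ∀ y, ∫⁻ x, f x y = (cone (m + 2)).indicator
      (fun y => ENNReal.ofReal (wt s t y * lor (e0 m + y) ^ (-(a - hN m)))) y * I0 := by
    intro y
    by_cases hy : y ∈ cone (m + 2)
    · simp only [hf, indicator_of_mem hy]
      rw [lintegral_const_mul' _ _ ENNReal.ofReal_ne_top, lintegral_lorC (cone_add (e0_mem m) hy),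
        ENNReal.ofReal_mul (wt_pos s t hy).le, mul_assoc, neg_sub]
    · simp only [hf, indicator_of_notMem hy, zero_mul, lintegral_zero]
  rw [e1, lintegral_reP_imP hfm, lintegral_congr e2, lintegral_mul_const' _ _ hI0t.ne,
    lintegral_indicator cone_isOpen.measurableSet]
  exact ENNReal.mul_lt_top (cone_integral_lt_top (by linarith) (by linarith) h5 (by linarith)
    (by linarith)) hI0t

/-- The integral of the modulus of the kernel is a monomial in the weights. -/
lemma exists_lintegral_lk {s t a : ℝ} (h1 : 2 * hN m < a) (h2 : s + t + 3 * hN m - 1 < a)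
    (h3 : t + 2 * hN m < a) (h4 : 0 < s + t + hN m) (h5 : -1 < t) :
    ∃ J : ℝ, 0 ≤ J ∧ ∀ w ∈ tube (m + 2), ∫⁻ z, ‖lk a z w‖ₑ ∂(wM m s t)
      = ENNReal.ofReal (J * (wt s t (imP w) * lor (imP w) ^ (2 * hN m - a))) := by
  have hJ := lintegral_lk_ie_lt_top h1 h2 h3 h4 h5
  set J := ∫⁻ z, ‖lk a z (ie m)‖ₑ ∂(wM m s t) with hJd
  refine ⟨J.toReal, ENNReal.toReal_nonneg, fun w hw => ?_⟩
  obtain ⟨G, hG, hGw⟩ := exists_hmap hw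
  have hT := hG.T_pos
  have hA := hG.A_pos
  have key := hG.lintegral_hmap s t (reP w) (fun z => ‖lk a z w‖ₑ)
  have e1 : ∫⁻ z, ‖lk a (hmap G (reP w) z) w‖ₑ ∂(wM m s t)
      = ENNReal.ofReal (lor (imP w) ^ (-a)) * J := by
    rw [hJd, ← lintegral_const_mul' _ _ ENNReal.ofReal_ne_top]
    refine lintegral_congr_ae ?_
    filter_upwards [ae_wM s t] with z hz
    have hlk := hG.lk_hmap a (reP w) hz ie_mem
    rw [hGw] at hlk
    rw [hlk, enorm_mul]
    congr 1
    rw [← ofReal_norm, Complex.norm_real, Real.norm_of_nonneg (by positivity)]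
  rw [e1] at key
  set c := la (imP w) ^ s * lor (imP w) ^ t * lor (imP w) ^ (m + 2) with hc
  have hcpos : 0 < c := by positivity
  have : ∫⁻ z, ‖lk a z w‖ₑ ∂(wM m s t)
      = ENNReal.ofReal c * (ENNReal.ofReal (lor (imP w) ^ (-a)) * J) := by
    rw [key, ← mul_assoc, ← ENNReal.ofReal_mul hcpos.le, mul_inv_cancel₀ hcpos.ne']
    simp
  rw [this, ← ENNReal.ofReal_toReal hJ.ne, ENNReal.toReal_ofReal ENNReal.toReal_nonneg,
    ← ENNReal.ofReal_mul (by positivity), ← ENNReal.ofReal_mul hcpos.le]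
  congr 1
  rw [hc, wt, ← Real.rpow_natCast (lor (imP w)) (m + 2), sub_eq_add_neg, Real.rpow_add hT, hN]
  push_cast
  ring_nf

end J

section holo
variable {n : ℕ}

lemma norm_fderiv_le {F : (Fin n → ℂ) → ℂ} {c : Fin n → ℂ} {r M : ℝ} (hr : 0 < r)
    (hd : DifferentiableOn ℂ F (Metric.ball c r)) (hM : ∀ z ∈ Metric.ball c r, ‖F z‖ ≤ M) :
    ‖fderiv ℂ F c‖ ≤ 2 * M / r := by
  refine Complex.norm_fderiv_le_div_of_mapsTo_ball hd (fun z hz => ?_) hr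
  rw [mem_closedBall_iff_norm]
  calc ‖F z - F c‖ ≤ ‖F z‖ + ‖F c‖ := norm_sub_le _ _
    _ ≤ 2 * M := by linarith [hM z hz, hM c (Metric.mem_ball_self hr)]

lemma norm_pd_le_norm_fderiv (F : (Fin n → ℂ) → ℂ) (z : Fin n → ℂ) (i : Fin n) :
    ‖pd i F z‖ ≤ ‖fderiv ℂ F z‖ := by
  refine ((fderiv ℂ F z).le_opNorm _).trans ?_
  rw [Pi.norm_single, norm_one, mul_one]

lemma norm_pd_le {F : (Fin n → ℂ) → ℂ} {c : Fin n → ℂ} {r M : ℝ} (hr : 0 < r)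
    (hd : DifferentiableOn ℂ F (Metric.ball c r)) (hM : ∀ z ∈ Metric.ball c r, ‖F z‖ ≤ M)
    (i : Fin n) : ‖pd i F c‖ ≤ 2 * M / r :=
  (norm_pd_le_norm_fderiv F c i).trans (norm_fderiv_le hr hd hM)

lemma tendsto_pd {F : (Fin n → ℂ) → ℂ} {z : Fin n → ℂ} (hF : DifferentiableAt ℂ F z) (i : Fin n) :
    Filter.Tendsto (fun k : ℕ => ((k : ℂ) + 1) * (F (z + ((k : ℂ) + 1)⁻¹ • Pi.single i 1) - F z))
      Filter.atTop (nhds (pd i F z)) := by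
  have h := hF.hasFDerivAt.hasLineDerivAt (Pi.single i 1)
  have h2 := (hasDerivAt_iff_tendsto_slope_zero.1 h)
  have h3 : Filter.Tendsto (fun k : ℕ => ((k : ℂ) + 1)⁻¹) Filter.atTop (nhdsWithin 0 {0}ᶜ) := by
    refine tendsto_nhdsWithin_iff.2 ⟨?_, Filter.Eventually.of_forall fun k => ?_⟩
    · have := tendsto_one_div_add_atTop_nhds_zero_nat (𝕜 := ℂ)
      simpa using this
    · simp only [mem_compl_iff, mem_singleton_iff, inv_eq_zero]
      exact_mod_cast Nat.succ_ne_zero k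
  have h4 := h2.comp h3
  refine h4.congr fun k => ?_
  simp

lemma aestronglyMeasurable_pd {Ω : Type*} [MeasurableSpace Ω] {μ : Measure Ω}
    {G : (Fin n → ℂ) → Ω → ℂ} {U : Set (Fin n → ℂ)} (hU : IsOpen U)
    (hm : ∀ z ∈ U, AEStronglyMeasurable (G z) μ)
    (hd : ∀ᵐ u ∂μ, DifferentiableOn ℂ (fun z => G z u) U) {z : Fin n → ℂ} (hz : z ∈ U) (i : Fin n) :
    AEStronglyMeasurable (fun u => pd i (fun z => G z u) z) μ := by
  have hlim : Filter.Tendsto (fun k : ℕ => z + ((k : ℂ) + 1)⁻¹ • (Pi.single i 1 : Fin n → ℂ))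
      Filter.atTop (nhds z) := by
    have h1 : Filter.Tendsto (fun k : ℕ => ((k : ℂ) + 1)⁻¹) Filter.atTop (nhds 0) := by
      simpa using tendsto_one_div_add_atTop_nhds_zero_nat (𝕜 := ℂ)
    simpa using (h1.smul_const (Pi.single i 1 : Fin n → ℂ)).const_add z
  obtain ⟨K, hK⟩ := Filter.eventually_atTop.1 (hlim.eventually (hU.mem_nhds hz))
  refine aestronglyMeasurable_of_tendsto_ae Filter.atTop (f := fun (k : ℕ) u =>
    (((k + K : ℕ) : ℂ) + 1) * (G (z + (((k + K : ℕ) : ℂ) + 1)⁻¹ • Pi.single i 1) u - G z u))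
    (fun k => ((hm _ (hK _ (by omega))).sub (hm z hz)).const_mul _) ?_
  filter_upwards [hd] with u hu
  exact (tendsto_pd (hu.differentiableAt (hU.mem_nhds hz)) i).comp (Filter.tendsto_add_atTop_nat K)

lemma clm_eq_sum (L : (Fin n → ℂ) →L[ℂ] ℂ) :
    L = ∑ i, (L (Pi.single i 1)) • (ContinuousLinearMap.proj i : (Fin n → ℂ) →L[ℂ] ℂ) := by
  ext v
  conv_lhs => rw [← Finset.univ_sum_single v]
  simp only [map_sum, _root_.sum_apply, _root_.smul_apply,
    ContinuousLinearMap.proj_apply, smul_eq_mul]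
  refine Finset.sum_congr rfl fun i _ => ?_
  have : (Pi.single i (v i) : Fin n → ℂ) = v i • Pi.single i 1 := by
    rw [← Pi.single_smul, smul_eq_mul, mul_one]
  rw [this, map_smul, smul_eq_mul, mul_comm]

lemma hasFDerivAt_integral_param {Ω : Type*} [MeasurableSpace Ω] {μ : Measure Ω}
    {G : (Fin n → ℂ) → Ω → ℂ} {z₀ : Fin n → ℂ} {r : ℝ} (hr : 0 < r) {b : Ω → ℝ}
    (hm : ∀ z ∈ Metric.ball z₀ r, AEStronglyMeasurable (G z) μ)
    (hd : ∀ᵐ u ∂μ, DifferentiableOn ℂ (fun z => G z u) (Metric.ball z₀ r))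
    (hb : Integrable b μ) (hGb : ∀ᵐ u ∂μ, ∀ z ∈ Metric.ball z₀ r, ‖G z u‖ ≤ b u) :
    HasFDerivAt (fun z => ∫ u, G z u ∂μ) (∫ u, fderiv ℂ (fun z => G z u) z₀ ∂μ) z₀ := by
  have hmem : z₀ ∈ Metric.ball z₀ r := Metric.mem_ball_self hr
  refine hasFDerivAt_integral_of_dominated_of_fderiv_le (F := G)
    (F' := fun z u => fderiv ℂ (fun z => G z u) z) (s := Metric.ball z₀ (r / 2))
    (bound := fun u => 2 * b u / (r / 2)) (Metric.ball_mem_nhds _ (by linarith)) ?_ ?_ ?_ ?_ ?_ ?_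
  · filter_upwards [Metric.ball_mem_nhds z₀ hr] with z hz using hm z hz
  · refine Integrable.mono' hb (hm _ hmem) ?_
    filter_upwards [hGb] with u hu using hu _ hmem
  · have : (fun u => fderiv ℂ (fun z => G z u) z₀) = fun u => ∑ i, (pd i (fun z => G z u) z₀) •
        (ContinuousLinearMap.proj i : (Fin n → ℂ) →L[ℂ] ℂ) := by
      ext1 u; exact clm_eq_sum _
    rw [this]
    refine Finset.aestronglyMeasurable_fun_sum _ fun i _ => ?_
    exact (aestronglyMeasurable_pd Metric.isOpen_ball hm hd hmem i).smul_const _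
  · filter_upwards [hGb, hd] with u hu hdu z hz
    have hsub : Metric.ball z (r / 2) ⊆ Metric.ball z₀ r :=
      Metric.ball_subset_ball' (by rw [Metric.mem_ball] at hz; linarith)
    exact norm_fderiv_le (by linarith) (hdu.mono hsub) fun w hw => hu w (hsub hw)
  · exact (hb.const_mul 2).div_const _
  · filter_upwards [hd] with u hu z hz
    have : z ∈ Metric.ball z₀ r := Metric.ball_subset_ball (by linarith) hz
    exact (hu.differentiableAt (Metric.isOpen_ball.mem_nhds this)).hasFDerivAt

lemma pd_eq_integral {F : (Fin n → ℂ) → ℂ} {z : Fin n → ℂ} {r : ℝ} (hr : 0 < r) {U : Set (Fin n → ℂ)}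
    (hU : IsOpen U) (hF : DifferentiableOn ℂ F U) (hz : Metric.closedBall z r ⊆ U) (i : Fin n) :
    pd i F z = (2 * Real.pi * I : ℂ)⁻¹ * ∫ θ in Ioc 0 (2 * Real.pi),
      deriv (circleMap 0 r) θ • ((circleMap 0 r θ) ^ (-2 : ℤ) • F (z + circleMap 0 r θ • Pi.single i 1)) := by
  set g : ℂ → ℂ := fun ζ => F (z + ζ • Pi.single i 1) with hg
  have hmaps : ∀ ζ ∈ Metric.closedBall (0 : ℂ) r, z + ζ • (Pi.single i 1 : Fin n → ℂ) ∈ U := by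
    intro ζ hζ
    refine hz ?_
    rw [mem_closedBall_iff_norm, add_sub_cancel_left, norm_smul, Pi.norm_single, norm_one, mul_one]
    simpa using hζ
  have hgd : ∀ ζ ∈ Metric.closedBall (0 : ℂ) r, DifferentiableAt ℂ g ζ := by
    intro ζ hζ
    have h1 := hF.differentiableAt (hU.mem_nhds (hmaps ζ hζ))
    exact h1.comp ζ (by fun_prop)
  have hdc : DiffContOnCl ℂ g (Metric.ball 0 r) := by
    refine DifferentiableOn.diffContOnCl fun ζ hζ => ?_
    rw [closure_ball _ hr.ne'] at hζ
    exact (hgd ζ hζ).differentiableWithinAt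
  have h1 : pd i F z = deriv g 0 := by
    have h1 := hF.differentiableAt (hU.mem_nhds (hz (Metric.mem_closedBall_self hr.le)))
    have h2 := h1.hasFDerivAt.hasLineDerivAt (Pi.single i 1 : Fin n → ℂ)
    exact (HasDerivAt.deriv h2).symm
  have h3 := hdc.deriv_eq_smul_circleIntegral hr
  rw [circleIntegral, intervalIntegral.integral_of_le Real.two_pi_pos.le, smul_eq_mul] at h3
  have hpi : (2 * Real.pi * I : ℂ) ≠ 0 := Complex.two_pi_I_ne_zero
  rw [h1, eq_inv_mul_iff_mul_eq₀ hpi, ← h3]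
  refine integral_congr_ae (Filter.Eventually.of_forall fun θ => ?_)
  simp only [hg, sub_zero, one_div, zpow_neg]
  rfl

lemma continuousOn_bound {F : (Fin n → ℂ) → ℂ} {z : Fin n → ℂ} {r : ℝ}
    (hF : ContinuousOn F (Metric.closedBall z r)) :
    ∃ M, ∀ w ∈ Metric.closedBall z r, ‖F w‖ ≤ M :=
  (isCompact_closedBall z r).exists_bound_of_continuousOn hF

lemma differentiableOn_pd {F : (Fin n → ℂ) → ℂ} {U : Set (Fin n → ℂ)} (hU : IsOpen U)
    (hF : DifferentiableOn ℂ F U) (i : Fin n) : DifferentiableOn ℂ (pd i F) U := by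
  intro z hz
  obtain ⟨R, hR, hRU⟩ := Metric.nhds_basis_closedBall.mem_iff.1 (hU.mem_nhds hz)
  set r := R / 2 with hr
  have hr0 : 0 < r := by positivity
  obtain ⟨M, hM⟩ := continuousOn_bound (hF.continuousOn.mono hRU)
  have hmem : ∀ w ∈ Metric.ball z r, ∀ θ : ℝ,
      w + circleMap 0 r θ • (Pi.single i 1 : Fin n → ℂ) ∈ Metric.closedBall z R := by
    intro w hw θ
    rw [mem_closedBall_iff_norm, add_sub_right_comm]
    refine (norm_add_le _ _).trans ?_
    rw [norm_smul, Pi.norm_single, norm_one, mul_one, norm_circleMap_zero, abs_of_pos hr0]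
    rw [mem_ball_iff_norm] at hw
    linarith
  set G : (Fin n → ℂ) → ℝ → ℂ := fun w θ =>
    deriv (circleMap 0 r) θ • ((circleMap 0 r θ) ^ (-2 : ℤ) •
      F (w + circleMap 0 r θ • Pi.single i 1)) with hG
  have hcne : ∀ θ, circleMap 0 r θ ≠ 0 := fun θ => circleMap_ne_center hr0.ne'
  have key := hasFDerivAt_integral_param (μ := volume.restrict (Ioc 0 (2 * Real.pi))) (G := G)
    (z₀ := z) hr0 (b := fun _ => r * (r ^ (-2 : ℤ) * M)) ?_ ?_ ?_ ?_
  · have hev : pd i F =ᶠ[nhds z] fun w => (2 * Real.pi * I : ℂ)⁻¹ *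
        ∫ θ in Ioc 0 (2 * Real.pi), G w θ := by
      filter_upwards [Metric.ball_mem_nhds z hr0] with w hw
      refine pd_eq_integral hr0 hU hF (fun v hv => hRU ?_) i
      rw [Metric.mem_closedBall] at hv ⊢
      rw [Metric.mem_ball] at hw
      linarith [dist_triangle v w z]
    exact ((key.differentiableAt.const_mul _).congr_of_eventuallyEq hev).differentiableWithinAt
  · intro w hw
    refine Continuous.aestronglyMeasurable ?_
    simp only [hG, deriv_circleMap]
    have hc : Continuous (circleMap 0 r) := continuous_circleMap 0 r
    refine (hc.mul continuous_const).smul ((hc.zpow₀ _ fun θ => Or.inl (hcne θ)).smul ?_)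
    refine (hF.continuousOn.mono hRU).comp_continuous (by fun_prop) (hmem w hw)
  · refine Filter.Eventually.of_forall fun θ w hw => ?_
    have h1 := hF.differentiableAt (hU.mem_nhds (hRU (hmem w hw θ)))
    have h2 : DifferentiableAt ℂ
        (fun w => F (w + circleMap 0 r θ • (Pi.single i 1 : Fin n → ℂ))) w :=
      DifferentiableAt.comp w h1 (by fun_prop)
    exact ((h2.const_smul ((circleMap 0 r θ) ^ (-2 : ℤ))).const_smul
      (deriv (circleMap 0 r) θ)).differentiableWithinAt
  · exact integrable_const _
  · refine Filter.Eventually.of_forall fun θ w hw => ?_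
    simp only [hG, deriv_circleMap, norm_smul, norm_mul, norm_circleMap_zero, norm_zpow, norm_I,
      mul_one, abs_of_pos hr0]
    gcongr
    exact hM _ (hmem w hw θ)

lemma differentiableOn_BoxOp [NeZero n] {F : (Fin n → ℂ) → ℂ} {U : Set (Fin n → ℂ)} (hU : IsOpen U)
    (hF : DifferentiableOn ℂ F U) : DifferentiableOn ℂ (BoxOp F) U := by
  have : BoxOp F = fun z => -∑ i, sg i * pd i (pd i F) z := by ext z; exact BoxOp_eq F z
  rw [this]
  refine DifferentiableOn.neg (DifferentiableOn.fun_sum fun i _ => ?_)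
  exact (differentiableOn_pd hU (differentiableOn_pd hU hF i) i).const_mul _

end holo

section holo
variable {n : ℕ}

lemma measurePreserving_circleMap_smul (θ : ℝ) :
    MeasurePreserving (fun w : Fin n → ℂ => circleMap 0 1 θ • w) := by
  have h := volume_preserving_pi (f := fun (_ : Fin n) (z : ℂ) => circleMap 0 1 θ * z) (fun _ => by
    have := (rotation (Circle.exp θ)).measurePreserving
    have h2 : (fun z : ℂ => circleMap 0 1 θ * z) = rotation (Circle.exp θ) := by
      funext z
      simp [circleMap, rotation_apply, Circle.coe_exp]
    rw [h2]
    exact this)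
  exact h

lemma enorm_mul_volume_le {F : (Fin n → ℂ) → ℂ} {U : Set (Fin n → ℂ)} (hU : IsOpen U)
    (hF : DifferentiableOn ℂ F U) {z : Fin n → ℂ} {r : ℝ} (hz : Metric.closedBall z r ⊆ U) :
    ‖F z‖ₑ * volume (Metric.closedBall (0 : Fin n → ℂ) r) ≤ ∫⁻ w in Metric.closedBall z r, ‖F w‖ₑ := by
  set B := Metric.closedBall z r with hB
  have hBm : MeasurableSet B := measurableSet_closedBall
  set H : (Fin n → ℂ) → ℝ≥0∞ := B.indicator (fun w => ‖F w‖ₑ) with hH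
  have hHm : Measurable H := by
    have h1 : ContinuousOn (fun w => ‖F w‖ₑ) B := (hF.continuousOn.mono hz).enorm
    classical
    rw [hH, ← piecewise_eq_indicator]
    exact h1.measurable_piecewise continuous_const.continuousOn hBm
  have hmem : ∀ w ∈ Metric.closedBall (0 : Fin n → ℂ) r, ∀ ζ ∈ Metric.closedBall (0 : ℂ) 1,
      z + ζ • w ∈ B := by
    intro w hw ζ hζ
    rw [hB, mem_closedBall_iff_norm, add_sub_cancel_left, norm_smul]
    rw [mem_closedBall_zero_iff] at hw hζ
    calc ‖ζ‖ * ‖w‖ ≤ 1 * ‖w‖ := by gcongr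
      _ ≤ r := by linarith
  have hpt : ∀ w ∈ Metric.closedBall (0 : Fin n → ℂ) r, ‖F z‖ₑ ≤
      ENNReal.ofReal ((2 * Real.pi)⁻¹) * ∫⁻ θ in Ioc 0 (2 * Real.pi), H (z + circleMap 0 1 θ • w) := by
    intro w hw
    have hdc : DiffContOnCl ℂ (fun ζ : ℂ => F (z + ζ • w)) (Metric.ball 0 |1|) := by
      refine DifferentiableOn.diffContOnCl fun ζ hζ => ?_
      rw [abs_one, closure_ball _ one_ne_zero] at hζ
      have h1 := hF.differentiableAt (hU.mem_nhds (hz (hmem w hw ζ hζ)))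
      have h2 : DifferentiableAt ℂ (fun ζ : ℂ => F (z + ζ • w)) ζ :=
        DifferentiableAt.comp ζ h1 (by fun_prop)
      exact h2.differentiableWithinAt
    have h1 := hdc.circleAverage
    rw [Real.circleAverage, intervalIntegral.integral_of_le Real.two_pi_pos.le, zero_smul,
      add_zero] at h1
    rw [← h1, enorm_smul]
    refine mul_le_mul' ?_ ?_
    · rw [Real.enorm_eq_ofReal (by positivity)]
    · refine (enorm_integral_le_lintegral_enorm _).trans (lintegral_mono fun θ => ?_)
      rw [hH, indicator_of_mem (hmem w hw _ (by simp))]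
  calc ‖F z‖ₑ * volume (Metric.closedBall (0 : Fin n → ℂ) r)
      = ∫⁻ w in Metric.closedBall (0 : Fin n → ℂ) r, ‖F z‖ₑ := by rw [setLIntegral_const]
    _ ≤ ∫⁻ w in Metric.closedBall (0 : Fin n → ℂ) r, ENNReal.ofReal ((2 * Real.pi)⁻¹) *
          ∫⁻ θ in Ioc 0 (2 * Real.pi), H (z + circleMap 0 1 θ • w) :=
        setLIntegral_mono' measurableSet_closedBall hpt
    _ ≤ ∫⁻ w, ENNReal.ofReal ((2 * Real.pi)⁻¹) *
          ∫⁻ θ in Ioc 0 (2 * Real.pi), H (z + circleMap 0 1 θ • w) := setLIntegral_le_lintegral _ _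
    _ = ENNReal.ofReal ((2 * Real.pi)⁻¹) *
          ∫⁻ θ in Ioc 0 (2 * Real.pi), ∫⁻ w : Fin n → ℂ, H (z + circleMap 0 1 θ • w) := by
        rw [lintegral_const_mul' _ _ ENNReal.ofReal_ne_top, lintegral_lintegral_swap]
        refine Measurable.aemeasurable (hHm.comp ?_)
        have : Continuous fun q : (Fin n → ℂ) × ℝ => z + circleMap 0 1 q.2 • q.1 := by fun_prop
        exact this.measurable
    _ = ENNReal.ofReal ((2 * Real.pi)⁻¹) * ∫⁻ θ in Ioc 0 (2 * Real.pi), ∫⁻ w in B, ‖F w‖ₑ := by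
        congr 1
        refine lintegral_congr fun θ => ?_
        rw [(measurePreserving_circleMap_smul θ).lintegral_comp (f := fun w => H (z + w))
          (hHm.comp (by fun_prop)), lintegral_add_left_eq_self H z, hH, lintegral_indicator hBm]
    _ = ∫⁻ w in B, ‖F w‖ₑ := by
        rw [setLIntegral_const, Real.volume_Ioc, mul_comm, mul_assoc,
          ← ENNReal.ofReal_mul (by linarith [Real.two_pi_pos]), sub_zero,
          mul_inv_cancel₀ Real.two_pi_pos.ne', ENNReal.ofReal_one, mul_one]

lemma enorm_rpow_mul_volume_le {F : (Fin n → ℂ) → ℂ} {U : Set (Fin n → ℂ)} (hU : IsOpen U)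
    (hF : DifferentiableOn ℂ F U) {z : Fin n → ℂ} {r : ℝ} (hr : 0 < r)
    (hz : Metric.closedBall z r ⊆ U) {p : ℝ} (hp : 1 < p) :
    ‖F z‖ₑ ^ p * volume (Metric.closedBall (0 : Fin n → ℂ) r)
      ≤ ∫⁻ w in Metric.closedBall z r, ‖F w‖ₑ ^ p := by
  have h1 := enorm_mul_volume_le hU hF hz
  have hc : ContinuousOn (fun w => ‖F w‖ₑ) (Metric.closedBall z r) :=
    (hF.continuousOn.mono hz).enorm
  have hm : AEMeasurable (fun w => ‖F w‖ₑ) (volume.restrict (Metric.closedBall z r)) :=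
    hc.aemeasurable measurableSet_closedBall
  have hpq := Real.HolderConjugate.conjExponent hp
  set V := volume (Metric.closedBall (0 : Fin n → ℂ) r) with hV
  have hVz : volume (Metric.closedBall z r) = V := by
    rw [hV, Measure.addHaar_closedBall_center]
  have hV0 : V ≠ 0 := (Metric.measure_closedBall_pos _ _ hr).ne'
  have hVt : V ≠ ⊤ := measure_closedBall_lt_top.ne
  have h2 := ENNReal.lintegral_mul_le_Lp_mul_Lq (volume.restrict (Metric.closedBall z r)) hpq hm
    (g := fun _ => 1) aemeasurable_const
  simp only [Pi.mul_apply, mul_one, ENNReal.one_rpow, setLIntegral_one, hVz] at h2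
  have h3 := ENNReal.rpow_le_rpow (h1.trans h2) (by linarith : 0 ≤ p)
  rw [ENNReal.mul_rpow_of_nonneg _ _ (by linarith), ENNReal.mul_rpow_of_nonneg _ _ (by linarith),
    ← ENNReal.rpow_mul, one_div, inv_mul_cancel₀ (by linarith), ENNReal.rpow_one,
    ← ENNReal.rpow_mul] at h3
  have he : 1 / p.conjExponent * p = p - 1 := by
    rw [Real.conjExponent]; field_simp
  rw [he] at h3
  have h4 : V ^ p = V * V ^ (p - 1) := by
    conv_rhs => rw [← ENNReal.rpow_one V, ← ENNReal.rpow_mul, one_mul, ← ENNReal.rpow_add _ _ hV0 hVt]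
    congr 1; ring
  rw [h4, ← mul_assoc] at h3
  exact (ENNReal.mul_le_mul_iff_left (ENNReal.rpow_pos (pos_iff_ne_zero.2 hV0) hVt).ne'
    (ENNReal.rpow_ne_top_of_nonneg (by linarith) hVt)).1 h3

lemma differentiableOn_of_tendstoUniformlyOn {F : ℕ → (Fin n → ℂ) → ℂ} {f : (Fin n → ℂ) → ℂ}
    {U : Set (Fin n → ℂ)} (hF : ∀ k, DifferentiableOn ℂ (F k) U)
    (hlim : ∀ z ∈ U, ∃ r > 0, Metric.ball z r ⊆ U ∧
      TendstoUniformlyOn F f Filter.atTop (Metric.ball z r)) : DifferentiableOn ℂ f U := by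
  intro z hz
  obtain ⟨r, hr, hrU, hu⟩ := hlim z hz
  set B := Metric.ball z (r / 2) with hB
  have hsub : ∀ w ∈ B, Metric.ball w (r / 2) ⊆ Metric.ball z r := fun w hw =>
    Metric.ball_subset_ball' (by rw [hB, Metric.mem_ball] at hw; linarith)
  have hdiff : ∀ k, ∀ w ∈ Metric.ball z r, DifferentiableAt ℂ (F k) w := fun k w hw =>
    ((hF k).mono hrU).differentiableAt (Metric.isOpen_ball.mem_nhds hw)
  have hC : UniformCauchySeqOn (fun k => fderiv ℂ (F k)) Filter.atTop B := by
    rw [Metric.uniformCauchySeqOn_iff]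
    intro ε hε
    obtain ⟨K, hK⟩ := Metric.uniformCauchySeqOn_iff.1 hu.uniformCauchySeqOn (ε * r / 8) (by positivity)
    refine ⟨K, fun j hj k hk w hw => ?_⟩
    have hwr : w ∈ Metric.ball z r := Metric.ball_subset_ball (by linarith) hw
    rw [dist_eq_norm, ← fderiv_fun_sub (hdiff j w hwr) (hdiff k w hwr)]
    have h := norm_fderiv_le (F := fun v => F j v - F k v) (c := w) (r := r / 2) (M := ε * r / 8)
      (by linarith)
      (((hF j).mono ((hsub w hw).trans hrU)).sub ((hF k).mono ((hsub w hw).trans hrU)))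
      (fun v hv => by
        have := hK j hj k hk v (hsub w hw hv)
        rw [dist_eq_norm] at this
        exact this.le)
    refine lt_of_le_of_lt h ?_
    rw [div_lt_iff₀ (by linarith)]
    nlinarith [mul_pos hε hr]
  have hex : ∀ w ∈ B, ∃ L, Filter.Tendsto (fun k => fderiv ℂ (F k) w) Filter.atTop (nhds L) :=
    fun w hw => cauchySeq_tendsto_of_complete (hC.cauchySeq hw)
  choose! g' hg' using hex
  have h1 := hC.tendstoUniformlyOn_of_tendsto hg'
  have h2 := hasFDerivAt_of_tendstoUniformlyOn (x := z) Metric.isOpen_ball h1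
    (fun k w hw => (hdiff k w (Metric.ball_subset_ball (by linarith) hw)).hasFDerivAt)
    (fun w hw => hu.tendsto_at (Metric.ball_subset_ball (by linarith) hw))
    (Metric.mem_ball_self (by linarith))
  exact h2.differentiableAt.differentiableWithinAt

end holo

section local_bounds
variable {n : ℕ}

lemma exists_le_of_setLIntegral {z : Fin n → ℂ} {r : ℝ} (hr : 0 < r) {U : Set (Fin n → ℂ)}
    (hU : IsOpen U) (hz : Metric.closedBall z r ⊆ U) {p : ℝ} (hp : 1 < p) :
    ∃ C : ℝ≥0∞, C ≠ ⊤ ∧ C ≠ 0 ∧ ∀ F : (Fin n → ℂ) → ℂ, DifferentiableOn ℂ F U →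
      ∀ w ∈ Metric.closedBall z (r / 2),
        ‖F w‖ₑ ≤ C * (∫⁻ w in Metric.closedBall z r, ‖F w‖ₑ ^ p) ^ p⁻¹ := by
  set V := volume (Metric.closedBall (0 : Fin n → ℂ) (r / 2)) with hV
  have hV0 : V ≠ 0 := (Metric.measure_closedBall_pos _ _ (by linarith)).ne'
  have hVt : V ≠ ⊤ := measure_closedBall_lt_top.ne
  have hp0 : 0 < p := by linarith
  refine ⟨(V⁻¹) ^ p⁻¹, ENNReal.rpow_ne_top_of_nonneg (by positivity) (ENNReal.inv_ne_top.2 hV0),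
    (ENNReal.rpow_pos (ENNReal.inv_pos.2 hVt) (ENNReal.inv_ne_top.2 hV0)).ne', fun F hF w hw => ?_⟩
  have hsub : Metric.closedBall w (r / 2) ⊆ Metric.closedBall z r :=
    Metric.closedBall_subset_closedBall' (by rw [Metric.mem_closedBall] at hw; linarith)
  have h1 := enorm_rpow_mul_volume_le hU hF (by linarith : 0 < r / 2) (hsub.trans hz) hp
  have h2 := h1.trans (lintegral_mono_set hsub)
  rw [← ENNReal.le_div_iff_mul_le (Or.inl hV0) (Or.inl hVt), ENNReal.div_eq_inv_mul] at h2
  have h3 := ENNReal.rpow_le_rpow h2 (by positivity : 0 ≤ p⁻¹)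
  rwa [← ENNReal.rpow_mul, mul_inv_cancel₀ hp0.ne', ENNReal.rpow_one,
    ENNReal.mul_rpow_of_nonneg _ _ (by positivity)] at h3

variable [NeZero n]

lemma norm_BoxOp_le {F : (Fin n → ℂ) → ℂ} {z : Fin n → ℂ} {r M : ℝ} (hr : 0 < r)
    (hd : DifferentiableOn ℂ F (Metric.ball z r)) (hM : ∀ w ∈ Metric.ball z r, ‖F w‖ ≤ M) :
    ‖BoxOp F z‖ ≤ n * (2 * (2 * M / (r / 2)) / (r / 2)) := by
  rw [BoxOp_eq, norm_neg]
  refine (norm_sum_le _ _).trans ?_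
  have : ∀ i ∈ Finset.univ, ‖(sg i : ℂ) * pd i (pd i F) z‖ ≤ 2 * (2 * M / (r / 2)) / (r / 2) := by
    intro i _
    have hs : ‖(sg i : ℂ)‖ = 1 := by unfold sg; split_ifs <;> simp
    rw [norm_mul, hs, one_mul]
    refine norm_pd_le (by linarith) ((differentiableOn_pd Metric.isOpen_ball hd i).mono
      (Metric.ball_subset_ball (by linarith))) (fun w hw => ?_) i
    have hsub : Metric.ball w (r / 2) ⊆ Metric.ball z r :=
      Metric.ball_subset_ball' (by rw [Metric.mem_ball] at hw; linarith)
    exact norm_pd_le (by linarith) (hd.mono hsub) (fun v hv => hM v (hsub hv)) i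
  refine (Finset.sum_le_sum this).trans ?_
  simp

lemma exists_BoxOp_le_of_setLIntegral {z : Fin n → ℂ} {r : ℝ} (hr : 0 < r) {U : Set (Fin n → ℂ)}
    (hU : IsOpen U) (hz : Metric.closedBall z r ⊆ U) {p : ℝ} (hp : 1 < p) :
    ∃ C : ℝ≥0∞, C ≠ ⊤ ∧ ∀ F : (Fin n → ℂ) → ℂ, DifferentiableOn ℂ F U →
        ‖BoxOp F z‖ₑ ≤ C * (∫⁻ w in Metric.closedBall z r, ‖F w‖ₑ ^ p) ^ p⁻¹ := by
  obtain ⟨C, hC, hC0, h⟩ := exists_le_of_setLIntegral hr hU hz hp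
  set K : ℝ := n * (2 * (2 / (r / 2 / 2)) / (r / 2 / 2)) with hK
  have hn : (0 : ℝ) < n := by exact_mod_cast (NeZero.pos n)
  have hKp : 0 < K := by positivity
  refine ⟨ENNReal.ofReal K * C, ENNReal.mul_ne_top ENNReal.ofReal_ne_top hC, fun F hF => ?_⟩
  set I := C * (∫⁻ w in Metric.closedBall z r, ‖F w‖ₑ ^ p) ^ p⁻¹ with hI
  by_cases hIt : I = ⊤
  · rw [mul_assoc, ← hI, hIt, ENNReal.mul_top (by simpa using hKp)]
    exact le_top
  rw [mul_assoc, ← hI]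
  have h1 := norm_BoxOp_le (F := F) (z := z) (r := r / 2) (M := I.toReal) (by linarith)
    (hF.mono (((Metric.ball_subset_closedBall.trans
      (Metric.closedBall_subset_closedBall (by linarith))).trans hz))) (fun w hw => by
        have := h F hF w (Metric.ball_subset_closedBall hw)
        rw [← toReal_enorm]
        exact ENNReal.toReal_mono hIt this)
  rw [← ofReal_norm]
  calc ENNReal.ofReal ‖BoxOp F z‖ ≤ ENNReal.ofReal (K * I.toReal) := by
        refine ENNReal.ofReal_le_ofReal (h1.trans (le_of_eq ?_))
        rw [hK]; ring
    _ = ENNReal.ofReal K * I := by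
        rw [ENNReal.ofReal_mul hKp.le, ENNReal.ofReal_toReal hIt]

end local_bounds

section covariance
variable {m : ℕ} {G : Matrix (Fin (m + 2)) (Fin (m + 2)) ℝ} {A T : ℝ}

lemma hasFDerivAt_hmap (G : Matrix (Fin (m + 2)) (Fin (m + 2)) ℝ) (x : Fin (m + 2) → ℝ)
    (z : Fin (m + 2) → ℂ) :
    HasFDerivAt (hmap G x)
      (LinearMap.toContinuousLinearMap (Matrix.toLin' (G.map (fun r : ℝ => (r : ℂ))))) z :=
  ((LinearMap.toContinuousLinearMap
    (Matrix.toLin' (G.map (fun r : ℝ => (r : ℂ))))).hasFDerivAt).add_const _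

lemma differentiable_hmap (G : Matrix (Fin (m + 2)) (Fin (m + 2)) ℝ) (x : Fin (m + 2) → ℝ) :
    Differentiable ℂ (hmap G x) := fun z => (hasFDerivAt_hmap G x z).differentiableAt

lemma IsG.comp_hmap (hG : IsG G A T) (x : Fin (m + 2) → ℝ) {F : (Fin (m + 2) → ℂ) → ℂ}
    (hF : DifferentiableOn ℂ F (tube (m + 2))) :
    DifferentiableOn ℂ (fun z => F (hmap G x z)) (tube (m + 2)) :=
  hF.comp (differentiable_hmap G x).differentiableOn fun z hz => (hG.hmap_mem x z).2 hz

lemma pd_comp_hmap (x : Fin (m + 2) → ℝ) {F : (Fin (m + 2) → ℂ) → ℂ} {z : Fin (m + 2) → ℂ}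
    (hF : DifferentiableAt ℂ F (hmap G x z)) (i : Fin (m + 2)) :
    pd i (fun z => F (hmap G x z)) z = ∑ j, (G j i : ℂ) * pd j F (hmap G x z) := by
  have h := (hF.hasFDerivAt.comp z (hasFDerivAt_hmap G x z)).fderiv
  rw [pd]
  change fderiv ℂ (F ∘ hmap G x) z _ = _
  rw [h, ContinuousLinearMap.comp_apply, clm_eq_sum (fderiv ℂ F (hmap G x z))]
  simp only [_root_.sum_apply, _root_.smul_apply, ContinuousLinearMap.proj_apply, smul_eq_mul]
  refine Finset.sum_congr rfl fun j _ => ?_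
  rw [mul_comm]
  congr 1
  simp

lemma pd_sum_mul {c : Fin (m + 2) → ℂ} {F : Fin (m + 2) → (Fin (m + 2) → ℂ) → ℂ}
    {z : Fin (m + 2) → ℂ} (hF : ∀ j, DifferentiableAt ℂ (F j) z) (i : Fin (m + 2)) :
    pd i (fun z => ∑ j, c j * F j z) z = ∑ j, c j * pd i (F j) z := by
  simp only [pd]
  rw [fderiv_fun_sum fun j _ => (hF j).const_mul _, _root_.sum_apply]
  refine Finset.sum_congr rfl fun j _ => ?_
  rw [fderiv_const_mul (hF j)]
  rfl

lemma IsG.BoxOp_hmap (hG : IsG G A T) (x : Fin (m + 2) → ℝ) {F : (Fin (m + 2) → ℂ) → ℂ}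
    (hF : DifferentiableOn ℂ F (tube (m + 2))) {z : Fin (m + 2) → ℂ} (hz : z ∈ tube (m + 2)) :
    BoxOp (fun z => F (hmap G x z)) z = T * BoxOp F (hmap G x z) := by
  have hd : ∀ w ∈ tube (m + 2), DifferentiableAt ℂ F (hmap G x w) := fun w hw =>
    hF.differentiableAt (tube_isOpen.mem_nhds ((hG.hmap_mem x w).2 hw))
  have hd2 : ∀ j, ∀ w ∈ tube (m + 2), DifferentiableAt ℂ (pd j F) (hmap G x w) := fun j w hw =>
    (differentiableOn_pd tube_isOpen hF j).differentiableAt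
      (tube_isOpen.mem_nhds ((hG.hmap_mem x w).2 hw))
  have h2 : ∀ i, pd i (pd i (fun z => F (hmap G x z))) z
      = ∑ j, (G j i : ℂ) * ∑ k, (G k i : ℂ) * pd k (pd j F) (hmap G x z) := by
    intro i
    have he : pd i (fun z => F (hmap G x z)) =ᶠ[nhds z]
        fun z => ∑ j, (G j i : ℂ) * pd j F (hmap G x z) := by
      filter_upwards [tube_isOpen.mem_nhds hz] with w hw
      exact pd_comp_hmap x (hd w hw) i
    rw [pd_congr he i, pd_sum_mul (F := fun j z => pd j F (hmap G x z)) (fun j =>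
      (hd2 j z hz).comp z (differentiable_hmap G x z))]
    exact Finset.sum_congr rfl fun j _ => by rw [pd_comp_hmap x (hd2 j z hz)]
  have h3 : ∀ j k, ∑ i, sg i * ((G j i : ℂ) * G k i) = if j = k then T * sg j else 0 := by
    intro j k
    have := congrFun (congrFun hG.mul_transpose j) k
    rw [Matrix.mul_apply] at this
    simp only [lsig, Matrix.mul_diagonal, Matrix.transpose_apply, Matrix.smul_apply,
      Matrix.diagonal_apply, smul_eq_mul] at this
    have h4 := congrArg (fun r : ℝ => (r : ℂ)) this
    push_cast at h4
    convert h4 using 1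
    · refine Finset.sum_congr rfl fun i _ => ?_
      simp only [sg]; split_ifs <;> push_cast <;> ring
    · simp only [sg]; split_ifs <;> push_cast <;> ring
  rw [BoxOp_eq, BoxOp_eq, mul_neg]
  congr 1
  calc ∑ i, sg i * pd i (pd i (fun z => F (hmap G x z))) z
      = ∑ i, ∑ j, ∑ k, sg i * ((G j i : ℂ) * G k i) * pd k (pd j F) (hmap G x z) := by
        refine Finset.sum_congr rfl fun i _ => ?_
        rw [h2, Finset.mul_sum]
        refine Finset.sum_congr rfl fun j _ => ?_
        rw [Finset.mul_sum, Finset.mul_sum]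
        exact Finset.sum_congr rfl fun k _ => by ring
    _ = ∑ j, ∑ k, (∑ i, sg i * ((G j i : ℂ) * G k i)) * pd k (pd j F) (hmap G x z) := by
        rw [Finset.sum_comm]
        refine Finset.sum_congr rfl fun j _ => ?_
        rw [Finset.sum_comm]
        exact Finset.sum_congr rfl fun k _ => by rw [Finset.sum_mul]
    _ = T * ∑ i, sg i * pd i (pd i F) (hmap G x z) := by
        rw [Finset.mul_sum]
        refine Finset.sum_congr rfl fun j _ => ?_
        simp only [h3, ite_mul, zero_mul, Finset.sum_ite_eq, Finset.mem_univ, if_true]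
        ring

end covariance

/-- The weighted Bergman space `A²` of the measure `wM m s t`. -/
structure A2 (m : ℕ) (s t : ℝ) (F : (Fin (m + 2) → ℂ) → ℂ) : Prop where
  holo : DifferentiableOn ℂ F (tube (m + 2))
  memLp : MemLp F 2 (wM m s t)

section bergman
variable {m : ℕ} {s t : ℝ}

lemma exists_setLIntegral_le (s t : ℝ) {z : Fin (m + 2) → ℂ} {r : ℝ}
    (hz : Metric.closedBall z r ⊆ tube (m + 2)) :
    ∃ c : ℝ≥0∞, c ≠ ⊤ ∧ ∀ f : (Fin (m + 2) → ℂ) → ℝ≥0∞,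
      ∫⁻ w in Metric.closedBall z r, f w ≤ c * ∫⁻ w, f w ∂(wM m s t) := by
  have hc : ContinuousOn (fun w : Fin (m + 2) → ℂ => (wt s t (imP w))⁻¹) (Metric.closedBall z r) := by
    have h1 : ContinuousOn (fun w : Fin (m + 2) → ℂ => wt s t (imP w)) (Metric.closedBall z r) := by
      have hla : Continuous fun w : Fin (m + 2) → ℂ => la (imP w) := by
        unfold la; exact ((continuous_apply 0).comp imP_continuous).add
          ((continuous_apply 1).comp imP_continuous)
      refine ContinuousOn.mul ?_ ?_
      · exact hla.continuousOn.rpow_const fun w hw => Or.inl (mem_cone_iff.1 (hz hw)).2.ne'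
      · exact (lor_continuous.comp imP_continuous).continuousOn.rpow_const
          fun w hw => Or.inl (mem_cone_iff.1 (hz hw)).1.ne'
    exact h1.inv₀ fun w hw => (wt_pos s t (hz hw)).ne'
  obtain ⟨M, hM⟩ := (isCompact_closedBall z r).exists_bound_of_continuousOn hc
  refine ⟨ENNReal.ofReal M, ENNReal.ofReal_ne_top, fun f => ?_⟩
  rw [lintegral_wM, ← lintegral_const_mul' _ _ ENNReal.ofReal_ne_top]
  refine le_trans ?_ (lintegral_mono_set hz)
  refine setLIntegral_mono' measurableSet_closedBall fun w hw => ?_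
  have hp := wt_pos s t (show imP w ∈ cone (m + 2) from hz hw)
  have h := (le_abs_self _).trans (hM w hw)
  have hM0 : 0 ≤ M := (norm_nonneg _).trans (hM w hw)
  rw [← mul_assoc, ← ENNReal.ofReal_mul hM0]
  refine le_mul_of_one_le_left zero_le ?_
  rw [ENNReal.one_le_ofReal]
  rwa [inv_le_iff_one_le_mul₀ hp] at h

lemma eLpNorm_two {Ω : Type*} [MeasurableSpace Ω] (F : Ω → ℂ) (μ : Measure Ω) :
    eLpNorm F 2 μ = (∫⁻ w, ‖F w‖ₑ ^ (2 : ℝ) ∂μ) ^ (2 : ℝ)⁻¹ := by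
  rw [eLpNorm_eq_lintegral_rpow_enorm_toReal (by norm_num) (by norm_num)]
  simp

lemma exists_closedBall_subset_tube {z : Fin (m + 2) → ℂ} (hz : z ∈ tube (m + 2)) :
    ∃ r > 0, Metric.closedBall z r ⊆ tube (m + 2) :=
  Metric.nhds_basis_closedBall.mem_iff.1 (tube_isOpen.mem_nhds hz)

lemma exists_enorm_le_eLpNorm (s t : ℝ) {z : Fin (m + 2) → ℂ} (hz : z ∈ tube (m + 2)) :
    ∃ r > 0, Metric.closedBall z r ⊆ tube (m + 2) ∧ ∃ C : ℝ≥0∞, C ≠ ⊤ ∧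
      ∀ F : (Fin (m + 2) → ℂ) → ℂ, DifferentiableOn ℂ F (tube (m + 2)) →
        ∀ w ∈ Metric.closedBall z r, ‖F w‖ₑ ≤ C * eLpNorm F 2 (wM m s t) := by
  obtain ⟨r, hr, hrt⟩ := exists_closedBall_subset_tube hz
  obtain ⟨C, hC, -, h⟩ := exists_le_of_setLIntegral hr tube_isOpen hrt one_lt_two
  obtain ⟨c, hc, h'⟩ := exists_setLIntegral_le s t hrt
  refine ⟨r / 2, by linarith,
    (Metric.closedBall_subset_closedBall (by linarith)).trans hrt, C * c ^ (2 : ℝ)⁻¹,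
    ENNReal.mul_ne_top hC (ENNReal.rpow_ne_top_of_nonneg (by norm_num) hc), fun F hF w hw => ?_⟩
  refine (h F hF w hw).trans ?_
  rw [eLpNorm_two, mul_assoc, ← ENNReal.mul_rpow_of_nonneg _ _ (by norm_num)]
  gcongr
  exact h' _

lemma exists_enorm_BoxOp_le_eLpNorm (s t : ℝ) {z : Fin (m + 2) → ℂ} (hz : z ∈ tube (m + 2)) :
    ∃ C : ℝ≥0∞, C ≠ ⊤ ∧
      ∀ F : (Fin (m + 2) → ℂ) → ℂ, DifferentiableOn ℂ F (tube (m + 2)) →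
        ‖BoxOp F z‖ₑ ≤ C * eLpNorm F 2 (wM m s t) := by
  obtain ⟨r, hr, hrt⟩ := exists_closedBall_subset_tube hz
  obtain ⟨C, hC, h⟩ := exists_BoxOp_le_of_setLIntegral hr tube_isOpen hrt one_lt_two
  obtain ⟨c, hc, h'⟩ := exists_setLIntegral_le s t hrt
  refine ⟨C * c ^ (2 : ℝ)⁻¹,
    ENNReal.mul_ne_top hC (ENNReal.rpow_ne_top_of_nonneg (by norm_num) hc), fun F hF => ?_⟩
  refine (h F hF).trans ?_
  rw [eLpNorm_two, mul_assoc, ← ENNReal.mul_rpow_of_nonneg _ _ (by norm_num)]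
  gcongr
  exact h' _

lemma eqOn_of_ae_eq {F F' : (Fin (m + 2) → ℂ) → ℂ} (hF : ContinuousOn F (tube (m + 2)))
    (hF' : ContinuousOn F' (tube (m + 2))) (h : F =ᵐ[wM m s t] F') : EqOn F F' (tube (m + 2)) := by
  have h1 : ∀ᵐ z ∂(volume.restrict (tube (m + 2))), F z = F' z := (ae_wM_iff s t).1 h
  exact Measure.eqOn_open_of_ae_eq h1 tube_isOpen hF hF'

lemma A2.aesm {F : (Fin (m + 2) → ℂ) → ℂ} (hF : DifferentiableOn ℂ F (tube (m + 2))) :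
    AEStronglyMeasurable F (wM m s t) :=
  (hF.continuousOn.aestronglyMeasurable measurable_tube).mono_ac (withDensity_absolutelyContinuous _ _)

lemma A2.add {F F' : (Fin (m + 2) → ℂ) → ℂ} (h : A2 m s t F) (h' : A2 m s t F') :
    A2 m s t (F + F') := ⟨h.holo.add h'.holo, h.memLp.add h'.memLp⟩

lemma A2.const_smul {F : (Fin (m + 2) → ℂ) → ℂ} (h : A2 m s t F) (c : ℂ) :
    A2 m s t (c • F) := ⟨h.holo.const_smul c, h.memLp.const_smul c⟩

variable (m s t) in
/-- The Bergman space as a subspace of `L²`. -/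
def hol2 : Submodule ℂ (Lp ℂ 2 (wM m s t)) where
  carrier := {f | ∃ F, A2 m s t F ∧ f =ᵐ[wM m s t] F}
  add_mem' := by
    rintro f g ⟨F, hF, hf⟩ ⟨G, hG, hg⟩
    exact ⟨F + G, hF.add hG, (Lp.coeFn_add f g).trans (hf.add hg)⟩
  zero_mem' := ⟨0, ⟨differentiableOn_const 0, MemLp.zero⟩, Lp.coeFn_zero _ _ _⟩
  smul_mem' := by
    rintro c f ⟨F, hF, hf⟩
    exact ⟨c • F, hF.const_smul c, (Lp.coeFn_smul c f).trans (hf.const_smul c)⟩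

lemma isClosed_hol2 : IsClosed (hol2 m s t : Set (Lp ℂ 2 (wM m s t))) := by
  refine IsSeqClosed.isClosed fun f g hf hg => ?_
  choose F hF hfF using hf
  have hcau : ∀ z ∈ tube (m + 2), ∃ r > 0, Metric.ball z r ⊆ tube (m + 2) ∧
      UniformCauchySeqOn F Filter.atTop (Metric.ball z r) := by
    intro z hz
    obtain ⟨r, hr, hrt, C, hC, h⟩ := exists_enorm_le_eLpNorm s t hz
    refine ⟨r, hr, Metric.ball_subset_closedBall.trans hrt, ?_⟩
    rw [Metric.uniformCauchySeqOn_iff]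
    intro ε hε
    have hC1 : 0 < C.toReal + 1 := by positivity
    obtain ⟨K, hK⟩ := Metric.cauchySeq_iff.1 hg.cauchySeq (ε / (C.toReal + 1)) (by positivity)
    refine ⟨K, fun j hj k hk w hw => ?_⟩
    have h1 := h (F j - F k) ((hF j).holo.sub (hF k).holo) w (Metric.ball_subset_closedBall hw)
    have h2 : eLpNorm (F j - F k) 2 (wM m s t) = ‖f j - f k‖ₑ := by
      rw [Lp.enorm_def]
      exact eLpNorm_congr_ae (((hfF j).symm.sub (hfF k).symm).trans (Lp.coeFn_sub _ _).symm)
    rw [h2, ← ENNReal.ofReal_toReal hC, ← ofReal_norm, ← ofReal_norm,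
      ← ENNReal.ofReal_mul ENNReal.toReal_nonneg, ENNReal.ofReal_le_ofReal_iff (by positivity)] at h1
    rw [dist_eq_norm]
    have h3 := hK j hj k hk
    rw [dist_eq_norm, lt_div_iff₀ hC1] at h3
    have h4 : ‖(F j - F k) w‖ = ‖F j w - F k w‖ := rfl
    nlinarith [norm_nonneg (f j - f k)]
  have hex : ∀ z ∈ tube (m + 2), ∃ L, Filter.Tendsto (fun k => F k z) Filter.atTop (nhds L) := by
    intro z hz
    obtain ⟨r, hr, -, hu⟩ := hcau z hz
    exact cauchySeq_tendsto_of_complete (hu.cauchySeq (Metric.mem_ball_self hr))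
  choose! H hH using hex
  have hHd : DifferentiableOn ℂ H (tube (m + 2)) := by
    refine differentiableOn_of_tendstoUniformlyOn (fun k => (hF k).holo) fun z hz => ?_
    obtain ⟨r, hr, hrt, hu⟩ := hcau z hz
    exact ⟨r, hr, hrt, hu.tendstoUniformlyOn_of_tendsto fun w hw => hH w (hrt hw)⟩
  have hgH : g =ᵐ[wM m s t] H := by
    have h1 : TendstoInMeasure (wM m s t) (fun k => (f k : (Fin (m + 2) → ℂ) → ℂ)) Filter.atTop g :=
      tendstoInMeasure_of_tendsto_Lp hg
    obtain ⟨ns, hns, h2⟩ := h1.exists_seq_tendsto_ae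
    filter_upwards [h2, ae_all_iff.2 hfF, ae_wM s t] with z hz hz2 hzt
    have h3 := (hH z hzt).comp hns.tendsto_atTop
    refine tendsto_nhds_unique hz (h3.congr fun k => ?_)
    exact (hz2 (ns k)).symm
  exact ⟨H, ⟨hHd, (memLp_congr_ae hgH).1 (Lp.memLp g)⟩, hgH⟩

instance : CompleteSpace (hol2 m s t) := isClosed_hol2.completeSpace_coe

/-- The holomorphic representative. -/
def rep (f : hol2 m s t) : (Fin (m + 2) → ℂ) → ℂ := Classical.choose f.2

lemma A2_rep (f : hol2 m s t) : A2 m s t (rep f) := (Classical.choose_spec f.2).1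

lemma coe_ae_eq_rep (f : hol2 m s t) : (f : Lp ℂ 2 (wM m s t)) =ᵐ[wM m s t] rep f :=
  (Classical.choose_spec f.2).2

/-- A function of the Bergman space as a vector of the Hilbert space. -/
def A2.vec {F : (Fin (m + 2) → ℂ) → ℂ} (h : A2 m s t F) : hol2 m s t :=
  ⟨h.memLp.toLp F, F, h, h.memLp.coeFn_toLp⟩

lemma A2.rep_eqOn {F : (Fin (m + 2) → ℂ) → ℂ} (h : A2 m s t F) : EqOn (rep h.vec) F (tube (m + 2)) :=
  eqOn_of_ae_eq (s := s) (t := t) (A2_rep _).holo.continuousOn h.holo.continuousOn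
    ((coe_ae_eq_rep h.vec).symm.trans h.memLp.coeFn_toLp)

lemma rep_add (f g : hol2 m s t) : EqOn (rep (f + g)) (rep f + rep g) (tube (m + 2)) :=
  eqOn_of_ae_eq (s := s) (t := t) (A2_rep _).holo.continuousOn ((A2_rep f).add (A2_rep g)).holo.continuousOn
    ((coe_ae_eq_rep (f + g)).symm.trans ((Lp.coeFn_add _ _).trans
      ((coe_ae_eq_rep f).add (coe_ae_eq_rep g))))

lemma rep_smul (c : ℂ) (f : hol2 m s t) : EqOn (rep (c • f)) (c • rep f) (tube (m + 2)) :=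
  eqOn_of_ae_eq (s := s) (t := t) (A2_rep _).holo.continuousOn ((A2_rep f).const_smul c).holo.continuousOn
    ((coe_ae_eq_rep (c • f)).symm.trans ((Lp.coeFn_smul _ _).trans
      ((coe_ae_eq_rep f).const_smul c)))

lemma inner_hol2 (f g : hol2 m s t) :
    inner ℂ f g = ∫ z, rep g z * (starRingEnd ℂ) (rep f z) ∂(wM m s t) := by
  rw [Submodule.coe_inner, L2.inner_def]
  refine integral_congr_ae ?_
  filter_upwards [coe_ae_eq_rep f, coe_ae_eq_rep g] with z h1 h2
  rw [h1, h2]; rfl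

lemma enorm_hol2 (f : hol2 m s t) : ‖f‖ₑ = eLpNorm (rep f) 2 (wM m s t) := by
  change ‖(f : Lp ℂ 2 (wM m s t))‖ₑ = _
  rw [Lp.enorm_def]
  exact eLpNorm_congr_ae (coe_ae_eq_rep f)

variable (m s t) in
/-- Bounded linear functionals on the Bergman space, at the level of functions. -/
structure BF (L : ((Fin (m + 2) → ℂ) → ℂ) → ℂ) : Prop where
  add : ∀ F F', A2 m s t F → A2 m s t F' → L (F + F') = L F + L F'
  smul : ∀ (c : ℂ) F, A2 m s t F → L (c • F) = c * L F
  congr : ∀ F F', EqOn F F' (tube (m + 2)) → L F = L F'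
  bound : ∃ C : ℝ≥0∞, C ≠ ⊤ ∧ ∀ F, A2 m s t F → ‖L F‖ₑ ≤ C * eLpNorm F 2 (wM m s t)

theorem BF.riesz {L : ((Fin (m + 2) → ℂ) → ℂ) → ℂ} (h : BF m s t L) :
    ∃ H, A2 m s t H ∧ ∀ F, A2 m s t F → L F = ∫ z, F z * (starRingEnd ℂ) (H z) ∂(wM m s t) := by
  obtain ⟨C, hC, hb⟩ := h.bound
  let l : hol2 m s t →ₗ[ℂ] ℂ :=
    { toFun := fun f => L (rep f)
      map_add' := fun f g => by
        rw [h.congr _ _ (rep_add f g), h.add _ _ (A2_rep f) (A2_rep g)]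
      map_smul' := fun c f => by
        rw [h.congr _ _ (rep_smul c f), h.smul _ _ (A2_rep f)]; rfl }
  let ell : hol2 m s t →L[ℂ] ℂ := l.mkContinuous C.toReal fun f => by
    have h1 := hb _ (A2_rep f)
    rw [← enorm_hol2, ← ENNReal.ofReal_toReal hC, ← ofReal_norm, ← ofReal_norm,
      ← ENNReal.ofReal_mul ENNReal.toReal_nonneg, ENNReal.ofReal_le_ofReal_iff (by positivity)] at h1
    exact h1
  set v := (InnerProductSpace.toDual ℂ (hol2 m s t)).symm ell with hv
  refine ⟨rep v, A2_rep v, fun F hF => ?_⟩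
  have h1 : inner ℂ v hF.vec = ell hF.vec := InnerProductSpace.toDual_symm_apply
  have h2 : ell hF.vec = L F := h.congr _ _ hF.rep_eqOn
  rw [← h2, ← h1, inner_hol2]
  refine integral_congr_ae ?_
  filter_upwards [ae_wM s t] with z hz
  rw [hF.rep_eqOn hz]

lemma BF_eval (s t : ℝ) {z : Fin (m + 2) → ℂ} (hz : z ∈ tube (m + 2)) : BF m s t fun F => F z where
  add _ _ _ _ := rfl
  smul _ _ _ := rfl
  congr _ _ h := h hz
  bound := by
    obtain ⟨r, hr, -, C, hC, h⟩ := exists_enorm_le_eLpNorm s t hz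
    exact ⟨C, hC, fun F hF => h F hF.holo z (Metric.mem_closedBall_self hr.le)⟩

lemma BoxOp_congr {F F' : (Fin (m + 2) → ℂ) → ℂ} (h : EqOn F F' (tube (m + 2)))
    {z : Fin (m + 2) → ℂ} (hz : z ∈ tube (m + 2)) : BoxOp F z = BoxOp F' z := by
  rw [BoxOp_eq, BoxOp_eq]
  have h1 : ∀ i, ∀ w ∈ tube (m + 2), pd i F w = pd i F' w := fun i w hw =>
    pd_congr (h.eventuallyEq_of_mem (tube_isOpen.mem_nhds hw)) i
  have h2 : ∀ i, pd i (pd i F) z = pd i (pd i F') z := fun i =>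
    pd_congr (EqOn.eventuallyEq_of_mem (h1 i) (tube_isOpen.mem_nhds hz)) i
  simp only [h2]

lemma BoxOp_add {F F' : (Fin (m + 2) → ℂ) → ℂ} (hF : DifferentiableOn ℂ F (tube (m + 2)))
    (hF' : DifferentiableOn ℂ F' (tube (m + 2))) {z : Fin (m + 2) → ℂ} (hz : z ∈ tube (m + 2)) :
    BoxOp (F + F') z = BoxOp F z + BoxOp F' z := by
  have key : ∀ {H H' : (Fin (m + 2) → ℂ) → ℂ}, DifferentiableOn ℂ H (tube (m + 2)) →
      DifferentiableOn ℂ H' (tube (m + 2)) → ∀ i, ∀ w ∈ tube (m + 2),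
        pd i (H + H') w = pd i H w + pd i H' w := by
    intro H H' hH hH' i w hw
    rw [pd, fderiv_add (hH.differentiableAt (tube_isOpen.mem_nhds hw))
      (hH'.differentiableAt (tube_isOpen.mem_nhds hw))]
    rfl
  have h2 : ∀ i, pd i (pd i (F + F')) z = pd i (pd i F) z + pd i (pd i F') z := fun i => by
    rw [pd_congr (EqOn.eventuallyEq_of_mem (s := tube (m + 2)) (g := pd i F + pd i F')
      (fun w hw => key hF hF' i w hw) (tube_isOpen.mem_nhds hz)) i]
    exact key (differentiableOn_pd tube_isOpen hF i) (differentiableOn_pd tube_isOpen hF' i) i z hz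
  rw [BoxOp_eq, BoxOp_eq, BoxOp_eq]
  simp only [h2, mul_add, Finset.sum_add_distrib, neg_add]

lemma BoxOp_smul (c : ℂ) {F : (Fin (m + 2) → ℂ) → ℂ} (hF : DifferentiableOn ℂ F (tube (m + 2)))
    {z : Fin (m + 2) → ℂ} (hz : z ∈ tube (m + 2)) :
    BoxOp (c • F) z = c * BoxOp F z := by
  have key : ∀ {H : (Fin (m + 2) → ℂ) → ℂ}, DifferentiableOn ℂ H (tube (m + 2)) →
      ∀ i, ∀ w ∈ tube (m + 2), pd i (c • H) w = c * pd i H w := by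
    intro H hH i w hw
    rw [pd, fderiv_const_smul (hH.differentiableAt (tube_isOpen.mem_nhds hw))]
    rfl
  have h2 : ∀ i, pd i (pd i (c • F)) z = c * pd i (pd i F) z := fun i => by
    rw [pd_congr (EqOn.eventuallyEq_of_mem (s := tube (m + 2)) (g := c • pd i F)
      (fun w hw => key hF i w hw) (tube_isOpen.mem_nhds hz)) i]
    exact key (differentiableOn_pd tube_isOpen hF i) i z hz
  rw [BoxOp_eq, BoxOp_eq]
  simp only [h2, mul_neg, Finset.mul_sum]
  congr 1
  exact Finset.sum_congr rfl fun i _ => by ring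

lemma BF_BoxOp (s t : ℝ) {z : Fin (m + 2) → ℂ} (hz : z ∈ tube (m + 2)) :
    BF m s t fun F => BoxOp F z where
  add _ _ h h' := BoxOp_add h.holo h'.holo hz
  smul c _ h := BoxOp_smul c h.holo hz
  congr _ _ h := BoxOp_congr h hz
  bound := by
    obtain ⟨C, hC, h⟩ := exists_enorm_BoxOp_le_eLpNorm s t hz
    exact ⟨C, hC, fun F hF => h F hF.holo⟩

end bergman

section pairing
variable {Ω : Type*} [MeasurableSpace Ω] {μ : Measure Ω}

lemma enorm_integral_mul_conj_le {F f : Ω → ℂ} (hF : AEStronglyMeasurable F μ)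
    (hf : AEStronglyMeasurable f μ) :
    ‖∫ z, F z * (starRingEnd ℂ) (f z) ∂μ‖ₑ ≤ eLpNorm f 2 μ * eLpNorm F 2 μ := by
  refine (enorm_integral_le_lintegral_enorm _).trans ?_
  have h := ENNReal.lintegral_mul_le_Lp_mul_Lq μ Real.HolderConjugate.two_two hF.enorm hf.enorm
  rw [eLpNorm_two, eLpNorm_two, mul_comm]
  simp only [one_div] at h
  refine le_trans (le_of_eq (lintegral_congr fun z => ?_)) h
  rw [enorm_mul, Pi.mul_apply]
  congr 1
  rw [← ofReal_norm, ← ofReal_norm, RCLike.norm_conj]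

lemma integrable_mul_conj {F f : Ω → ℂ} (hF : MemLp F 2 μ) (hf : MemLp f 2 μ) :
    Integrable (fun z => F z * (starRingEnd ℂ) (f z)) μ :=
  hF.integrable_mul hf.star

lemma integral_mul_conj_symm (F f : Ω → ℂ) :
    ∫ z, F z * (starRingEnd ℂ) (f z) ∂μ
      = (starRingEnd ℂ) (∫ z, f z * (starRingEnd ℂ) (F z) ∂μ) := by
  rw [← integral_conj]
  simp [mul_comm]

end pairing

section kernel
variable {m : ℕ} {s t : ℝ}

lemma BF_inner {f : (Fin (m + 2) → ℂ) → ℂ} (hf : MemLp f 2 (wM m s t)) :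
    BF m s t fun F => ∫ z, F z * (starRingEnd ℂ) (f z) ∂(wM m s t) where
  add F F' h h' := by
    rw [← integral_add (integrable_mul_conj h.memLp hf) (integrable_mul_conj h'.memLp hf)]
    simp only [Pi.add_apply, add_mul]
  smul c F h := by
    rw [← integral_const_mul]
    simp only [Pi.smul_apply, smul_eq_mul, mul_assoc]
  congr F F' h := by
    refine integral_congr_ae ?_
    filter_upwards [ae_wM s t] with z hz
    rw [h hz]
  bound := ⟨_, hf.2.ne, fun F hF => enorm_integral_mul_conj_le hF.memLp.1 hf.1⟩

lemma BF.sub {L L' : ((Fin (m + 2) → ℂ) → ℂ) → ℂ} (h : BF m s t L) (h' : BF m s t L') :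
    BF m s t fun F => L F - L' F where
  add F F' hF hF' := by rw [h.add F F' hF hF', h'.add F F' hF hF']; ring
  smul c F hF := by rw [h.smul c F hF, h'.smul c F hF]; ring
  congr F F' hF := by rw [h.congr F F' hF, h'.congr F F' hF]
  bound := by
    obtain ⟨C, hC, hb⟩ := h.bound
    obtain ⟨C', hC', hb'⟩ := h'.bound
    refine ⟨C + C', ENNReal.add_ne_top.2 ⟨hC, hC'⟩, fun F hF => ?_⟩
    rw [add_mul]
    exact enorm_sub_le.trans (add_le_add (hb F hF) (hb' F hF))

lemma BF.const_mul {L : ((Fin (m + 2) → ℂ) → ℂ) → ℂ} (h : BF m s t L) (c : ℂ) :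
    BF m s t fun F => c * L F where
  add F F' hF hF' := by rw [h.add F F' hF hF']; ring
  smul c F hF := by rw [h.smul c F hF]; ring
  congr F F' hF := by rw [h.congr F F' hF]
  bound := by
    obtain ⟨C, hC, hb⟩ := h.bound
    refine ⟨‖c‖ₑ * C, ENNReal.mul_ne_top enorm_ne_top hC, fun F hF => ?_⟩
    rw [enorm_mul, mul_assoc]
    gcongr
    exact hb F hF

open Classical in
variable (m s t) in
/-- The reproducing kernel of the Bergman space (as a function of `z`, with pole `w`). -/
def bk (w : Fin (m + 2) → ℂ) : (Fin (m + 2) → ℂ) → ℂ :=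
  if hw : w ∈ tube (m + 2) then Classical.choose (BF_eval s t hw).riesz else 0

lemma A2_bk (w : Fin (m + 2) → ℂ) : A2 m s t (bk m s t w) := by
  unfold bk
  split_ifs with hw
  · exact (Classical.choose_spec (BF_eval s t hw).riesz).1
  · exact ⟨differentiableOn_const 0, MemLp.zero⟩

lemma A2.repro {F : (Fin (m + 2) → ℂ) → ℂ} (hF : A2 m s t F) {w : Fin (m + 2) → ℂ}
    (hw : w ∈ tube (m + 2)) :
    F w = ∫ z, F z * (starRingEnd ℂ) (bk m s t w z) ∂(wM m s t) := by
  rw [bk, dif_pos hw]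
  exact (Classical.choose_spec (BF_eval s t hw).riesz).2 F hF

lemma bk_symm {z w : Fin (m + 2) → ℂ} (hz : z ∈ tube (m + 2)) (hw : w ∈ tube (m + 2)) :
    bk m s t z w = (starRingEnd ℂ) (bk m s t w z) := by
  rw [(A2_bk z).repro hw, (A2_bk w).repro hz]
  exact integral_mul_conj_symm _ _

theorem BF.repr {L : ((Fin (m + 2) → ℂ) → ℂ) → ℂ} (h : BF m s t L) :
    ∃ H, A2 m s t H ∧ (∀ u ∈ tube (m + 2), H u = (starRingEnd ℂ) (L (bk m s t u))) ∧
      ∀ F, A2 m s t F → L F = ∫ z, F z * (starRingEnd ℂ) (H z) ∂(wM m s t) := by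
  obtain ⟨H, hH, hL⟩ := h.riesz
  refine ⟨H, hH, fun u hu => ?_, hL⟩
  rw [hL _ (A2_bk u), hH.repro hu]
  exact integral_mul_conj_symm _ _

theorem BF.eq_zero {L : ((Fin (m + 2) → ℂ) → ℂ) → ℂ} (h : BF m s t L)
    (h0 : ∀ u ∈ tube (m + 2), L (bk m s t u) = 0) {F : (Fin (m + 2) → ℂ) → ℂ} (hF : A2 m s t F) :
    L F = 0 := by
  obtain ⟨H, -, hHu, hL⟩ := h.repr
  rw [hL F hF]
  refine integral_eq_zero_of_ae ?_
  filter_upwards [ae_wM s t] with z hz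
  rw [hHu z hz, h0 z hz]
  simp

/-- Uniqueness of the reproducing kernel. -/
lemma bk_eq_of_repro {w : Fin (m + 2) → ℂ} (hw : w ∈ tube (m + 2)) {φ : (Fin (m + 2) → ℂ) → ℂ}
    (hφ : A2 m s t φ)
    (h : ∀ F, A2 m s t F → F w = ∫ z, F z * (starRingEnd ℂ) (φ z) ∂(wM m s t)) :
    EqOn (bk m s t w) φ (tube (m + 2)) := by
  intro z hz
  rw [bk_symm hw hz, h _ (A2_bk z), hφ.repro hz, integral_mul_conj_symm]
  simp

variable {G : Matrix (Fin (m + 2)) (Fin (m + 2)) ℝ} {A T : ℝ}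

lemma IsG.inv (hG : IsG G A T) : IsG G⁻¹ A⁻¹ T⁻¹ := by
  have hu : IsUnit G.det := isUnit_iff_ne_zero.2 hG.det_ne
  have h : ∀ v, G.mulVec (G⁻¹.mulVec v) = v := fun v => by
    rw [Matrix.mulVec_mulVec, Matrix.mul_nonsing_inv _ hu, Matrix.one_mulVec]
  refine ⟨inv_pos.2 hG.A_pos, inv_pos.2 hG.T_pos, fun v => ?_, fun v => ?_⟩
  · rw [eq_inv_mul_iff_mul_eq₀ hG.T_pos.ne', ← hG.lor_eq, h]
  · rw [eq_inv_mul_iff_mul_eq₀ hG.A_pos.ne', ← hG.la_eq, h]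

lemma IsG.hmap_inv (hG : IsG G A T) (x : Fin (m + 2) → ℝ) (z : Fin (m + 2) → ℂ) :
    hmap G⁻¹ (-G⁻¹.mulVec x) (hmap G x z) = z := by
  have hu : IsUnit G.det := isUnit_iff_ne_zero.2 hG.det_ne
  rw [← cmk_reP_imP (hmap _ _ _), ← cmk_reP_imP z, imP_hmap, imP_hmap, hmap, reP_add_ofR,
    reP_mulVec, hmap, reP_add_ofR, reP_mulVec, Matrix.mulVec_add, Matrix.mulVec_mulVec,
    Matrix.mulVec_mulVec, Matrix.nonsing_inv_mul _ hu, Matrix.one_mulVec, Matrix.one_mulVec,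
    add_neg_cancel_right, cmk_reP_imP]

lemma IsG.integral_hmap (hG : IsG G A T) (s t : ℝ) (x : Fin (m + 2) → ℝ)
    (f : (Fin (m + 2) → ℂ) → ℂ) :
    ∫ z, f (hmap G x z) ∂(wM m s t)
      = (((A ^ s * T ^ t * T ^ (m + 2))⁻¹ : ℝ) : ℂ) * ∫ z, f z ∂(wM m s t) := by
  have hpos : 0 < (A ^ s * T ^ t * T ^ (m + 2))⁻¹ := inv_pos.2 (mul_pos (mul_pos
    (Real.rpow_pos_of_pos hG.A_pos _) (Real.rpow_pos_of_pos hG.T_pos _)) (pow_pos hG.T_pos _))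
  rw [← (hG.hmap_emb x).integral_map, hG.map_hmap_wM, integral_smul_measure,
    ENNReal.toReal_ofReal hpos.le, real_smul]

lemma A2.comp_hmap (hG : IsG G A T) (x : Fin (m + 2) → ℝ) {F : (Fin (m + 2) → ℂ) → ℂ}
    (hF : A2 m s t F) : A2 m s t fun z => F (hmap G x z) := by
  refine ⟨hG.comp_hmap x hF.holo, ?_⟩
  refine MemLp.comp_of_map (g := F) ?_ (hG.hmap_emb x).measurable.aemeasurable
  rw [hG.map_hmap_wM]
  exact hF.memLp.smul_measure ENNReal.ofReal_ne_top

lemma IsG.bk_hmap (hG : IsG G A T) (x : Fin (m + 2) → ℝ) {z w : Fin (m + 2) → ℂ}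
    (hz : z ∈ tube (m + 2)) (hw : w ∈ tube (m + 2)) :
    bk m s t (hmap G x w) (hmap G x z)
      = (((A ^ s * T ^ t * T ^ (m + 2))⁻¹ : ℝ) : ℂ) * bk m s t w z := by
  have hpos : 0 < (A ^ s * T ^ t * T ^ (m + 2)) := (mul_pos (mul_pos
    (Real.rpow_pos_of_pos hG.A_pos _) (Real.rpow_pos_of_pos hG.T_pos _)) (pow_pos hG.T_pos _))
  set c : ℝ := (A ^ s * T ^ t * T ^ (m + 2)) with hc
  have hcne : (c : ℂ) ≠ 0 := by exact_mod_cast hpos.ne'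
  have hw' := (hG.hmap_mem x w).2 hw
  have h := bk_eq_of_repro hw
    (((A2_bk (s := s) (t := t) (hmap G x w)).comp_hmap hG x).const_smul (c : ℂ)) (fun F hF => by
      have h1 := hF.comp_hmap hG.inv (-G⁻¹.mulVec x)
      have h2 := h1.repro hw'
      rw [hG.hmap_inv] at h2
      have h3 := hG.integral_hmap s t x (fun z => F (hmap G⁻¹ (-G⁻¹.mulVec x) z)
        * (starRingEnd ℂ) (bk m s t (hmap G x w) z))
      rw [← h2, ← hc] at h3
      simp only [hG.hmap_inv] at h3
      push_cast at h3
      rw [eq_inv_mul_iff_mul_eq₀ hcne, ← integral_const_mul] at h3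
      rw [← h3]
      refine integral_congr_ae (Filter.Eventually.of_forall fun z => ?_)
      simp only [Pi.smul_apply, smul_eq_mul, map_mul, conj_ofReal]
      ring)
  have h1 := h hz
  simp only [Pi.smul_apply, smul_eq_mul] at h1
  rw [h1]
  push_cast
  rw [inv_mul_cancel_left₀ hcne]

end kernel

section polarization

lemma eq_zero_of_line {g : ℂ → ℂ} {S : Set ℂ} (hS : IsOpen S) (hconv : Convex ℝ S) (h0 : (0 : ℂ) ∈ S)
    (hg : DifferentiableOn ℂ g S) {c : ℂ} (hc : c ≠ 0) (h : ∀ τ : ℝ, (τ : ℂ) * c ∈ S → g (τ * c) = 0)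
    {ζ : ℂ} (hζ : ζ ∈ S) : g ζ = 0 := by
  refine AnalyticOnNhd.eqOn_zero_of_preconnected_of_frequently_eq_zero (hg.analyticOnNhd hS)
    hconv.isPreconnected h0 ?_ hζ
  have ht : Filter.Tendsto (fun k : ℕ => (((k : ℝ) + 1)⁻¹ : ℝ) * c) Filter.atTop
      (nhdsWithin 0 {0}ᶜ) := by
    refine tendsto_nhdsWithin_iff.2 ⟨?_, Filter.Eventually.of_forall fun k => ?_⟩
    · have h1 : Filter.Tendsto (fun k : ℕ => ((k : ℝ) + 1)⁻¹) Filter.atTop (nhds 0) := by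
        simpa using tendsto_one_div_add_atTop_nhds_zero_nat (𝕜 := ℝ)
      have h2 : Continuous fun τ : ℝ => (τ : ℂ) * c := by fun_prop
      have h3 := (h2.tendsto 0).comp h1
      rwa [ofReal_zero, zero_mul] at h3
    · have : ((k : ℝ) + 1)⁻¹ ≠ 0 := by positivity
      exact mul_ne_zero (by exact_mod_cast this) hc
  refine ht.frequently (Filter.Eventually.frequently ?_)
  have h4 := (tendsto_nhdsWithin_iff.1 ht).1.eventually (hS.mem_nhds h0)
  filter_upwards [h4] with k hk
  exact h _ hk

variable {m : ℕ}

lemma convex_line (a b : Fin (m + 2) → ℂ) : Convex ℝ {ζ : ℂ | a + ζ • b ∈ tube (m + 2)} := by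
  intro ζ hζ ξ hξ p q hp hq hpq
  have h := tube_convex hζ hξ hp hq hpq
  have he : p • (a + ζ • b) + q • (a + ξ • b) = a + (p • ζ + q • ξ) • b := by
    ext i
    simp only [Pi.add_apply, Pi.smul_apply, smul_eq_mul, real_smul]
    have : (p : ℂ) + q = 1 := by exact_mod_cast hpq
    linear_combination (a i) * this
  rw [he] at h
  exact h

lemma isOpen_line (a b : Fin (m + 2) → ℂ) : IsOpen {ζ : ℂ | a + ζ • b ∈ tube (m + 2)} :=
  tube_isOpen.preimage (by fun_prop : Continuous fun ζ : ℂ => a + ζ • b)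

/-- Hermitian kernels on the tube, holomorphic in the first variable and invariant under real
translations. -/
structure IsTK (K : (Fin (m + 2) → ℂ) → (Fin (m + 2) → ℂ) → ℂ) : Prop where
  holo : ∀ w ∈ tube (m + 2), DifferentiableOn ℂ (fun z => K z w) (tube (m + 2))
  herm : ∀ z ∈ tube (m + 2), ∀ w ∈ tube (m + 2), K w z = (starRingEnd ℂ) (K z w)
  trans : ∀ x : Fin (m + 2) → ℝ, ∀ z ∈ tube (m + 2), ∀ w ∈ tube (m + 2),
    K (z + ofR x) (w + ofR x) = K z w

lemma mem_tube_add_ofR {z : Fin (m + 2) → ℂ} (x : Fin (m + 2) → ℝ) :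
    z + ofR x ∈ tube (m + 2) ↔ z ∈ tube (m + 2) := by
  change imP (z + ofR x) ∈ cone (m + 2) ↔ imP z ∈ cone (m + 2)
  rw [imP_add_ofR]

namespace IsTK
variable {K : (Fin (m + 2) → ℂ) → (Fin (m + 2) → ℂ) → ℂ}

lemma holo_line (hK : IsTK K) (a b : Fin (m + 2) → ℂ) {w : Fin (m + 2) → ℂ} (hw : w ∈ tube (m + 2)) :
    DifferentiableOn ℂ (fun ζ : ℂ => K (a + ζ • b) w) {ζ : ℂ | a + ζ • b ∈ tube (m + 2)} :=
  (hK.holo w hw).comp (by fun_prop : Differentiable ℂ fun ζ : ℂ => a + ζ • b).differentiableOn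
    fun _ h => h

/-- Translations in imaginary directions. -/
lemma shift (hK : IsTK K) {z w : Fin (m + 2) → ℂ} (hz : z ∈ tube (m + 2)) (hw : w ∈ tube (m + 2))
    (b : Fin (m + 2) → ℝ) (hz' : z + I • ofR b ∈ tube (m + 2)) (hw' : w + I • ofR b ∈ tube (m + 2)) :
    K (z + I • ofR b) w = K z (w + I • ofR b) := by
  set S : Set ℂ := {ζ : ℂ | z + ζ • ofR b ∈ tube (m + 2)} with hS
  set S' : Set ℂ := {ζ : ℂ | w + ζ • ofR b ∈ tube (m + 2)} with hS'
  have hre : ∀ ζ : ℂ, w + (-(starRingEnd ℂ) ζ) • ofR b = w + ζ • ofR b + ofR ((-2 * ζ.re) • b) := by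
    intro ζ
    ext i
    simp only [Pi.add_apply, Pi.smul_apply, smul_eq_mul, ofR]
    push_cast
    have : (starRingEnd ℂ) ζ = 2 * ζ.re - ζ := by
      have := add_conj ζ
      push_cast at this
      linear_combination this
    rw [this]; ring
  have hmem : ∀ ζ ∈ S', w + (-(starRingEnd ℂ) ζ) • ofR b ∈ tube (m + 2) := fun ζ hζ => by
    rw [hre, mem_tube_add_ofR]; exact hζ
  have key := eq_zero_of_line (g := fun ζ => K (z + ζ • ofR b) w
      - (starRingEnd ℂ) (K (w + (-(starRingEnd ℂ) ζ) • ofR b) z)) (S := S ∩ S')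
    ((isOpen_line _ _).inter (isOpen_line _ _)) ((convex_line _ _).inter (convex_line _ _))
    ⟨by simpa [hS] using hz, by simpa [hS'] using hw⟩ ?_ one_ne_zero ?_ (ζ := I) ⟨hz', hw'⟩
  · rw [sub_eq_zero] at key
    simp only [conj_I, neg_neg] at key
    rw [key, hK.herm z hz _ hw', conj_conj]
  · refine ((hK.holo_line z (ofR b) hw).mono inter_subset_left).sub fun ζ hζ => ?_
    have h1 : DifferentiableAt ℂ (fun ξ : ℂ => K (w + (-ξ) • ofR b) z) ((starRingEnd ℂ) ζ) := by
      have h2 : DifferentiableAt ℂ (fun ξ : ℂ => K (w + ξ • ofR b) z) (-(starRingEnd ℂ) ζ) :=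
        (hK.holo_line w (ofR b) hz).differentiableAt
          ((isOpen_line _ _).mem_nhds (hmem ζ hζ.2))
      exact h2.comp ((starRingEnd ℂ) ζ) (by fun_prop : DifferentiableAt ℂ (fun ξ : ℂ => -ξ) _)
    have h3 := h1.hasDerivAt.conj_conj
    rw [conj_conj] at h3
    exact h3.differentiableAt.differentiableWithinAt
  · intro τ hτ
    rw [mul_one] at hτ ⊢
    rw [sub_eq_zero, conj_ofReal]
    have e1 : z + (τ : ℂ) • ofR b = z + ofR (τ • b) := by
      ext i; simp [ofR]
    have e2 : w = w + (-(τ : ℂ)) • ofR b + ofR (τ • b) := by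
      ext i; simp [ofR]
    have hw2 : w + (-(τ : ℂ)) • ofR b ∈ tube (m + 2) := by
      have := hmem τ hτ.2
      rwa [conj_ofReal] at this
    rw [e1]
    conv_lhs => rw [e2]
    rw [hK.trans _ z hz _ hw2, hK.herm _ hw2 z hz]

theorem eq_zero (hK : IsTK K) (hd : ∀ z ∈ tube (m + 2), K z z = 0) {z w : Fin (m + 2) → ℂ}
    (hz : z ∈ tube (m + 2)) (hw : w ∈ tube (m + 2)) : K z w = 0 := by
  -- shifts by imaginary vectors of the base point
  have imag : ∀ y : Fin (m + 2) → ℝ, ∀ {z : Fin (m + 2) → ℂ}, z ∈ tube (m + 2) →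
      z + I • ofR y ∈ tube (m + 2) → K (z + I • ofR y) z = 0 := by
    intro y z hz hy
    have hmid : z + I • ofR ((1 / 2 : ℝ) • y) ∈ tube (m + 2) := by
      have := tube_convex hz hy (by norm_num : (0 : ℝ) ≤ 1 / 2) (by norm_num : (0 : ℝ) ≤ 1 / 2)
        (by norm_num)
      convert this using 1
      ext i
      simp [ofR]
      ring
    have e : z + I • ofR y = (z + I • ofR ((1 / 2 : ℝ) • y)) + I • ofR ((1 / 2 : ℝ) • y) := by
      ext i; simp [ofR]; ring
    rw [e, hK.shift hmid hz _ (by rwa [← e]) hmid]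
    exact hd _ hmid
  have real : ∀ x : Fin (m + 2) → ℝ, ∀ {z : Fin (m + 2) → ℂ}, z ∈ tube (m + 2) →
      K (z + ofR x) z = 0 := by
    intro x z hz
    have h := eq_zero_of_line (g := fun ζ => K (z + ζ • ofR x) z) (isOpen_line z (ofR x))
      (convex_line _ _) (by simpa using hz) (hK.holo_line z (ofR x) hz) I_ne_zero ?_ (ζ := 1)
      (by rw [mem_ofPred_eq, one_smul, mem_tube_add_ofR]; exact hz)
    · simpa using h
    · intro τ hτ
      have e : z + ((τ : ℂ) * I) • ofR x = z + I • ofR (τ • x) := by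
        ext i; simp [ofR]; ring
      rw [mem_ofPred_eq, e] at hτ
      simp only [e]
      exact imag _ hz hτ
  -- reduce to the same imaginary part
  set x := reP z - reP w with hx
  set d := (1 / 2 : ℝ) • (imP z - imP w) with hd'
  have hwm : w + I • ofR d ∈ tube (m + 2) := by
    have := tube_convex hz hw (by norm_num : (0 : ℝ) ≤ 1 / 2) (by norm_num : (0 : ℝ) ≤ 1 / 2)
      (by norm_num)
    rw [← mem_tube_add_ofR (-((1 / 2 : ℝ) • x))] at this
    convert this using 1
    ext i
    apply Complex.ext <;> simp [ofR, hd', hx, imP, reP] <;> ring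
  have e1 : z = (w + I • ofR d + ofR x) + I • ofR d := by
    ext i
    apply Complex.ext <;> simp [ofR, hd', hx, imP, reP]
    ring
  have hz1 : w + I • ofR d + ofR x ∈ tube (m + 2) := (mem_tube_add_ofR x).2 hwm
  rw [e1, hK.shift hz1 hw d (by rwa [← e1]) hwm]
  exact real x hwm

end IsTK

/-- Kernels transforming by a fixed factor under the linear automorphisms of the tube. -/
structure IsCK (c : ℝ → ℝ → ℝ) (K : (Fin (m + 2) → ℂ) → (Fin (m + 2) → ℂ) → ℂ) : Prop where
  holo : ∀ w ∈ tube (m + 2), DifferentiableOn ℂ (fun z => K z w) (tube (m + 2))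
  herm : ∀ z ∈ tube (m + 2), ∀ w ∈ tube (m + 2), K w z = (starRingEnd ℂ) (K z w)
  cov : ∀ {G A T}, IsG G A T → ∀ x : Fin (m + 2) → ℝ, ∀ z ∈ tube (m + 2), ∀ w ∈ tube (m + 2),
    K (hmap G x z) (hmap G x w) = (c A T : ℂ) * K z w

lemma isG_one : IsG (1 : Matrix (Fin (m + 2)) (Fin (m + 2)) ℝ) 1 1 :=
  ⟨one_pos, one_pos, fun v => by simp, fun v => by simp⟩

lemma hmap_one (x : Fin (m + 2) → ℝ) (z : Fin (m + 2) → ℂ) : hmap 1 x z = z + ofR x := by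
  rw [← cmk_reP_imP (hmap _ _ _), ← cmk_reP_imP (z + ofR x), imP_hmap, imP_add_ofR, hmap,
    reP_add_ofR, reP_mulVec, reP_add_ofR, Matrix.one_mulVec, Matrix.one_mulVec]

theorem IsCK.eq_smul {c : ℝ → ℝ → ℝ} (hc : c 1 1 = 1)
    {K K' : (Fin (m + 2) → ℂ) → (Fin (m + 2) → ℂ) → ℂ} (hK : IsCK c K) (hK' : IsCK c K')
    (h0 : K' (ie m) (ie m) ≠ 0) :
    ∀ z ∈ tube (m + 2), ∀ w ∈ tube (m + 2),
      K z w = (((K (ie m) (ie m)).re / (K' (ie m) (ie m)).re : ℝ) : ℂ) * K' z w := by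
  have hre : ∀ {K}, IsCK c K → ((K (ie m) (ie m)).re : ℂ) = K (ie m) (ie m) := fun hK =>
    conj_eq_iff_re.1 (hK.herm _ ie_mem _ ie_mem).symm
  set γ : ℝ := (K (ie m) (ie m)).re / (K' (ie m) (ie m)).re with hγ
  have hγ' : (γ : ℂ) * K' (ie m) (ie m) = K (ie m) (ie m) := by
    rw [hγ, ofReal_div, hre hK, hre hK', div_mul_cancel₀ _ h0]
  have hT : IsTK fun z w => K z w - γ * K' z w := by
    refine ⟨fun w hw => (hK.holo w hw).sub ((hK'.holo w hw).const_mul _), fun z hz w hw => ?_,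
      fun x z hz w hw => ?_⟩
    · rw [map_sub, map_mul, conj_ofReal, hK.herm z hz w hw, hK'.herm z hz w hw]
    · have h1 := hK.cov isG_one x z hz w hw
      have h2 := hK'.cov isG_one x z hz w hw
      rw [hmap_one, hmap_one, hc, ofReal_one, one_mul] at h1 h2
      simp only [h1, h2]
  intro z hz w hw
  refine sub_eq_zero.1 (hT.eq_zero (fun z hz => ?_) hz hw)
  obtain ⟨G, hG, h⟩ := exists_hmap hz
  have h1 := hK.cov hG (reP z) _ ie_mem _ ie_mem
  have h2 := hK'.cov hG (reP z) _ ie_mem _ ie_mem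
  rw [h] at h1 h2
  rw [h1, h2, ← hγ']
  ring

end polarization

section identification
variable {m : ℕ}

lemma hN_ge (m : ℕ) : 1 ≤ hN m := by
  rw [hN]; push_cast; linarith [(Nat.cast_nonneg m : (0 : ℝ) ≤ m)]

lemma two_hN (m : ℕ) : ((m + 2 : ℕ) : ℝ) = 2 * hN m := by rw [hN]; ring

lemma enorm_lk_rpow {n : ℕ} [NeZero n] (a p : ℝ) {z w : Fin n → ℂ} (hz : z ∈ tube n)
    (hw : w ∈ tube n) : ‖lk a z w‖ₑ ^ p = ‖lk (a * p) z w‖ₑ := by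
  have h := norm_pos_iff.2 (lorC_ne (zc_mem hz hw))
  have h1 := norm_pos_iff.2 (lk_ne a hz hw)
  rw [← ofReal_norm, ENNReal.ofReal_rpow_of_pos h1, ← ofReal_norm, norm_lk _ hz hw,
    norm_lk _ hz hw, ← Real.rpow_mul h.le, neg_mul]

lemma enorm_lk_comm {n : ℕ} [NeZero n] (a : ℝ) {z w : Fin n → ℂ} (hz : z ∈ tube n)
    (hw : w ∈ tube n) : ‖lk a z w‖ₑ = ‖lk a w z‖ₑ := by
  rw [← lk_conj a hz hw, RCLike.enorm_conj]

lemma lintegral_lk_rpow (s t a p : ℝ) {w : Fin (m + 2) → ℂ} (hw : w ∈ tube (m + 2)) :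
    ∫⁻ z, ‖lk a z w‖ₑ ^ p ∂(wM m s t) = ∫⁻ z, ‖lk (a * p) z w‖ₑ ∂(wM m s t) :=
  lintegral_congr_ae ((ae_wM s t).mono fun _ hz => enorm_lk_rpow a p hz hw)

lemma A2_of_lintegral_lt {s t : ℝ} {F : (Fin (m + 2) → ℂ) → ℂ}
    (hF : DifferentiableOn ℂ F (tube (m + 2)))
    (h : ∫⁻ z, ‖F z‖ₑ ^ (2 : ℝ) ∂(wM m s t) < ⊤) : A2 m s t F := by
  refine ⟨hF, A2.aesm hF, ?_⟩
  rw [eLpNorm_two]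
  exact ENNReal.rpow_lt_top_of_nonneg (by norm_num) h.ne

lemma A2_lk {s t a : ℝ} (h1 : hN m < a) (h2 : s + t + 3 * hN m - 1 < 2 * a)
    (h3 : t + 2 * hN m < 2 * a) (h4 : 0 < s + t + hN m) (h5 : -1 < t) {w : Fin (m + 2) → ℂ}
    (hw : w ∈ tube (m + 2)) : A2 m s t fun z => lk a z w := by
  obtain ⟨J, -, hJ⟩ := exists_lintegral_lk (m := m) (s := s) (t := t) (a := a * 2) (by linarith)
    (by linarith) (by linarith) h4 h5
  refine A2_of_lintegral_lt (differentiableOn_lk a hw) ?_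
  rw [lintegral_lk_rpow s t a 2 hw, hJ w hw]
  exact ENNReal.ofReal_lt_top

lemma IsCK.isTK {c : ℝ → ℝ → ℝ} (hc : c 1 1 = 1) {K : (Fin (m + 2) → ℂ) → (Fin (m + 2) → ℂ) → ℂ}
    (hK : IsCK c K) : IsTK K := by
  refine ⟨hK.holo, hK.herm, fun x z hz w hw => ?_⟩
  have h1 := hK.cov isG_one x z hz w hw
  rwa [hmap_one, hmap_one, hc, ofReal_one, one_mul] at h1

lemma IsCK.eq_zero {c : ℝ → ℝ → ℝ} (hc : c 1 1 = 1)
    {K : (Fin (m + 2) → ℂ) → (Fin (m + 2) → ℂ) → ℂ} (hK : IsCK c K)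
    (h0 : K (ie m) (ie m) = 0) {z w : Fin (m + 2) → ℂ} (hz : z ∈ tube (m + 2))
    (hw : w ∈ tube (m + 2)) : K z w = 0 := by
  refine (hK.isTK hc).eq_zero (fun z hz => ?_) hz hw
  obtain ⟨G, hG, h⟩ := exists_hmap hz
  have h1 := hK.cov hG (reP z) _ ie_mem _ ie_mem
  rwa [h, h0, mul_zero] at h1

lemma isCK_bk (s t : ℝ) :
    IsCK (fun A T => (A ^ s * T ^ t * T ^ (m + 2))⁻¹) fun z w => bk m s t w z where
  holo _ _ := (A2_bk _).holo
  herm _ hz _ hw := bk_symm hz hw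
  cov hG x _ hz _ hw := hG.bk_hmap x hz hw

lemma bk_ie_ne {s t : ℝ} {F : (Fin (m + 2) → ℂ) → ℂ} (hF : A2 m s t F) {w : Fin (m + 2) → ℂ}
    (hw : w ∈ tube (m + 2)) (hFw : F w ≠ 0) : bk m s t (ie m) (ie m) ≠ 0 := by
  intro h
  refine hFw ?_
  rw [hF.repro hw]
  refine integral_eq_zero_of_ae ((ae_wM s t).mono fun z hz => ?_)
  have := (isCK_bk (m := m) s t).eq_zero (by simp) h hz hw
  simp only [this, map_zero, mul_zero, Pi.zero_apply]

lemma isCK_lk (a : ℝ) : IsCK (fun _ T => T ^ (-a)) fun z w : Fin (m + 2) → ℂ => lk a z w where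
  holo _ hw := differentiableOn_lk a hw
  herm _ hz _ hw := (lk_conj a hz hw).symm
  cov hG x _ hz _ hw := hG.lk_hmap a x hz hw

/-- The Bergman kernel of the standard weights. -/
theorem exists_bk_eq_lk {ν : ℝ} (hν : hN m - 1 < ν) : ∃ C : ℝ, C ≠ 0 ∧ ∀ z ∈ tube (m + 2),
    ∀ w ∈ tube (m + 2), bk m 0 (ν - hN m) w z = C * lk (ν + hN m) z w := by
  have hN1 := hN_ge m
  have hK : IsCK (fun _ T => T ^ (-(ν + hN m))) fun z w => bk m 0 (ν - hN m) w z := by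
    refine ⟨(isCK_bk _ _).holo, (isCK_bk _ _).herm, fun {G A T} hG x z hz w hw => ?_⟩
    rw [(isCK_bk _ _).cov hG x z hz w hw]
    congr 2
    rw [Real.rpow_zero, one_mul, ← Real.rpow_natCast, ← Real.rpow_add hG.T_pos,
      ← Real.rpow_neg hG.T_pos.le, two_hN]
    ring_nf
  have h := hK.eq_smul (by simp) (isCK_lk (ν + hN m)) (lk_ne _ ie_mem ie_mem)
  refine ⟨_, fun h0 => ?_, h⟩
  have h1 : A2 m 0 (ν - hN m) fun z => lk (ν + hN m) z (ie m) :=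
    A2_lk (by linarith) (by linarith) (by linarith) (by linarith) (by linarith) ie_mem
  refine bk_ie_ne h1 ie_mem (lk_ne _ ie_mem ie_mem) ?_
  rw [h _ ie_mem _ ie_mem, h0]
  simp

instance instSFinite_wM (s t : ℝ) : SFinite (wM m s t) := by unfold wM; infer_instance

lemma aemeasurable_lk (a : ℝ) (s t s' t' : ℝ) :
    AEStronglyMeasurable (fun q : (Fin (m + 2) → ℂ) × (Fin (m + 2) → ℂ) => lk a q.1 q.2)
      ((wM m s t).prod (wM m s' t')) := by
  have hm : MeasurableSet (tube (m + 2) ×ˢ tube (m + 2)) := measurable_tube.prod measurable_tube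
  have h := (continuousOn_lk (n := m + 2) a).aestronglyMeasurable
    (μ := (wM m s t).prod (wM m s' t')) hm
  rwa [Measure.restrict_eq_self_of_ae_mem] at h
  have h1 := Measure.ae_prod_iff_ae_ae (μ := wM m s t) (ν := wM m s' t') (p := fun q => q ∈
    tube (m + 2) ×ˢ tube (m + 2)) hm
  exact h1.2 ((ae_wM s t).mono fun z hz => (ae_wM s' t').mono fun w hw => ⟨hz, hw⟩)

end identification

section boxbound
variable {m : ℕ}

lemma wt_mul_rpow (s t x : ℝ) {y : Fin (m + 2) → ℝ} (hy : y ∈ cone (m + 2)) :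
    wt s t y * lor y ^ x = wt s (t + x) y := by
  rw [wt, wt, mul_assoc, ← Real.rpow_add hy.1]

lemma wt_zero (t : ℝ) (y : Fin (m + 2) → ℝ) : wt 0 t y = lor y ^ t := by
  rw [wt, Real.rpow_zero, one_mul]

/-- The integral of the modulus of the kernel against a weight. -/
theorem exists_lintegral_lk_eq {s t a : ℝ} (h1 : 2 * hN m < a) (h2 : s + t + 3 * hN m - 1 < a)
    (h3 : t + 2 * hN m < a) (h4 : 0 < s + t + hN m) (h5 : -1 < t) :
    ∃ J : ℝ≥0∞, J ≠ ⊤ ∧ ∀ w ∈ tube (m + 2), ∫⁻ z, ‖lk a z w‖ₑ ∂(wM m s t)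
      = J * ENNReal.ofReal (wt s (t + (2 * hN m - a)) (imP w)) := by
  obtain ⟨J, hJ0, hJ⟩ := exists_lintegral_lk h1 h2 h3 h4 h5
  refine ⟨ENNReal.ofReal J, ENNReal.ofReal_ne_top, fun w hw => ?_⟩
  rw [hJ w hw, wt_mul_rpow _ _ _ hw, ENNReal.ofReal_mul hJ0]

lemma lintegral_lk_swap (s t s' t' a : ℝ) {f : (Fin (m + 2) → ℂ) → ℝ≥0∞}
    (hf : AEMeasurable f (wM m s' t')) :
    ∫⁻ z, ∫⁻ w, f w * ‖lk a z w‖ₑ ∂(wM m s' t') ∂(wM m s t)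
      = ∫⁻ w, f w * ∫⁻ z, ‖lk a z w‖ₑ ∂(wM m s t) ∂(wM m s' t') := by
  have hk := (aemeasurable_lk (m := m) a s t s' t').enorm
  have h2 := (hf.comp_quasiMeasurePreserving
    (Measure.quasiMeasurePreserving_snd (μ := wM m s t))).mul hk
  rw [lintegral_lintegral_swap h2]
  refine lintegral_congr_ae ((ae_wM s' t').mono fun w hw => ?_)
  refine lintegral_const_mul'' (f w) ?_
  have h3 : AEStronglyMeasurable (fun z => lk a z w) (wM m s t) :=
    A2.aesm (differentiableOn_lk a hw)
  exact h3.enorm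

theorem exists_lintegral_lintegral_lk {s t a : ℝ} (h1 : 2 * hN m < a)
    (h2 : s + t + 3 * hN m - 1 < a) (h3 : t + 2 * hN m < a) (h4 : 0 < s + t + hN m) (h5 : -1 < t) :
    ∃ J : ℝ≥0∞, J ≠ ⊤ ∧ ∀ s' t' (f : (Fin (m + 2) → ℂ) → ℝ≥0∞), AEMeasurable f (wM m s' t') →
      ∫⁻ z, ∫⁻ w, f w * ‖lk a z w‖ₑ ∂(wM m s' t') ∂(wM m s t)
        = J * ∫⁻ w, f w ∂(wM m (s' + s) (t' + (t + (2 * hN m - a)))) := by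
  obtain ⟨J, hJ0, hJ⟩ := exists_lintegral_lk_eq h1 h2 h3 h4 h5
  refine ⟨J, hJ0, fun s' t' f hf => ?_⟩
  rw [lintegral_lk_swap s t s' t' a hf, ← lintegral_wM_mul, ← lintegral_const_mul'' J]
  · refine lintegral_congr_ae ((ae_wM s' t').mono fun w hw => ?_)
    simp only [hJ w hw]
    ring
  · exact (measurable_wt_imP _ _).aemeasurable.mul hf

lemma exists_one_le_lk (a : ℝ) {w : Fin (m + 2) → ℂ} (hw : w ∈ tube (m + 2))
    {B : Set (Fin (m + 2) → ℂ)} (hB : IsCompact B) (hBt : B ⊆ tube (m + 2)) :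
    ∃ K : ℝ≥0∞, K ≠ ⊤ ∧ ∀ z ∈ B, 1 ≤ K * ‖lk a z w‖ₑ := by
  obtain ⟨K, hK⟩ := hB.exists_bound_of_continuousOn
    (f := fun z => lk (-a) z w) ((differentiableOn_lk (-a) hw).continuousOn.mono hBt)
  refine ⟨ENNReal.ofReal K, ENNReal.ofReal_ne_top, fun z hz => ?_⟩
  have h1 : lk (-a) z w * lk a z w = 1 := by
    rw [← lk_add _ _ (hBt hz) hw, neg_add_cancel, lk]
    simp
  calc (1 : ℝ≥0∞) = ‖lk (-a) z w‖ₑ * ‖lk a z w‖ₑ := by rw [← enorm_mul, h1, enorm_one]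
    _ ≤ _ := by
      gcongr
      rw [← ofReal_norm]
      exact ENNReal.ofReal_le_ofReal (hK z hz)

lemma exists_enorm_BoxOp_le (b c : ℝ) {p : ℝ} (hp : 1 < p) :
    ∃ C : ℝ≥0∞, C ≠ ⊤ ∧ ∀ F : (Fin (m + 2) → ℂ) → ℂ, DifferentiableOn ℂ F (tube (m + 2)) →
      ∀ z ∈ tube (m + 2), ‖(lor (imP z) : ℂ) * BoxOp F z‖ₑ ^ p
        ≤ C * ENNReal.ofReal (wt 0 (b - c - 2 * hN m) (imP z)) *
          ∫⁻ w, ‖F w‖ₑ ^ p * ‖lk b z w‖ₑ ∂(wM m 0 c) := by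
  obtain ⟨r, hr, hB⟩ := exists_closedBall_subset_tube (ie_mem (m := m))
  obtain ⟨C, hC, hCF⟩ := exists_BoxOp_le_of_setLIntegral hr tube_isOpen hB hp
  obtain ⟨K, hK, hKl⟩ := exists_one_le_lk b ie_mem (isCompact_closedBall (ie m) r) hB
  obtain ⟨k, hk, hkf⟩ := exists_setLIntegral_le 0 c hB
  have hp0 : 0 < p := by linarith
  refine ⟨C ^ p * (K * k), ENNReal.mul_ne_top (ENNReal.rpow_ne_top_of_nonneg hp0.le hC)
    (ENNReal.mul_ne_top hK hk), fun F hF z hz => ?_⟩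
  obtain ⟨G, hG, hGz⟩ := exists_hmap hz
  set T := lor (imP z) with hT
  have hTp : 0 < T := hz.1
  have h1 : ‖(T : ℂ) * BoxOp F z‖ₑ ^ p
      ≤ C ^ p * ∫⁻ w in Metric.closedBall (ie m) r, ‖F (hmap G (reP z) w)‖ₑ ^ p := by
    have h0 := hG.BoxOp_hmap (reP z) hF ie_mem
    rw [hGz] at h0
    rw [← h0]
    refine (ENNReal.rpow_le_rpow (hCF _ (hG.comp_hmap (reP z) hF)) hp0.le).trans_eq ?_
    rw [ENNReal.mul_rpow_of_nonneg _ _ hp0.le, ENNReal.rpow_inv_rpow hp0.ne']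
  refine h1.trans ?_
  have h2 : ∫⁻ w in Metric.closedBall (ie m) r, ‖F (hmap G (reP z) w)‖ₑ ^ p
      ≤ K * (k * ∫⁻ w, ‖F (hmap G (reP z) w)‖ₑ ^ p * ‖lk b w (ie m)‖ₑ ∂(wM m 0 c)) := by
    have h3 := hkf fun w => ‖F (hmap G (reP z) w)‖ₑ ^ p * ‖lk b w (ie m)‖ₑ
    refine le_trans ?_ (mul_le_mul_right h3 K)
    rw [← lintegral_const_mul' _ _ hK]
    refine setLIntegral_mono' measurableSet_closedBall fun w hw => ?_
    calc _ = ‖F (hmap G (reP z) w)‖ₑ ^ p * 1 := (mul_one _).symm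
      _ ≤ ‖F (hmap G (reP z) w)‖ₑ ^ p * (K * ‖lk b w (ie m)‖ₑ) := by gcongr; exact hKl w hw
      _ = _ := by ring
  have h4 : ∫⁻ w, ‖F (hmap G (reP z) w)‖ₑ ^ p * ‖lk b w (ie m)‖ₑ ∂(wM m 0 c)
      = ENNReal.ofReal (wt 0 (b - c - 2 * hN m) (imP z)) *
          ∫⁻ w, ‖F w‖ₑ ^ p * ‖lk b z w‖ₑ ∂(wM m 0 c) := by
    have h5 : ∀ w ∈ tube (m + 2), ‖F (hmap G (reP z) w)‖ₑ ^ p * ‖lk b w (ie m)‖ₑ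
        = ENNReal.ofReal (T ^ b) * (fun w => ‖F w‖ₑ ^ p * ‖lk b z w‖ₑ) (hmap G (reP z) w) := by
      intro w hw
      have h6 := hG.lk_hmap b (reP z) ie_mem hw
      rw [hGz] at h6
      simp only [h6]
      rw [enorm_mul, enorm_lk_comm b ie_mem hw, ← ofReal_norm (((T ^ (-b) : ℝ)) : ℂ), norm_real,
        Real.norm_of_nonneg (by positivity)]
      have h7 : ENNReal.ofReal (T ^ b) * ENNReal.ofReal (T ^ (-b)) = 1 := by
        rw [← ENNReal.ofReal_mul (by positivity), ← Real.rpow_add hTp]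
        simp
      calc _ = ‖F (hmap G (reP z) w)‖ₑ ^ p * (1 * ‖lk b w (ie m)‖ₑ) := by rw [one_mul]
        _ = _ := by rw [← h7]; ring
    rw [lintegral_congr_ae ((ae_wM 0 c).mono h5), lintegral_const_mul' _ _ ENNReal.ofReal_ne_top,
      hG.lintegral_hmap 0 c (reP z) fun w => ‖F w‖ₑ ^ p * ‖lk b z w‖ₑ, ← mul_assoc, ← ENNReal.ofReal_mul (by positivity), wt_zero, ← hT]
    congr 2
    rw [Real.rpow_zero, one_mul, ← Real.rpow_natCast, ← Real.rpow_add hTp, ← Real.rpow_neg hTp.le,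
      ← Real.rpow_add hTp, two_hN]
    ring_nf
  calc _ ≤ C ^ p * (K * (k * (ENNReal.ofReal (wt 0 (b - c - 2 * hN m) (imP z)) *
          ∫⁻ w, ‖F w‖ₑ ^ p * ‖lk b z w‖ₑ ∂(wM m 0 c)))) := by rw [← h4]; gcongr
    _ = _ := by ring

/-- `Δ □` is bounded on the weighted Bergman spaces. -/
theorem exists_lintegral_BoxOp_le (ν : ℝ) {p : ℝ} (hp : 1 < p) :
    ∃ C : ℝ≥0∞, C ≠ ⊤ ∧ ∀ F : (Fin (m + 2) → ℂ) → ℂ, DifferentiableOn ℂ F (tube (m + 2)) →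
      ∫⁻ z, ‖(lor (imP z) : ℂ) * BoxOp F z‖ₑ ^ p ∂(wM m 0 (ν - hN m))
        ≤ C * ∫⁻ z, ‖F z‖ₑ ^ p ∂(wM m 0 (ν - hN m)) := by
  have hN1 := hN_ge m
  obtain ⟨C, hC, hCF⟩ := exists_enorm_BoxOp_le (m := m) (3 * hN m) ν hp
  obtain ⟨J, hJ, hJF⟩ := exists_lintegral_lintegral_lk (m := m) (s := 0) (t := 0) (a := 3 * hN m)
    (by linarith) (by linarith) (by linarith) (by linarith) (by linarith)
  refine ⟨C * J, ENNReal.mul_ne_top hC hJ, fun F hF => ?_⟩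
  have hm : AEMeasurable (fun z => ‖F z‖ₑ ^ p) (wM m 0 ν) := (A2.aesm hF).enorm.pow_const p
  calc _ ≤ ∫⁻ z, C * (ENNReal.ofReal (wt 0 (3 * hN m - ν - 2 * hN m) (imP z)) *
          ∫⁻ w, ‖F w‖ₑ ^ p * ‖lk (3 * hN m) z w‖ₑ ∂(wM m 0 ν)) ∂(wM m 0 (ν - hN m)) := by
        refine lintegral_mono_ae ((ae_wM _ _).mono fun z hz => ?_)
        rw [← mul_assoc]
        exact hCF F hF z hz
    _ = C * ∫⁻ z, ∫⁻ w, ‖F w‖ₑ ^ p * ‖lk (3 * hN m) z w‖ₑ ∂(wM m 0 ν) ∂(wM m 0 0) := by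
        rw [lintegral_const_mul' _ _ hC, lintegral_wM_mul]
        congr 3 <;> ring
    _ = _ := by
        rw [hJF 0 ν _ hm, mul_assoc]
        congr 4 <;> ring

end boxbound

section boxpairing
variable {m : ℕ}

lemma integral_wM (s t : ℝ) (f : (Fin (m + 2) → ℂ) → ℂ) :
    ∫ z, f z ∂(wM m s t) = ∫ z in tube (m + 2), (wt s t (imP z) : ℂ) * f z := by
  rw [wM, integral_withDensity_eq_integral_toReal_smul (measurable_wt_imP s t)
    (Filter.Eventually.of_forall fun _ => ENNReal.ofReal_lt_top)]
  refine setIntegral_congr_fun measurable_tube fun z hz => ?_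
  simp only [ENNReal.toReal_ofReal (wt_pos s t hz).le, real_smul]

lemma integral_wM_mul (s t s' t' : ℝ) (f : (Fin (m + 2) → ℂ) → ℂ) :
    ∫ z, (wt s' t' (imP z) : ℂ) * f z ∂(wM m s t) = ∫ z, f z ∂(wM m (s + s') (t + t')) := by
  rw [integral_wM, integral_wM]
  refine setIntegral_congr_fun measurable_tube fun z hz => ?_
  have h : wt (s + s') (t + t') (imP z) = wt s t (imP z) * wt s' t' (imP z) := by
    have hc := mem_cone_iff.1 hz
    rw [wt, wt, wt, Real.rpow_add hc.1, Real.rpow_add hc.2]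
    ring
  simp only [h]
  push_cast
  ring

lemma aesm_wt (s t s' t' : ℝ) :
    AEStronglyMeasurable (fun z : Fin (m + 2) → ℂ => (wt s t (imP z) : ℂ)) (wM m s' t') :=
  (measurable_ofReal.comp ((measurable_wt s t).comp
    imP_continuous.measurable)).aestronglyMeasurable

lemma aesm_BoxOp (s t : ℝ) {F : (Fin (m + 2) → ℂ) → ℂ} (hF : DifferentiableOn ℂ F (tube (m + 2))) :
    AEStronglyMeasurable (fun z => (lor (imP z) : ℂ) * BoxOp F z) (wM m s t) := by
  refine AEStronglyMeasurable.mul ?_ (A2.aesm (differentiableOn_BoxOp tube_isOpen hF))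
  simpa [wt_zero] using aesm_wt (m := m) 0 1 s t

lemma exists_eLpNorm_BoxOp_le (ν : ℝ) :
    ∃ C : ℝ≥0∞, C ≠ ⊤ ∧ ∀ F : (Fin (m + 2) → ℂ) → ℂ, DifferentiableOn ℂ F (tube (m + 2)) →
      eLpNorm (fun z => (lor (imP z) : ℂ) * BoxOp F z) 2 (wM m 0 (ν - hN m))
        ≤ C * eLpNorm F 2 (wM m 0 (ν - hN m)) := by
  obtain ⟨C, hC, h⟩ := exists_lintegral_BoxOp_le (m := m) ν one_lt_two
  refine ⟨C ^ (2 : ℝ)⁻¹, ENNReal.rpow_ne_top_of_nonneg (by norm_num) hC, fun F hF => ?_⟩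
  rw [eLpNorm_two, eLpNorm_two, ← ENNReal.mul_rpow_of_nonneg _ _ (by norm_num)]
  exact ENNReal.rpow_le_rpow (h F hF) (by norm_num)

lemma memLp_BoxOp {ν : ℝ} {F : (Fin (m + 2) → ℂ) → ℂ} (hF : A2 m 0 (ν - hN m) F) :
    MemLp (fun z => (lor (imP z) : ℂ) * BoxOp F z) 2 (wM m 0 (ν - hN m)) := by
  obtain ⟨C, hC, h⟩ := exists_eLpNorm_BoxOp_le (m := m) ν
  exact ⟨aesm_BoxOp _ _ hF.holo, (h F hF.holo).trans_lt
    (ENNReal.mul_lt_top hC.lt_top hF.memLp.2)⟩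

/-- The Box operator maps the Bergman kernel to a multiple of the next Bergman kernel. -/
lemma exists_BoxOp_bk {ν : ℝ} (hν : hN m - 1 < ν) : ∃ d : ℝ, d ≠ 0 ∧ ∀ z ∈ tube (m + 2),
    ∀ w ∈ tube (m + 2),
      BoxOp (bk m 0 (ν - hN m) w) z = d * bk m 0 (ν + 1 - hN m) w z := by
  have hN1 := hN_ge m
  obtain ⟨C, hC, h⟩ := exists_bk_eq_lk hν
  obtain ⟨C', hC', h'⟩ := exists_bk_eq_lk (m := m) (ν := ν + 1) (by linarith)
  refine ⟨C * (4 * (ν + hN m) * (ν + 1)) / C', div_ne_zero (mul_ne_zero hC (mul_ne_zero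
    (by linarith) (by linarith))) hC', fun z hz w hw => ?_⟩
  have h1 : EqOn (bk m 0 (ν - hN m) w) ((C : ℂ) • fun z => lk (ν + hN m) z w) (tube (m + 2)) :=
    fun z hz => h z hz w hw
  rw [BoxOp_congr h1 hz, BoxOp_smul _ (differentiableOn_lk _ hw) hz, BoxOp_lk _ hz hw, h' z hz w hw]
  have h2 : ((m + 2 : ℕ) : ℂ) = 2 * (hN m : ℂ) := by
    have := two_hN m
    exact_mod_cast this
  have h3 : (C' : ℂ) ≠ 0 := by exact_mod_cast hC'
  rw [h2]
  push_cast
  field_simp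
  ring_nf

lemma A2_bk_succ {ν : ℝ} (hν : hN m - 1 < ν) (h1 : 1 < ν + hN m) {w : Fin (m + 2) → ℂ}
    (hw : w ∈ tube (m + 2)) : A2 m 0 (ν + 1 - hN m) (bk m 0 (ν - hN m) w) := by
  have hN1 := hN_ge m
  obtain ⟨C, hC, h⟩ := exists_bk_eq_lk hν
  have h2 : A2 m 0 (ν + 1 - hN m) ((C : ℂ) • fun z => lk (ν + hN m) z w) :=
    (A2_lk (by linarith) (by linarith) (by linarith) (by linarith) (by linarith) hw).const_smul _
  refine ⟨(A2_bk w).holo, h2.memLp.ae_eq ((ae_wM _ _).mono fun z hz => ?_)⟩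
  exact (h z hz w hw).symm

/-- Integration by parts: `Δ □` is a multiple of the identity in the weak sense on `A²`. -/
theorem exists_integral_BoxOp {ν : ℝ} (hν : hN m - 1 < ν) (hν1 : 1 < ν + hN m) :
    ∃ d : ℝ, d ≠ 0 ∧ ∀ F G, A2 m 0 (ν - hN m) F → A2 m 0 (ν - hN m) G →
      ∫ z, (lor (imP z) : ℂ) * BoxOp F z * (starRingEnd ℂ) (G z) ∂(wM m 0 (ν - hN m))
        = d * ∫ z, F z * (starRingEnd ℂ) (G z) ∂(wM m 0 (ν - hN m)) := by
  obtain ⟨d, hd, hbk⟩ := exists_BoxOp_bk hν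
  refine ⟨d, hd, ?_⟩
  have hL : ∀ G, A2 m 0 (ν - hN m) G → BF m 0 (ν - hN m) fun F =>
      ∫ z, (lor (imP z) : ℂ) * BoxOp F z * (starRingEnd ℂ) (G z) ∂(wM m 0 (ν - hN m)) := by
    intro G hG
    refine ⟨fun F F' hF hF' => ?_, fun c F hF => ?_, fun F F' h => ?_, ?_⟩
    · rw [← integral_add (integrable_mul_conj (memLp_BoxOp hF) hG.memLp)
        (integrable_mul_conj (memLp_BoxOp hF') hG.memLp)]
      refine integral_congr_ae ((ae_wM _ _).mono fun z hz => ?_)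
      simp only [BoxOp_add hF.holo hF'.holo hz]
      ring
    · rw [← integral_const_mul]
      refine integral_congr_ae ((ae_wM _ _).mono fun z hz => ?_)
      simp only [BoxOp_smul c hF.holo hz]
      ring
    · refine integral_congr_ae ((ae_wM _ _).mono fun z hz => ?_)
      simp only [BoxOp_congr h hz]
    · obtain ⟨C, hC, h⟩ := exists_eLpNorm_BoxOp_le (m := m) ν
      refine ⟨eLpNorm G 2 (wM m 0 (ν - hN m)) * C, ENNReal.mul_ne_top hG.memLp.2.ne hC,
        fun F hF => ?_⟩
      rw [mul_assoc]
      exact (enorm_integral_mul_conj_le (aesm_BoxOp _ _ hF.holo) hG.memLp.1).trans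
        (mul_le_mul_right (h F hF.holo) _)
  have h1 : ∀ F, A2 m 0 (ν - hN m) F → ∀ u ∈ tube (m + 2),
      ∫ z, (lor (imP z) : ℂ) * BoxOp F z * (starRingEnd ℂ) (bk m 0 (ν - hN m) u z)
        ∂(wM m 0 (ν - hN m)) = d * F u := by
    intro F hF u hu
    rw [← sub_eq_zero]
    refine BF.eq_zero ((hL _ (A2_bk u)).sub ((BF_eval 0 (ν - hN m) hu).const_mul d))
      (fun v hv => ?_) hF
    rw [sub_eq_zero]
    have h2 := (A2_bk_succ hν hν1 hu).repro hv
    rw [integral_mul_conj_symm] at h2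
    have h3 := bk_symm (s := 0) (t := ν - hN m) hv hu
    rw [h3, h2, conj_conj, ← integral_const_mul]
    have h4 := integral_wM_mul (m := m) 0 (ν - hN m) 0 1 fun z =>
      (d : ℂ) * (bk m 0 (ν + 1 - hN m) v z * (starRingEnd ℂ) (bk m 0 (ν - hN m) u z))
    rw [show ν - hN m + 1 = ν + 1 - hN m by ring, show (0 : ℝ) + 0 = 0 by ring] at h4
    rw [← h4]
    refine integral_congr_ae ((ae_wM _ _).mono fun z hz => ?_)
    simp only [hbk z hz v hv, wt_zero, Real.rpow_one]
    ring
  intro F G hF hG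
  have h5 : BF m 0 (ν - hN m) fun G =>
      ∫ z, G z * (starRingEnd ℂ) ((lor (imP z) : ℂ) * BoxOp F z) ∂(wM m 0 (ν - hN m))
        - (d : ℂ) * ∫ z, G z * (starRingEnd ℂ) (F z) ∂(wM m 0 (ν - hN m)) :=
    (BF_inner (memLp_BoxOp hF)).sub ((BF_inner hF.memLp).const_mul d)
  have h6 := h5.eq_zero (fun u hu => ?_) hG
  · rw [sub_eq_zero, integral_mul_conj_symm, integral_mul_conj_symm G] at h6
    have h7 := congrArg (starRingEnd ℂ) h6
    rwa [map_mul, conj_conj, conj_conj, conj_ofReal] at h7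
  · rw [sub_eq_zero, integral_mul_conj_symm, h1 F hF u hu, integral_mul_conj_symm _ F,
      ← hF.repro hu, map_mul, conj_ofReal]

end boxpairing

section translate
variable {m : ℕ}

lemma lpInt_eq (ν : ℝ) {p : ℝ} (hp : 0 ≤ p) (F : (Fin (m + 2) → ℂ) → ℂ) :
    lpInt (m + 2) p ν F = ∫⁻ z, ‖F z‖ₑ ^ p ∂(wM m 0 (ν - hN m)) := by
  rw [lpInt, dV_eq]
  refine lintegral_congr fun z => ?_
  rw [← ofReal_norm, ENNReal.ofReal_rpow_of_nonneg (norm_nonneg _) hp]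

lemma memA_two_iff (ν : ℝ) (F : (Fin (m + 2) → ℂ) → ℂ) :
    memA (m + 2) 2 ν F ↔ A2 m 0 (ν - hN m) F := by
  rw [memA, lpInt_eq ν zero_le_two]
  refine ⟨fun h => A2_of_lintegral_lt h.1 h.2, fun h => ⟨h.holo, ?_⟩⟩
  have h2 := h.memLp.2
  rw [eLpNorm_two] at h2
  exact (ENNReal.rpow_lt_top_iff_of_pos (by norm_num)).1 h2

end translate

section damping
variable {m : ℕ}

lemma isG_smul {δ : ℝ} (hδ : 0 < δ) :
    IsG (δ • (1 : Matrix (Fin (m + 2)) (Fin (m + 2)) ℝ)) δ (δ ^ 2) :=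
  ⟨hδ, by positivity, fun v => by rw [Matrix.smul_mulVec, Matrix.one_mulVec, lor_smul],
    fun v => by rw [Matrix.smul_mulVec, Matrix.one_mulVec]; simp [la, mul_add]⟩

lemma hmap_smul (δ : ℝ) (z : Fin (m + 2) → ℂ) :
    hmap (δ • (1 : Matrix (Fin (m + 2)) (Fin (m + 2)) ℝ)) 0 z = (δ : ℂ) • z := by
  rw [← cmk_reP_imP (hmap _ _ _), ← cmk_reP_imP ((δ : ℂ) • z), imP_hmap, hmap,
    reP_add_ofR, reP_mulVec, Matrix.smul_mulVec, Matrix.smul_mulVec, Matrix.one_mulVec,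
    Matrix.one_mulVec, add_zero]
  congr 1 <;> ext i <;> simp [reP, imP]

/-- A damping factor. -/
def damp (a δ : ℝ) (z : Fin (m + 2) → ℂ) : ℂ := lk a ((δ : ℂ) • z) (ie m)

lemma smul_mem_tube {δ : ℝ} (hδ : 0 < δ) {z : Fin (m + 2) → ℂ} (hz : z ∈ tube (m + 2)) :
    (δ : ℂ) • z ∈ tube (m + 2) := by
  rw [← hmap_smul]
  exact ((isG_smul hδ).hmap_mem 0 z).2 hz

lemma differentiableOn_damp (a : ℝ) {δ : ℝ} (hδ : 0 < δ) :
    DifferentiableOn ℂ (damp (m := m) a δ) (tube (m + 2)) :=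
  (differentiableOn_lk a ie_mem).comp
    (by fun_prop : Differentiable ℂ fun z : Fin (m + 2) → ℂ => (δ : ℂ) • z).differentiableOn
    fun _ hz => smul_mem_tube hδ hz

lemma norm_damp_le {a δ : ℝ} (ha : 0 ≤ a) (hδ : 0 < δ) {z : Fin (m + 2) → ℂ}
    (hz : z ∈ tube (m + 2)) : ‖damp a δ z‖ ≤ 1 := by
  have hz' := smul_mem_tube hδ hz
  refine (norm_lk_le ha hz' ie_mem).trans (Real.rpow_le_one_of_one_le_of_nonpos ?_ (by linarith))
  have h1 : 0 < lor (imP ((δ : ℂ) • z)) := hz'.1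
  have h2 := lb_pos hz' (e0_mem m)
  rw [imP_ie, lor_add, lor_e0]
  linarith

lemma tendsto_damp (a : ℝ) (z : Fin (m + 2) → ℂ) :
    Filter.Tendsto (fun k : ℕ => damp a (1 / ((k : ℝ) + 1)) z) Filter.atTop (nhds 1) := by
  have h1 : lorC (zc 0 (ie m)) = -1 := by
    rw [lorC_eq, imP_zc]
    have hr : reP (zc 0 (ie m)) = 0 := by ext i; simp [reP, zc, ie, cmk]
    have hi : imP (0 : Fin (m + 2) → ℂ) = 0 := by ext i; simp [imP]
    have h0 : lor (0 : Fin (m + 2) → ℝ) = 0 := by simp [lor]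
    rw [hr, hi, zero_add, imP_ie, lor_e0, h0]
    simp [lb]
  have h2 : ContinuousAt (fun x : Fin (m + 2) → ℂ => lk a x (ie m)) 0 := by
    unfold lk
    refine ContinuousAt.cpow ?_ continuousAt_const (by rw [h1]; simp)
    have : Continuous fun x : Fin (m + 2) → ℂ => zc x (ie m) :=
      continuous_zc.comp (by fun_prop : Continuous fun x : Fin (m + 2) → ℂ => (x, ie m))
    exact (differentiable_lorC.continuous.comp this).neg.continuousAt
  have h3 : lk a 0 (ie m) = 1 := by rw [lk, h1]; simp
  have h4 : Filter.Tendsto (fun k : ℕ => ((1 / ((k : ℝ) + 1) : ℝ) : ℂ) • z) Filter.atTop (nhds 0) := by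
    have h5 : Continuous fun τ : ℝ => (τ : ℂ) • z := by fun_prop
    have h6 := (h5.tendsto 0).comp (tendsto_one_div_add_atTop_nhds_zero_nat (𝕜 := ℝ))
    rwa [ofReal_zero, zero_smul] at h6
  have h5 := h2.tendsto.comp h4
  rw [h3] at h5
  exact h5

lemma lintegral_damp_lt_top {t a δ p : ℝ} (hδ : 0 < δ) (h1 : 2 * hN m < a * p)
    (h2 : t + 3 * hN m - 1 < a * p) (h3 : t + 2 * hN m < a * p) (h4 : 0 < t + hN m)
    (h5 : -1 < t) : ∫⁻ z, ‖damp a δ z‖ₑ ^ p ∂(wM m 0 t) < ⊤ := by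
  obtain ⟨J, hJ0, hJ⟩ := exists_lintegral_lk_eq (s := 0) h1 (by linarith) h3 (by linarith) h5
  have h := (isG_smul hδ).lintegral_hmap 0 t 0 fun z : Fin (m + 2) → ℂ => ‖lk a z (ie m)‖ₑ ^ p
  simp only [hmap_smul] at h
  simp only [damp]
  rw [h, lintegral_lk_rpow 0 t a p ie_mem, hJ _ ie_mem]
  exact ENNReal.mul_lt_top ENNReal.ofReal_lt_top
    (ENNReal.mul_lt_top hJ0.lt_top ENNReal.ofReal_lt_top)

/-- Approximation of functions in `A^p` by functions in `A^p ∩ A²`. -/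
lemma exists_approx_A2 {ν p : ℝ} (hν : hN m - 1 < ν) (hp : 2 ≤ p) {F : (Fin (m + 2) → ℂ) → ℂ}
    (hF : DifferentiableOn ℂ F (tube (m + 2)))
    (hFp : ∫⁻ z, ‖F z‖ₑ ^ p ∂(wM m 0 (ν - hN m)) < ⊤) :
    ∃ Φ : ℕ → (Fin (m + 2) → ℂ) → ℂ, (∀ k, A2 m 0 (ν - hN m) (Φ k)) ∧
      (∀ k, ∫⁻ z, ‖Φ k z‖ₑ ^ p ∂(wM m 0 (ν - hN m)) < ⊤) ∧
      Filter.Tendsto (fun k => ∫⁻ z, ‖F z - Φ k z‖ₑ ^ p ∂(wM m 0 (ν - hN m))) Filter.atTop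
        (nhds 0) := by
  have hN1 := hN_ge m
  have hp0 : 0 < p := by linarith
  have hδ : ∀ k : ℕ, 0 < 1 / ((k : ℝ) + 1) := fun k => by positivity
  have hdl : ∀ k : ℕ, ∀ z ∈ tube (m + 2), ‖damp (ν + hN m) (1 / ((k : ℝ) + 1)) z‖ₑ ≤ 1 := by
    intro k z hz
    rw [← ofReal_norm]
    exact ENNReal.ofReal_le_one.2 (norm_damp_le (by linarith) (hδ k) hz)
  set Φ : ℕ → (Fin (m + 2) → ℂ) → ℂ :=
    fun k z => F z * damp (ν + hN m) (1 / ((k : ℝ) + 1)) z with hΦ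
  have hol : ∀ k, DifferentiableOn ℂ (Φ k) (tube (m + 2)) := fun k =>
    hF.mul (differentiableOn_damp _ (hδ k))
  have hle : ∀ k, ∀ z ∈ tube (m + 2), ‖Φ k z‖ₑ ≤ ‖F z‖ₑ := fun k z hz => by
    rw [hΦ, enorm_mul]
    exact mul_le_of_le_one_right' (hdl k z hz)
  have hpint : ∀ k, ∫⁻ z, ‖Φ k z‖ₑ ^ p ∂(wM m 0 (ν - hN m)) < ⊤ := fun k =>
    (lintegral_mono_ae ((ae_wM _ _).mono fun z hz =>
      ENNReal.rpow_le_rpow (hle k z hz) hp0.le)).trans_lt hFp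
  refine ⟨Φ, fun k => A2_of_lintegral_lt (hol k) ?_, hpint, ?_⟩
  · rcases hp.eq_or_lt with rfl | hp2
    · exact hpint k
    have hc : 1 < p / 2 := by linarith
    have hpq := Real.HolderConjugate.conjExponent hc
    set q := (p / 2).conjExponent with hq
    have hq1 : 1 < q := hpq.symm.lt
    have h1 : ∀ z, ‖Φ k z‖ₑ ^ (2 : ℝ)
        ≤ ‖F z‖ₑ ^ p + ‖damp (ν + hN m) (1 / ((k : ℝ) + 1)) z‖ₑ ^ (2 * q) := by
      intro z
      have h2 := ENNReal.young_inequality (‖F z‖ₑ ^ (2 : ℝ))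
        (‖damp (ν + hN m) (1 / ((k : ℝ) + 1)) z‖ₑ ^ (2 : ℝ)) hpq
      rw [← ENNReal.rpow_mul, ← ENNReal.rpow_mul, mul_div_cancel₀ _ two_ne_zero,
        ← ENNReal.mul_rpow_of_nonneg _ _ zero_le_two, ← enorm_mul] at h2
      refine h2.trans (add_le_add ?_ ?_)
      · exact ENNReal.div_le_of_le_mul (le_mul_of_one_le_right' (by simpa using hc.le))
      · exact ENNReal.div_le_of_le_mul (le_mul_of_one_le_right' (by simpa using hq1.le))
    refine (lintegral_mono h1).trans_lt ?_
    rw [lintegral_add_left' ((A2.aesm hF).enorm.pow_const p)]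
    refine ENNReal.add_lt_top.2 ⟨hFp, lintegral_damp_lt_top (hδ k) ?_ ?_ ?_ (by linarith)
      (by linarith)⟩ <;> nlinarith
  · have h0 : (0 : ℝ≥0∞) = ∫⁻ _, 0 ∂(wM m 0 (ν - hN m)) := by simp
    rw [h0]
    refine tendsto_lintegral_of_dominated_convergence' (fun z => 2 ^ p * ‖F z‖ₑ ^ p)
      (fun k => ((A2.aesm hF).sub (A2.aesm (hol k))).enorm.pow_const p)
      (fun k => (ae_wM _ _).mono fun z hz => ?_) ?_ (Filter.Eventually.of_forall fun z => ?_)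
    · simp only
      rw [← ENNReal.mul_rpow_of_nonneg _ _ hp0.le]
      refine ENNReal.rpow_le_rpow ?_ hp0.le
      refine (enorm_sub_le).trans ?_
      rw [two_mul]
      exact add_le_add le_rfl (hle k z hz)
    · rw [lintegral_const_mul' _ _ (ENNReal.rpow_ne_top_of_nonneg hp0.le (by simp))]
      exact (ENNReal.mul_lt_top (ENNReal.rpow_lt_top_of_nonneg hp0.le (by simp)) hFp).ne
    · have h1 := ((tendsto_damp (ν + hN m) z).const_mul (F z)).const_sub (F z)
      rw [mul_one, sub_self] at h1
      have h2 := (h1.enorm).ennrpow_const p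
      rwa [enorm_zero, ENNReal.zero_rpow_of_pos hp0] at h2

end damping

section hardy
variable {m : ℕ}

lemma lintegral_add_rpow_le {Ω : Type*} [MeasurableSpace Ω] {μ : Measure Ω} {f g : Ω → ℂ}
    (hf : AEStronglyMeasurable f μ) {p : ℝ} (hp : 1 ≤ p) :
    ∫⁻ z, ‖f z + g z‖ₑ ^ p ∂μ
      ≤ 2 ^ (p - 1) * (∫⁻ z, ‖f z‖ₑ ^ p ∂μ + ∫⁻ z, ‖g z‖ₑ ^ p ∂μ) := by
  rw [← lintegral_add_left' (hf.enorm.pow_const p),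
    ← lintegral_const_mul' _ _ (ENNReal.rpow_ne_top_of_nonneg (by linarith) (by simp))]
  refine lintegral_mono fun z => ?_
  exact (ENNReal.rpow_le_rpow (enorm_add_le _ _) (by linarith)).trans
    (ENNReal.rpow_add_le_mul_rpow_add_rpow _ _ hp)

lemma le_of_lpNorm_le {p ν C : ℝ} (hp : 0 < p) {f g : (Fin (m + 2) → ℂ) → ℂ}
    (h : lpNorm (m + 2) p ν g ≤ ENNReal.ofReal C * lpNorm (m + 2) p ν f) :
    lpInt (m + 2) p ν g ≤ ENNReal.ofReal C ^ p * lpInt (m + 2) p ν f := by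
  have h1 := ENNReal.rpow_le_rpow h hp.le
  rw [ENNReal.mul_rpow_of_nonneg _ _ hp.le, _root_.lpNorm, _root_.lpNorm, ← ENNReal.rpow_mul, ← ENNReal.rpow_mul,
    one_div, inv_mul_cancel₀ hp.ne', ENNReal.rpow_one, ENNReal.rpow_one] at h1
  exact h1

theorem hardy_of_projBounded {p ν : ℝ} (hp : 2 ≤ p) (hν : hN m - 1 < ν) (hν1 : 1 < ν + hN m)
    (h : projBounded (m + 2) p ν) : hardy (m + 2) p ν := by
  have hp0 : 0 < p := by linarith
  obtain ⟨C, hC, hPB⟩ := h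
  obtain ⟨d, hd, hdF⟩ := exists_integral_BoxOp hν hν1
  obtain ⟨B, hB, hBF⟩ := exists_lintegral_BoxOp_le (m := m) ν (p := p) (by linarith)
  set μ := wM m 0 (ν - hN m) with hμ
  set K : ℝ≥0∞ := (‖(d : ℂ)‖ₑ ^ p)⁻¹ * ENNReal.ofReal C ^ p with hK
  have hd' : ‖(d : ℂ)‖ₑ ^ p ≠ 0 := by
    rw [Ne, ENNReal.rpow_eq_zero_iff_of_pos hp0]
    simpa using hd
  have hd'' : ‖(d : ℂ)‖ₑ ^ p ≠ ⊤ := ENNReal.rpow_ne_top_of_nonneg hp0.le (by simp)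
  have hKt : K ≠ ⊤ := ENNReal.mul_ne_top (ENNReal.inv_ne_top.2 hd')
    (ENNReal.rpow_ne_top_of_nonneg hp0.le ENNReal.ofReal_ne_top)
  have step : ∀ F, A2 m 0 (ν - hN m) F → ∫⁻ z, ‖F z‖ₑ ^ p ∂μ < ⊤ →
      ∫⁻ z, ‖F z‖ₑ ^ p ∂μ ≤ K * ∫⁻ z, ‖(lor (imP z) : ℂ) * BoxOp F z‖ₑ ^ p ∂μ := by
    intro F hF hFp
    have hm := memLp_BoxOp hF
    have h1 := hPB (fun z => (lor (imP z) : ℂ) * BoxOp F z) ((d : ℂ) • F)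
      (by rw [dV_eq]; exact hm.1)
      (by
        rw [lpInt_eq ν zero_le_two]
        have h2 := hm.2
        rw [eLpNorm_two] at h2
        exact (ENNReal.rpow_lt_top_iff_of_pos (by norm_num)).1 h2)
      (by
        rw [lpInt_eq ν hp0.le]
        exact (hBF F hF.holo).trans_lt (ENNReal.mul_lt_top hB.lt_top hFp))
      ⟨(memA_two_iff ν _).2 (hF.const_smul _), fun h hh => by
        rw [dV_eq, hdF F h hF ((memA_two_iff ν _).1 hh), ← integral_const_mul]
        simp only [Pi.smul_apply, smul_eq_mul, mul_assoc, hμ]⟩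
    have h2 := le_of_lpNorm_le hp0 h1
    rw [lpInt_eq ν hp0.le, lpInt_eq ν hp0.le] at h2
    simp only [Pi.smul_apply, smul_eq_mul, enorm_mul (d : ℂ),
      ENNReal.mul_rpow_of_nonneg _ _ hp0.le] at h2
    rw [lintegral_const_mul' _ _ hd''] at h2
    simp only [enorm_mul, ENNReal.mul_rpow_of_nonneg _ _ hp0.le]
    rw [hK, mul_assoc, ← ENNReal.mul_le_iff_le_inv hd' hd'']
    simpa only [enorm_mul, ENNReal.mul_rpow_of_nonneg _ _ hp0.le] using h2
  set c : ℝ≥0∞ := 2 ^ (p - 1) with hc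
  have hct : c ≠ ⊤ := ENNReal.rpow_ne_top_of_nonneg (by linarith) (by simp)
  have main : ∀ F, memA (m + 2) p ν F →
      ∫⁻ z, ‖F z‖ₑ ^ p ∂μ ≤ c * (K * (c * ∫⁻ z, ‖(lor (imP z) : ℂ) * BoxOp F z‖ₑ ^ p ∂μ)) := by
    intro F hF
    have hFp := hF.2
    rw [lpInt_eq ν hp0.le] at hFp
    obtain ⟨Φ, hΦ, hΦp, hlim⟩ := exists_approx_A2 hν hp hF.1 hFp
    set X := ∫⁻ z, ‖(lor (imP z) : ℂ) * BoxOp F z‖ₑ ^ p ∂μ with hX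
    set ε : ℕ → ℝ≥0∞ := fun k => ∫⁻ z, ‖F z - Φ k z‖ₑ ^ p ∂μ with hε
    have hk : ∀ k, ∫⁻ z, ‖F z‖ₑ ^ p ∂μ ≤ c * (K * (c * (X + B * ε k)) + ε k) := by
      intro k
      have e1 : ∫⁻ z, ‖F z‖ₑ ^ p ∂μ ≤ c * (∫⁻ z, ‖Φ k z‖ₑ ^ p ∂μ + ε k) := by
        have := lintegral_add_rpow_le (μ := μ) (f := Φ k) (g := fun z => F z - Φ k z) (p := p)
          (A2.aesm (hΦ k).holo) (by linarith)
        simpa using this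
      have e2 : ∫⁻ z, ‖(lor (imP z) : ℂ) * BoxOp (Φ k) z‖ₑ ^ p ∂μ ≤ c * (X + B * ε k) := by
        have hsub : DifferentiableOn ℂ (fun z => Φ k z - F z) (tube (m + 2)) :=
          (hΦ k).holo.sub hF.1
        have e3 := lintegral_add_rpow_le (μ := μ) (f := fun z => (lor (imP z) : ℂ) * BoxOp F z)
          (g := fun z => (lor (imP z) : ℂ) * BoxOp (fun z => Φ k z - F z) z) (p := p)
          (aesm_BoxOp _ _ hF.1) (by linarith)
        have e4 := hBF _ hsub
        have e5 : ∫⁻ z, ‖Φ k z - F z‖ₑ ^ p ∂μ = ε k :=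
          lintegral_congr fun z => by rw [← enorm_neg, neg_sub]
        rw [e5] at e4
        refine le_trans (le_of_eq ?_) (e3.trans (mul_le_mul_right (add_le_add le_rfl e4) c))
        refine lintegral_congr_ae ((ae_wM _ _).mono fun z hz => ?_)
        have e6 : BoxOp (Φ k) z = BoxOp F z + BoxOp (fun z => Φ k z - F z) z := by
          rw [← BoxOp_add hF.1 hsub hz]
          congr 1
          ext z; simp
        simp only [e6, mul_add]
      refine e1.trans (mul_le_mul_right (add_le_add ((step _ (hΦ k) (hΦp k)).trans ?_) le_rfl) c)
      exact mul_le_mul_right e2 K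
    have t1 : Filter.Tendsto (fun k => X + B * ε k) Filter.atTop (nhds (X + B * 0)) :=
      tendsto_const_nhds.add (ENNReal.Tendsto.const_mul hlim (Or.inr hB))
    have t2 := (ENNReal.Tendsto.const_mul (ENNReal.Tendsto.const_mul t1 (Or.inr hct))
      (Or.inr hKt)).add hlim
    have t3 := ENNReal.Tendsto.const_mul t2 (Or.inr hct)
    rw [mul_zero, add_zero, add_zero] at t3
    exact ge_of_tendsto' t3 hk
  have hcKc : c * (K * c) ≠ ⊤ := ENNReal.mul_ne_top hct (ENNReal.mul_ne_top hKt hct)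
  refine ⟨(c * (K * c)).toReal + 1, by positivity, fun F hF => ?_⟩
  rw [lpInt_eq ν hp0.le, lpInt_eq ν hp0.le]
  refine (main F hF).trans ?_
  rw [← mul_assoc K, ← mul_assoc]
  gcongr
  rw [← ENNReal.ofReal_toReal hcKc]
  exact ENNReal.ofReal_le_ofReal (by simp)

end hardy

/-- If two families have proportional Gram matrices and the first one is total, then every vector
of the second space has a counterpart in the first one. -/
theorem exists_of_inner_eq {H H' ι : Type*} [NormedAddCommGroup H] [InnerProductSpace ℂ H]
    [CompleteSpace H] [NormedAddCommGroup H'] [InnerProductSpace ℂ H'] [CompleteSpace H']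
    {b : ι → H} {k : ι → H'} {c : ℝ}
    (hb : ∀ x, (∀ i, inner ℂ (b i) x = 0) → x = 0)
    (hk : ∀ i j, inner ℂ (k i) (k j) = (c : ℂ) * inner ℂ (b i) (b j)) (φ : H') :
    ∃ g : H, ‖g‖ ≤ √|c| * ‖φ‖ ∧ ∀ i, inner ℂ (b i) g = inner ℂ (k i) φ := by
  set e := Finsupp.linearCombination ℂ b
  set f := Finsupp.linearCombination ℂ k
  have hin : ∀ x y, inner ℂ (f x) (f y) = (c : ℂ) * inner ℂ (e x) (e y) := by
    intro x y
    induction x using Finsupp.induction_linear with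
    | zero => simp
    | add x x' hx hx' => rw [map_add, map_add, inner_add_left, inner_add_left, hx, hx', mul_add]
    | single i a =>
      induction y using Finsupp.induction_linear with
      | zero => simp
      | add x x' hx hx' => rw [map_add, map_add, inner_add_right, inner_add_right, hx, hx', mul_add]
      | single j a' =>
        simp only [e, f, Finsupp.linearCombination_single, inner_smul_left, inner_smul_right, hk]
        ring
  have hle : ∀ x, ‖f x‖ ≤ √|c| * ‖e x‖ := by
    intro x
    refine abs_le_of_sq_le_sq' ?_ (by positivity) |>.2
    have h1 := congrArg Complex.re (hin x x)
    rw [Complex.re_ofReal_mul] at h1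
    have h2 : (inner ℂ (f x) (f x)).re = ‖f x‖ ^ 2 := inner_self_eq_norm_sq (𝕜 := ℂ) _
    have h3 : (inner ℂ (e x) (e x)).re = ‖e x‖ ^ 2 := inner_self_eq_norm_sq (𝕜 := ℂ) _
    rw [h2, h3] at h1
    rw [h1, mul_pow, Real.sq_sqrt (abs_nonneg c)]
    exact mul_le_mul_of_nonneg_right (le_abs_self c) (by positivity)
  have hdense : DenseRange e := by
    have h1 : (LinearMap.range e).topologicalClosure = ⊤ := by
      rw [Submodule.topologicalClosure_eq_top_iff, Submodule.eq_bot_iff]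
      intro x hx
      refine hb x fun i => ?_
      rw [Submodule.mem_orthogonal] at hx
      exact hx _ ⟨Finsupp.single i 1, by simp [e]⟩
    intro x
    have h2 : x ∈ (LinearMap.range e).topologicalClosure := by rw [h1]; trivial
    exact h2
  set W : H →L[ℂ] H' := f.extendOfNorm e
  have hW : ∀ i, W (b i) = k i := by
    intro i
    have := LinearMap.extendOfNorm_eq (f := f) hdense ⟨_, hle⟩ (Finsupp.single i 1)
    simpa [e, f] using this
  have hWn : ‖W‖ ≤ √|c| := LinearMap.opNorm_extendOfNorm_le hdense (by positivity) hle
  refine ⟨ContinuousLinearMap.adjoint W φ, ?_, fun i => ?_⟩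
  · refine ((ContinuousLinearMap.adjoint W).le_opNorm φ).trans ?_
    rw [LinearIsometryEquiv.norm_map]
    gcongr
  · rw [ContinuousLinearMap.adjoint_inner_right, hW]

section
variable {n : ℕ}

/-- Holomorphy of a parametric integral whose integrand is locally integrable jointly. -/
theorem differentiableAt_integral_of_prod {Ω : Type*} [MeasurableSpace Ω] {μ : Measure Ω} [SFinite μ]
    {U : Set (Fin n → ℂ)} (hU : IsOpen U) {G : (Fin n → ℂ) → Ω → ℂ} {z₀ : Fin n → ℂ} {R : ℝ}
    (hR : 0 < R) (hRU : Metric.closedBall z₀ R ⊆ U)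
    (hd : ∀ᵐ u ∂μ, DifferentiableOn ℂ (fun z => G z u) U)
    (hm : ∀ z ∈ U, AEStronglyMeasurable (G z) μ)
    (hj : AEStronglyMeasurable (Function.uncurry G)
      ((volume.restrict (Metric.closedBall z₀ R)).prod μ))
    (hfin : ∫⁻ z in Metric.closedBall z₀ R, ∫⁻ u, ‖G z u‖ₑ ∂μ < ⊤) :
    DifferentiableAt ℂ (fun z => ∫ u, G z u ∂μ) z₀ := by
  set B := Metric.closedBall z₀ R
  set S : Ω → ℝ≥0∞ := fun u => ∫⁻ z in B, ‖G z u‖ₑ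
  set V := volume (Metric.closedBall (0 : Fin n → ℂ) (R / 2))
  have hV0 : V ≠ 0 := (Metric.measure_closedBall_pos _ _ (by linarith)).ne'
  have hVt : V ≠ ⊤ := measure_closedBall_lt_top.ne
  have hS : AEMeasurable S μ := hj.enorm.lintegral_prod_left'
  have hSi : ∫⁻ u, S u ∂μ < ⊤ := by
    rw [lintegral_lintegral_swap (f := fun u z => ‖G z u‖ₑ)]
    · exact hfin
    · exact hj.enorm.comp_quasiMeasurePreserving
        (Measure.measurePreserving_swap (μ := μ)).quasiMeasurePreserving
  have hSf : ∀ᵐ u ∂μ, S u < ⊤ := ae_lt_top' hS hSi.ne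
  have hsub : Metric.ball z₀ (R / 2) ⊆ U := (Metric.ball_subset_closedBall.trans
    (Metric.closedBall_subset_closedBall (by linarith))).trans hRU
  refine (hasFDerivAt_integral_param (r := R / 2) (b := fun u => (S u / V).toReal) (by linarith)
    (fun z hz => hm z (hsub hz)) (hd.mono fun u hu => hu.mono hsub) ?_ ?_).differentiableAt
  · refine integrable_toReal_of_lintegral_ne_top (hS.div_const _) ?_
    simp only [div_eq_mul_inv]
    rw [lintegral_mul_const' _ _ (ENNReal.inv_ne_top.2 hV0)]
    exact ENNReal.mul_ne_top hSi.ne (ENNReal.inv_ne_top.2 hV0)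
  · filter_upwards [hd, hSf] with u hu hSu z hz
    have hzB : Metric.closedBall z (R / 2) ⊆ B := by
      intro w hw
      have h1 := Metric.mem_ball.1 hz
      have h2 := Metric.mem_closedBall.1 hw
      refine Metric.mem_closedBall.2 ((dist_triangle w z z₀).trans (by linarith))
    have h1 := (enorm_mul_volume_le hU hu (hzB.trans hRU)).trans (lintegral_mono_set hzB)
    have h2 : ‖G z u‖ₑ ≤ S u / V := by
      rw [ENNReal.le_div_iff_mul_le (Or.inl hV0) (Or.inl hVt)]
      exact h1
    have h3 := ENNReal.toReal_mono (ENNReal.div_ne_top hSu.ne hV0) h2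
    simpa using h3

end

section gram
variable {m : ℕ}

lemma continuousOn_wt (s t : ℝ) : ContinuousOn (wt (m := m) s t) (cone (m + 2)) := by
  unfold wt
  refine ContinuousOn.mul (ContinuousOn.rpow_const (by unfold la; fun_prop) fun y hy =>
    Or.inl (mem_cone_iff.1 hy).2.ne') (ContinuousOn.rpow_const lor_continuous.continuousOn
      fun y hy => Or.inl (ne_of_gt (mem_cone_iff.1 hy).1))

/-- The Gram kernel of the functions `lk a · z` in a weighted `L²` space. -/
def gram (m : ℕ) (s t a : ℝ) (z w : Fin (m + 2) → ℂ) : ℂ :=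
  ∫ u, (starRingEnd ℂ) (lk a u z) * lk a u w ∂(wM m s t)

lemma aesm_lk_left {a s t : ℝ} {z : Fin (m + 2) → ℂ} (hz : z ∈ tube (m + 2)) :
    AEStronglyMeasurable (fun u => lk a u z) (wM m s t) :=
  A2.aesm (differentiableOn_lk a hz)

lemma aesm_conj {Ω : Type*} [MeasurableSpace Ω] {μ : Measure Ω} {f : Ω → ℂ}
    (hf : AEStronglyMeasurable f μ) :
    AEStronglyMeasurable (fun u => (starRingEnd ℂ) (f u)) μ :=
  continuous_conj.comp_aestronglyMeasurable hf

lemma gram_holo {s t a : ℝ} (h1 : hN m < a) (h2 : s + t + 3 * hN m - 1 < 2 * a)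
    (h3 : t + 2 * hN m < 2 * a) (h4 : 0 < s + t + hN m) (h5 : -1 < t) {w : Fin (m + 2) → ℂ}
    (hw : w ∈ tube (m + 2)) : DifferentiableOn ℂ (fun z => gram m s t a z w) (tube (m + 2)) := by
  intro z₀ hz₀
  refine DifferentiableAt.differentiableWithinAt ?_
  obtain ⟨R, hR, hRt⟩ := exists_closedBall_subset_tube hz₀
  obtain ⟨J, hJ0, hJ⟩ := exists_lintegral_lk_eq (m := m) (s := s) (t := t) (a := a * 2) (by linarith)
    (by linarith) (by linarith) h4 h5
  have hJ2 : ∀ z ∈ tube (m + 2), ∫⁻ u, ‖lk a u z‖ₑ ^ (2 : ℝ) ∂(wM m s t)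
      = J * ENNReal.ofReal (wt s (t + (2 * hN m - a * 2)) (imP z)) := fun z hz => by
    rw [lintegral_lk_rpow s t a 2 hz, hJ z hz]
  refine differentiableAt_integral_of_prod tube_isOpen hR hRt ?_ ?_ ?_ ?_
  · refine (ae_wM s t).mono fun u hu => ?_
    refine DifferentiableOn.mul_const ?_ _
    exact (differentiableOn_lk a hu).congr fun z hz => lk_conj a hu hz
  · exact fun z hz => (aesm_conj (aesm_lk_left hz)).mul (aesm_lk_left hw)
  · have hB : ∀ᵐ z ∂(volume.restrict (Metric.closedBall z₀ R)), z ∈ tube (m + 2) :=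
      (ae_restrict_mem measurableSet_closedBall).mono fun z hz => hRt hz
    have hm : MeasurableSet (tube (m + 2) ×ˢ tube (m + 2)) := measurable_tube.prod measurable_tube
    set σ := (volume.restrict (Metric.closedBall z₀ R)).prod (wM m s t)
    have hmem : ∀ᵐ q ∂σ, q ∈ tube (m + 2) ×ˢ tube (m + 2) := by
      refine (Measure.ae_prod_iff_ae_ae (p := fun q => q ∈ tube (m + 2) ×ˢ tube (m + 2)) hm).2 ?_
      exact hB.mono fun z hz => (ae_wM s t).mono fun u hu => ⟨hz, hu⟩
    have hcont : ContinuousOn (fun q : (Fin (m + 2) → ℂ) × (Fin (m + 2) → ℂ) =>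
        lk a q.1 q.2 * lk a q.2 w) (tube (m + 2) ×ˢ tube (m + 2)) :=
      (continuousOn_lk a).mul ((differentiableOn_lk a hw).continuousOn.comp continuousOn_snd
        fun q hq => hq.2)
    have h := hcont.aestronglyMeasurable (μ := σ) hm
    rw [Measure.restrict_eq_self_of_ae_mem hmem] at h
    exact h.congr (hmem.mono fun q hq => by simp only [Function.uncurry, lk_conj a hq.2 hq.1])
  · have hle : ∀ z ∈ tube (m + 2), ∫⁻ u, ‖(starRingEnd ℂ) (lk a u z) * lk a u w‖ₑ ∂(wM m s t)
        ≤ J * ENNReal.ofReal (wt s (t + (2 * hN m - a * 2)) (imP z))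
          + J * ENNReal.ofReal (wt s (t + (2 * hN m - a * 2)) (imP w)) := by
      intro z hz
      rw [← hJ2 z hz, ← hJ2 w hw, ← lintegral_add_left' ((aesm_lk_left hz).enorm.pow_const _)]
      refine lintegral_mono fun u => ?_
      rw [enorm_mul, RCLike.enorm_conj, ENNReal.rpow_two, ENNReal.rpow_two]
      rcases le_total ‖lk a u z‖ₑ ‖lk a u w‖ₑ with h | h
      · exact (mul_le_mul_left h _).trans (by rw [← sq]; exact le_add_self)
      · exact (mul_le_mul_right h _).trans (by rw [← sq]; exact le_self_add)
    refine lt_of_le_of_lt (setLIntegral_mono' measurableSet_closedBall fun z hz => hle z (hRt hz)) ?_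
    rw [lintegral_add_right _ measurable_const, lintegral_const_mul' _ _ hJ0, setLIntegral_const]
    refine ENNReal.add_lt_top.2 ⟨ENNReal.mul_lt_top hJ0.lt_top ?_, ENNReal.mul_lt_top
      (ENNReal.mul_lt_top hJ0.lt_top ENNReal.ofReal_lt_top) measure_closedBall_lt_top⟩
    have hc : ContinuousOn (fun z => wt s (t + (2 * hN m - a * 2)) (imP z))
        (Metric.closedBall z₀ R) :=
      (continuousOn_wt _ _).comp imP_continuous.continuousOn fun z hz => hRt hz
    exact (hc.integrableOn_compact (isCompact_closedBall _ _)).lintegral_lt_top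

lemma isCK_gram {s t a : ℝ} (h1 : hN m < a) (h2 : s + t + 3 * hN m - 1 < 2 * a)
    (h3 : t + 2 * hN m < 2 * a) (h4 : 0 < s + t + hN m) (h5 : -1 < t) :
    IsCK (fun A T => (A ^ (-s) * T ^ (2 * a - t - 4 * hN m) * T ^ (m + 2))⁻¹) (gram m s t a) where
  holo w hw := gram_holo h1 h2 h3 h4 h5 hw
  herm z _ w _ := by
    rw [gram, gram, ← integral_conj]
    simp [mul_comm]
  cov {G A T} hG x z hz w hw := by
    have hpos : 0 < (A ^ s * T ^ t * T ^ (m + 2)) := (mul_pos (mul_pos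
      (Real.rpow_pos_of_pos hG.A_pos _) (Real.rpow_pos_of_pos hG.T_pos _)) (pow_pos hG.T_pos _))
    have hi := hG.integral_hmap s t x fun u => (starRingEnd ℂ) (lk a u (hmap G x z))
      * lk a u (hmap G x w)
    have h6 : ∫ u, (starRingEnd ℂ) (lk a (hmap G x u) (hmap G x z))
        * lk a (hmap G x u) (hmap G x w) ∂(wM m s t)
        = ((T ^ (-a) * T ^ (-a) : ℝ) : ℂ) * gram m s t a z w := by
      rw [gram, ← integral_const_mul]
      refine integral_congr_ae ((ae_wM s t).mono fun u hu => ?_)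
      simp only [hG.lk_hmap a x hu hz, hG.lk_hmap a x hu hw, map_mul, conj_ofReal]
      push_cast
      ring
    rw [h6] at hi
    change _ = ((_ : ℝ) : ℂ) * gram m s t a (hmap G x z) (hmap G x w) at hi
    have h7 : (A ^ (-s) * T ^ (2 * a - t - 4 * hN m) * T ^ (m + 2))⁻¹
        = A ^ s * T ^ t * T ^ (m + 2) * (T ^ (-a) * T ^ (-a)) := by
      rw [← Real.rpow_natCast T (m + 2), two_hN, Real.rpow_neg hG.A_pos.le, mul_inv, mul_inv, inv_inv,
        ← Real.rpow_neg hG.T_pos.le, ← Real.rpow_neg hG.T_pos.le, mul_assoc, ← Real.rpow_add hG.T_pos,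
        ← Real.rpow_add hG.T_pos, mul_assoc, ← Real.rpow_add hG.T_pos, mul_assoc,
        ← Real.rpow_add hG.T_pos]
      ring_nf
    rw [h7, ofReal_mul, mul_assoc, hi, ← mul_assoc, ← ofReal_mul, mul_inv_cancel₀ hpos.ne',
      ofReal_one, one_mul]

/-- Boundedness in weighted `L²` of the integral operators with kernel `lk a`. -/
theorem exists_integral_lk_le {s t a : ℝ} (h1 : hN m < a) (h2 : s + t + 3 * hN m - 1 < 2 * a)
    (h3 : t + 2 * hN m < 2 * a) (h4 : 0 < s + t + hN m) (h5 : -1 < t)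
    (h6 : 0 < 2 * a - s - t - 3 * hN m)
    (h7 : -1 < 2 * a - t - 4 * hN m) :
    ∃ C : ℝ≥0∞, C ≠ ⊤ ∧ ∀ φ, MemLp φ 2 (wM m s t) → ∃ g, A2 m (-s) (2 * a - t - 4 * hN m) g ∧
      eLpNorm g 2 (wM m (-s) (2 * a - t - 4 * hN m)) ≤ C * eLpNorm φ 2 (wM m s t) ∧
      ∀ z ∈ tube (m + 2), g z = ∫ u, φ u * lk a z u ∂(wM m s t) := by
  set t' := 2 * a - t - 4 * hN m with ht'
  have hN1 := hN_ge m
  have hκ : ∀ z ∈ tube (m + 2), A2 m (-s) t' fun u => lk a u z := fun z hz =>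
    A2_lk h1 (by linarith) (by linarith) (by linarith) (by linarith) hz
  have hκ2 : ∀ z ∈ tube (m + 2), A2 m s t fun u => lk a u z := fun z hz =>
    A2_lk h1 h2 h3 h4 h5 hz
  have hb := bk_ie_ne (hκ _ ie_mem) ie_mem (lk_ne a ie_mem ie_mem)
  have hc := (isCK_gram h1 h2 h3 h4 h5).eq_smul (by simp) (isCK_bk (-s) t') hb
  set c : ℝ := (gram m s t a (ie m) (ie m)).re / (bk m (-s) t' (ie m) (ie m)).re
  refine ⟨ENNReal.ofReal √|c|, ENNReal.ofReal_ne_top, fun φ hφ => ?_⟩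
  have hin : ∀ z ∈ tube (m + 2), ∀ v : hol2 m (-s) t',
      inner ℂ (A2_bk (s := -s) (t := t') z).vec v = rep v z := by
    intro z hz v
    rw [inner_hol2, (A2_rep v).repro hz]
    refine integral_congr_ae ((ae_wM _ _).mono fun u hu => ?_)
    simp only [(A2_bk (s := -s) (t := t') z).rep_eqOn hu]
  have hb0 : ∀ v : hol2 m (-s) t', (∀ z : tube (m + 2),
      inner ℂ (A2_bk (s := -s) (t := t') z.1).vec v = 0) → v = 0 := by
    intro v hv
    have h10 : ∀ᵐ z ∂(wM m (-s) t'), rep v z = 0 :=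
      (ae_wM _ _).mono fun z hz => (hin z hz v).symm.trans (hv ⟨z, hz⟩)
    refine Subtype.ext (Lp.ext ?_)
    filter_upwards [coe_ae_eq_rep v, h10, Lp.coeFn_zero ℂ 2 (wM m (-s) t')] with z h11 h12 h13
    rw [h11, h12, ZeroMemClass.coe_zero, h13]
    rfl
  have hk0 : ∀ z w : tube (m + 2), (inner ℂ ((hκ2 z.1 z.2).memLp.toLp _)
      ((hκ2 w.1 w.2).memLp.toLp _) : ℂ) = (c : ℂ) * inner ℂ
        (A2_bk (s := -s) (t := t') z.1).vec (A2_bk (s := -s) (t := t') w.1).vec := by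
    rintro ⟨z, hz⟩ ⟨w, hw⟩
    rw [hin z hz, (A2_bk (s := -s) (t := t') w).rep_eqOn hz, ← hc z hz w hw, L2.inner_def, gram]
    refine integral_congr_ae ?_
    filter_upwards [(hκ2 z hz).memLp.coeFn_toLp, (hκ2 w hw).memLp.coeFn_toLp] with u h10 h11
    rw [h10, h11, mul_comm]
    rfl
  obtain ⟨g, hg, hgz⟩ := exists_of_inner_eq hb0 hk0 (hφ.toLp φ)
  refine ⟨rep g, A2_rep g, ?_, fun z hz => ?_⟩
  · rw [← enorm_hol2, ← Lp.enorm_toLp (hf := hφ), ← ofReal_norm, ← ofReal_norm,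
      ← ENNReal.ofReal_mul (Real.sqrt_nonneg _)]
    exact ENNReal.ofReal_le_ofReal hg
  · have := hgz ⟨z, hz⟩
    simp only [hin z hz] at this
    rw [this, L2.inner_def]
    refine integral_congr_ae ?_
    filter_upwards [ae_wM s t, hφ.coeFn_toLp, (hκ2 z hz).memLp.coeFn_toLp] with u hu h10 h11
    rw [h10, h11, ← lk_conj a hu hz]
    rfl

end gram

/-- Real interpolation between `L²` and `L^∞` from the truncated weak type estimate. -/
theorem lintegral_rpow_le_of_meas_lt {Ω : Type*} [MeasurableSpace Ω] {μ : Measure Ω} {g h : Ω → ℝ}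
    (hg0 : 0 ≤ᵐ[μ] g) (hg : AEMeasurable g μ) (hh0 : 0 ≤ᵐ[μ] h) (hh : Measurable h) {p c : ℝ}
    (hp : 2 < p) (hc : 0 < c) {C : ℝ≥0∞} (hC : C ≠ ⊤)
    (hw : ∀ t > 0, μ {ω | t < g ω} * ENNReal.ofReal (t ^ 2)
      ≤ C * ∫⁻ ω in {ω | c * t < h ω}, ENNReal.ofReal (h ω ^ 2) ∂μ) :
    ∫⁻ ω, ENNReal.ofReal (g ω ^ p) ∂μ
      ≤ ENNReal.ofReal p * (C * ((ENNReal.ofReal (p - 2))⁻¹ * (ENNReal.ofReal ((c⁻¹) ^ (p - 2)) *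
        ∫⁻ ω, ENNReal.ofReal (h ω ^ p) ∂μ))) := by
  rw [lintegral_rpow_eq_lintegral_meas_lt_mul μ hg0 hg (by linarith)]
  set σ := μ.withDensity fun ω => ENNReal.ofReal (h ω ^ 2) with hσ
  have hm2 : Measurable fun ω => ENNReal.ofReal (h ω ^ 2) := (hh.pow_const 2).ennreal_ofReal
  have hac : σ ≪ μ := withDensity_absolutelyContinuous _ _
  have h1 := lintegral_rpow_eq_lintegral_meas_lt_mul (f := fun ω => h ω / c) (p := p - 2) σ
    (hac.ae_le (hh0.mono fun ω hω => div_nonneg hω hc.le)) (hh.div_const c).aemeasurable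
    (by linarith)
  have h2 : ∫⁻ ω, ENNReal.ofReal ((h ω / c) ^ (p - 2)) ∂σ
      = ENNReal.ofReal ((c⁻¹) ^ (p - 2)) * ∫⁻ ω, ENNReal.ofReal (h ω ^ p) ∂μ := by
    rw [hσ, lintegral_withDensity_eq_lintegral_mul _ hm2
      ((hh.div_const c).pow_const _).ennreal_ofReal,
      ← lintegral_const_mul' _ _ ENNReal.ofReal_ne_top]
    refine lintegral_congr_ae (hh0.mono fun ω hω => ?_)
    have hω' : 0 ≤ h ω := hω
    simp only [Pi.mul_apply]
    rw [← ENNReal.ofReal_mul (by positivity), ← ENNReal.ofReal_mul (by positivity), div_eq_mul_inv,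
      Real.mul_rpow hω' (by positivity)]
    congr 1
    rw [← mul_assoc, ← Real.rpow_natCast, mul_comm (_ * _), ← Real.rpow_add' hω'
      (by push_cast; linarith)]
    congr 2
    push_cast; ring
  have hp2 : ENNReal.ofReal (p - 2) ≠ 0 := by
    rw [Ne, ENNReal.ofReal_eq_zero]; linarith
  have h3 : (ENNReal.ofReal (p - 2))⁻¹ * ∫⁻ ω, ENNReal.ofReal ((h ω / c) ^ (p - 2)) ∂σ
      = ∫⁻ t in Ioi 0, σ {a | t < h a / c} * ENNReal.ofReal (t ^ (p - 2 - 1)) := by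
    rw [h1, ← mul_assoc, ENNReal.inv_mul_cancel hp2 ENNReal.ofReal_ne_top, one_mul]
  rw [← h2, h3, ← lintegral_const_mul' _ _ hC]
  refine mul_le_mul_right (setLIntegral_mono' measurableSet_Ioi fun t ht => ?_) _
  have ht' : 0 < t := ht
  have h4 : {a | t < h a / c} = {a | c * t < h a} := by
    ext a
    simp only [mem_ofPred_eq, lt_div_iff₀ hc, mul_comm c]
  rw [h4, hσ, withDensity_apply _ (measurableSet_lt measurable_const hh), ← mul_assoc]
  have h5 : t ^ (p - 1) = t ^ 2 * t ^ (p - 2 - 1) := by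
    rw [← Real.rpow_natCast, ← Real.rpow_add ht']
    congr 1
    push_cast; ring
  rw [h5, ENNReal.ofReal_mul (by positivity), ← mul_assoc]
  exact mul_le_mul_left (hw t ht') _

section top
variable {m : ℕ}

/-- The integral operator with kernel `lk a` on the standard weight. -/
def Iop (m : ℕ) (ν a : ℝ) (f : (Fin (m + 2) → ℂ) → ℂ) (z : Fin (m + 2) → ℂ) : ℂ :=
  ∫ w, f w * lk a z w ∂(wM m 0 (ν - hN m))

/-- Uniform estimate with weights. -/
lemma exists_enorm_Iop_le {ν γ : ℝ} (hν : hN m - 1 < ν) (h1 : hN m - 2 < γ) (h2 : γ < ν) :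
    ∃ J : ℝ≥0∞, J ≠ ⊤ ∧ ∀ f : (Fin (m + 2) → ℂ) → ℂ, ∀ s : ℝ≥0∞, s ≠ ⊤ →
      (∀ w ∈ tube (m + 2), ‖f w‖ₑ ≤ s * ENNReal.ofReal (wt (-γ) 0 (imP w))) →
      ∀ z ∈ tube (m + 2), ∫⁻ w, ‖f w * lk (ν + 1 + hN m) z w‖ₑ ∂(wM m 0 (ν - hN m))
        ≤ s * (J * ENNReal.ofReal (wt (-γ) (-1) (imP z))) := by
  have hN1 := hN_ge m
  obtain ⟨J, hJ0, hJ⟩ := exists_lintegral_lk_eq (m := m) (s := -γ) (t := ν - hN m)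
    (a := ν + 1 + hN m) (by linarith) (by linarith) (by linarith) (by linarith) (by linarith)
  refine ⟨J, hJ0, fun f s hs hf z hz => ?_⟩
  have h3 : ν - hN m + (2 * hN m - (ν + 1 + hN m)) = -1 := by ring
  rw [← h3, ← hJ z hz]
  have h4 := lintegral_wM_mul (m := m) 0 (ν - hN m) (-γ) 0 fun w => ‖lk (ν + 1 + hN m) w z‖ₑ
  rw [zero_add, add_zero] at h4
  rw [← h4, ← lintegral_const_mul' _ _ hs]
  refine lintegral_mono_ae ((ae_wM _ _).mono fun w hw => ?_)
  rw [enorm_mul, enorm_lk_comm _ hz hw, ← mul_assoc]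
  exact mul_le_mul_left (hf w hw) _

lemma enorm_wt_rpow (s t : ℝ) {p : ℝ} (hp : 0 ≤ p) {y : Fin (m + 2) → ℝ} (hy : y ∈ cone (m + 2)) :
    ‖(wt s t y : ℂ)‖ₑ ^ p = ENNReal.ofReal (wt (s * p) (t * p) y) := by
  obtain ⟨h1, h2⟩ := mem_cone_iff.1 hy
  rw [← ofReal_norm, norm_real, Real.norm_of_nonneg (wt_pos s t hy).le,
    ENNReal.ofReal_rpow_of_nonneg (wt_pos s t hy).le hp, wt, wt,
    Real.mul_rpow (Real.rpow_nonneg h2.le _) (Real.rpow_nonneg h1.le _), ← Real.rpow_mul h2.le,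
    ← Real.rpow_mul h1.le]

lemma lintegral_wt_mul_rpow (s t s' t' : ℝ) {p : ℝ} (hp : 0 ≤ p) (f : (Fin (m + 2) → ℂ) → ℂ) :
    ∫⁻ z, ‖(wt s' t' (imP z) : ℂ) * f z‖ₑ ^ p ∂(wM m s t)
      = ∫⁻ z, ‖f z‖ₑ ^ p ∂(wM m (s + s' * p) (t + t' * p)) := by
  rw [← lintegral_wM_mul]
  refine lintegral_congr_ae ((ae_wM _ _).mono fun z hz => ?_)
  simp only [enorm_mul, ENNReal.mul_rpow_of_nonneg _ _ hp, enorm_wt_rpow s' t' hp hz]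

/-- Weighted `L²` estimate. -/
lemma exists_lintegral_Iop_le {ν ρ : ℝ} (hν : hN m - 1 < ν) (h1 : 0 < ρ) (h2 : ρ < ν + 2) :
    ∃ C : ℝ≥0∞, C ≠ ⊤ ∧ ∀ f, Measurable f →
      ∫⁻ z, ‖f z‖ₑ ^ (2 : ℝ) ∂(wM m (-ρ) (ν - hN m)) < ⊤ →
      (∀ z ∈ tube (m + 2), Integrable (fun w => f w * lk (ν + 1 + hN m) z w) (wM m 0 (ν - hN m))) ∧
      DifferentiableOn ℂ (Iop m ν (ν + 1 + hN m) f) (tube (m + 2)) ∧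
      ∫⁻ z, ‖(lor (imP z) : ℂ) * Iop m ν (ν + 1 + hN m) f z‖ₑ ^ (2 : ℝ) ∂(wM m (-ρ) (ν - hN m))
        ≤ C * ∫⁻ z, ‖f z‖ₑ ^ (2 : ℝ) ∂(wM m (-ρ) (ν - hN m)) := by
  have hN1 := hN_ge m
  obtain ⟨C, hC, hCφ⟩ := exists_integral_lk_le (m := m) (s := ρ) (t := ν - hN m) (a := ν + 1 + hN m)
    (by linarith) (by linarith) (by linarith) (by linarith) (by linarith) (by linarith)
    (by linarith)
  rw [show 2 * (ν + 1 + hN m) - (ν - hN m) - 4 * hN m = ν - hN m + 1 * 2 by ring] at hCφ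
  refine ⟨C ^ (2 : ℝ), ENNReal.rpow_ne_top_of_nonneg (by norm_num) hC, fun f hf hf2 => ?_⟩
  set φ : (Fin (m + 2) → ℂ) → ℂ := fun w => (wt (-ρ) 0 (imP w) : ℂ) * f w with hφ
  have hφ2 : ∫⁻ w, ‖φ w‖ₑ ^ (2 : ℝ) ∂(wM m ρ (ν - hN m))
      = ∫⁻ z, ‖f z‖ₑ ^ (2 : ℝ) ∂(wM m (-ρ) (ν - hN m)) := by
    rw [hφ, lintegral_wt_mul_rpow _ _ _ _ zero_le_two]
    congr 2 <;> ring
  have hφm : MemLp φ 2 (wM m ρ (ν - hN m)) := by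
    refine ⟨(aesm_wt _ _ _ _).mul hf.aestronglyMeasurable, ?_⟩
    rw [eLpNorm_two, hφ2]
    exact ENNReal.rpow_lt_top_of_nonneg (by norm_num) hf2.ne
  obtain ⟨g, hg, hgφ, hgz⟩ := hCφ φ hφm
  have hgI : ∀ z ∈ tube (m + 2), g z = Iop m ν (ν + 1 + hN m) f z := by
    intro z hz
    rw [hgz z hz, Iop]
    have := integral_wM_mul (m := m) ρ (ν - hN m) (-ρ) 0 fun w => f w * lk (ν + 1 + hN m) z w
    rw [add_neg_cancel, add_zero] at this
    rw [← this]
    simp only [hφ, mul_assoc]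
  refine ⟨fun z hz => ⟨?_, ?_⟩, hg.holo.congr fun z hz => (hgI z hz).symm, ?_⟩
  · refine hf.aestronglyMeasurable.mul ?_
    exact (aesm_conj (aesm_lk_left hz)).congr ((ae_wM _ _).mono fun w hw => lk_conj _ hw hz)
  · have h3 : A2 m ρ (ν - hN m) fun u => lk (ν + 1 + hN m) u z :=
      A2_lk (by linarith) (by linarith) (by linarith) (by linarith) (by linarith) hz
    have h4 := (integrable_mul_conj hφm h3.memLp).hasFiniteIntegral
    rw [hasFiniteIntegral_iff_enorm] at h4 ⊢
    have h5 := lintegral_wM_mul (m := m) ρ (ν - hN m) (-ρ) 0 fun w =>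
      ‖f w * lk (ν + 1 + hN m) z w‖ₑ
    rw [add_neg_cancel, add_zero] at h5
    rw [← h5]
    refine lt_of_le_of_lt (lintegral_mono_ae ((ae_wM _ _).mono fun w hw => le_of_eq ?_)) h4
    have h6 := enorm_wt_rpow (-ρ) 0 zero_le_one (y := imP w) hw
    rw [ENNReal.rpow_one, mul_one, mul_one] at h6
    simp only [hφ, lk_conj _ hw hz]
    rw [mul_assoc, enorm_mul (wt _ _ _ : ℂ), h6]
  · have h3 := lintegral_wt_mul_rpow (m := m) (-ρ) (ν - hN m) 0 1 zero_le_two g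
    simp only [wt_zero, Real.rpow_one, zero_mul, add_zero] at h3
    rw [eLpNorm_two, eLpNorm_two, hφ2] at hgφ
    have h4 := ENNReal.rpow_le_rpow hgφ (zero_le_two (α := ℝ))
    rw [ENNReal.mul_rpow_of_nonneg _ _ zero_le_two, ← ENNReal.rpow_mul, ← ENNReal.rpow_mul,
      inv_mul_cancel₀ (by norm_num : (2 : ℝ) ≠ 0), ENNReal.rpow_one, ENNReal.rpow_one, ← h3] at h4
    refine le_trans (le_of_eq (lintegral_congr_ae ((ae_wM _ _).mono fun z hz => ?_))) h4
    simp only [hgI z hz]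

end top

section lp
variable {m : ℕ}

lemma ofReal_norm_rpow (x : ℂ) {p : ℝ} (hp : 0 ≤ p) : ENNReal.ofReal (‖x‖ ^ p) = ‖x‖ₑ ^ p := by
  rw [← ENNReal.ofReal_rpow_of_nonneg (norm_nonneg _) hp, ofReal_norm]

lemma ofReal_norm_sq (x : ℂ) : ENNReal.ofReal (‖x‖ ^ 2) = ‖x‖ₑ ^ (2 : ℝ) := by
  rw [← ofReal_norm_rpow _ zero_le_two, Real.rpow_two]

lemma wt_mul_wt (s t s' t' : ℝ) {y : Fin (m + 2) → ℝ} (hy : y ∈ cone (m + 2)) :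
    wt s t y * wt s' t' y = wt (s + s') (t + t') y := by
  obtain ⟨h1, h2⟩ := mem_cone_iff.1 hy
  rw [wt, wt, wt, Real.rpow_add h2, Real.rpow_add h1]
  ring

lemma Iop_add {ν a : ℝ} {f g : (Fin (m + 2) → ℂ) → ℂ} {z : Fin (m + 2) → ℂ}
    (hf : Integrable (fun w => f w * lk a z w) (wM m 0 (ν - hN m)))
    (hg : Integrable (fun w => g w * lk a z w) (wM m 0 (ν - hN m))) :
    Iop m ν a (fun w => f w + g w) z = Iop m ν a f z + Iop m ν a g z := by
  simp only [Iop, add_mul]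
  exact integral_add hf hg

/-- `L^p` boundedness of the integral operator, in the range given by the Hardy inequality. -/
theorem exists_lintegral_Iop_rpow_le {ν p : ℝ} (hν : hN m - 1 < ν) (hp : 2 < p)
    (hνp : (hN m - 2) * (p - 2) < ν + 2) :
    ∃ ρ, 0 < ρ ∧ ρ < ν + 2 ∧ ∃ C : ℝ≥0∞, C ≠ ⊤ ∧ ∀ f, Measurable f →
      ∫⁻ z, ‖f z‖ₑ ^ (2 : ℝ) ∂(wM m (-ρ) (ν - hN m)) < ⊤ →
      ∫⁻ z, ‖(lor (imP z) : ℂ) * Iop m ν (ν + 1 + hN m) f z‖ₑ ^ p ∂(wM m 0 (ν - hN m))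
        ≤ C * ∫⁻ z, ‖f z‖ₑ ^ p ∂(wM m 0 (ν - hN m)) := by
  have hN1 := hN_ge m
  have hp2 : 0 < p - 2 := by linarith
  have hp0 : 0 ≤ p := by linarith
  obtain ⟨γ, hγ1, hγ2⟩ : ∃ γ, max (hN m - 2) 0 < γ ∧ γ < min ν ((ν + 2) / (p - 2)) :=
    exists_between (max_lt (lt_min (by linarith) ((lt_div_iff₀ hp2).2 hνp))
      (lt_min (by linarith) (div_pos (by linarith) hp2)))
  obtain ⟨hγN, hγ0⟩ := max_lt_iff.1 hγ1
  obtain ⟨hγν, hγp⟩ := lt_min_iff.1 hγ2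
  have hργ : γ * (p - 2) < ν + 2 := (lt_div_iff₀ hp2).1 hγp
  set a := ν + 1 + hN m with ha
  obtain ⟨J, hJ0, hJ⟩ := exists_enorm_Iop_le hν hγN hγν
  obtain ⟨C₂, hC₂, hL2⟩ := exists_lintegral_Iop_le hν (mul_pos hγ0 hp2) hργ
  set ρ := γ * (p - 2) with hρ
  set c : ℝ := (2 * (J.toReal + 1))⁻¹ with hc
  have hJr : 0 ≤ J.toReal := ENNReal.toReal_nonneg
  have hc0 : 0 < c := by positivity
  have hcJ : ENNReal.ofReal c * J ≤ ENNReal.ofReal 2⁻¹ := by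
    rw [← ENNReal.ofReal_toReal hJ0, ← ENNReal.ofReal_mul hc0.le]
    refine ENNReal.ofReal_le_ofReal ?_
    rw [hc, inv_mul_le_iff₀ (by positivity)]
    linarith
  set σ := wM m (-γ * p) (ν - hN m) with hσ
  have hσp : ∀ f : (Fin (m + 2) → ℂ) → ℂ, ∫⁻ z, ‖(wt γ 0 (imP z) : ℂ) * f z‖ₑ ^ p ∂σ
      = ∫⁻ z, ‖f z‖ₑ ^ p ∂(wM m 0 (ν - hN m)) := fun f => by
    rw [hσ, lintegral_wt_mul_rpow _ _ _ _ hp0]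
    congr 2 <;> ring
  have hσ2 : ∀ f : (Fin (m + 2) → ℂ) → ℂ, ∫⁻ z, ‖(wt γ 0 (imP z) : ℂ) * f z‖ₑ ^ (2 : ℝ) ∂σ
      = ∫⁻ z, ‖f z‖ₑ ^ (2 : ℝ) ∂(wM m (-ρ) (ν - hN m)) := fun f => by
    rw [hσ, lintegral_wt_mul_rpow _ _ _ _ zero_le_two]
    congr 2 <;> ring
  refine ⟨ρ, mul_pos hγ0 hp2, hργ, ENNReal.ofReal p * (4 * C₂ * ((ENNReal.ofReal (p - 2))⁻¹ *
    ENNReal.ofReal ((c⁻¹) ^ (p - 2)))), ?_, fun f hf hf2 => ?_⟩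
  · refine ENNReal.mul_ne_top ENNReal.ofReal_ne_top (ENNReal.mul_ne_top
      (ENNReal.mul_ne_top (by norm_num) hC₂) (ENNReal.mul_ne_top (ENNReal.inv_ne_top.2 ?_)
      ENNReal.ofReal_ne_top))
    rw [Ne, ENNReal.ofReal_eq_zero]; linarith
  set h : (Fin (m + 2) → ℂ) → ℝ := fun z => ‖(wt γ 0 (imP z) : ℂ) * f z‖ with hh
  set g : (Fin (m + 2) → ℂ) → ℝ := fun z =>
    ‖(wt γ 0 (imP z) : ℂ) * ((lor (imP z) : ℂ) * Iop m ν a f z)‖ with hg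
  have hwtm : Measurable fun z : Fin (m + 2) → ℂ => (wt γ 0 (imP z) : ℂ) :=
    measurable_ofReal.comp ((measurable_wt γ 0).comp imP_continuous.measurable)
  have hlorm : Measurable fun z : Fin (m + 2) → ℂ => (lor (imP z) : ℂ) :=
    measurable_ofReal.comp ((lor_continuous.comp imP_continuous).measurable)
  have hhm : Measurable h := (hwtm.mul hf).norm
  have hTm : ∀ f, Measurable f → ∫⁻ z, ‖f z‖ₑ ^ (2 : ℝ) ∂(wM m (-ρ) (ν - hN m)) < ⊤ →
      AEStronglyMeasurable (fun z => (wt γ 0 (imP z) : ℂ) * ((lor (imP z) : ℂ) * Iop m ν a f z)) σ :=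
    fun f hf hf2 => hwtm.aestronglyMeasurable.mul (hlorm.aestronglyMeasurable.mul
      (A2.aesm (hL2 f hf hf2).2.1))
  have key := lintegral_rpow_le_of_meas_lt (μ := σ) (g := g) (h := h) (p := p) (c := c)
    (C := 4 * C₂) (Filter.Eventually.of_forall fun z => norm_nonneg _) (hTm f hf hf2).norm.aemeasurable
    (Filter.Eventually.of_forall fun z => norm_nonneg _) hhm hp hc0
    (ENNReal.mul_ne_top (by norm_num) hC₂) ?_
  · simp only [hg, hh, ofReal_norm_rpow _ hp0] at key
    rw [hσp, hσp] at key
    refine key.trans (le_of_eq ?_)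
    ring
  intro t ht
  set S : Set (Fin (m + 2) → ℂ) := {z | c * t < h z} with hS
  have hSm : MeasurableSet S := measurableSet_lt measurable_const hhm
  have hind : ∀ (S : Set (Fin (m + 2) → ℂ)), ∫⁻ z, ‖S.indicator f z‖ₑ ^ (2 : ℝ)
      ∂(wM m (-ρ) (ν - hN m)) < ⊤ := fun S => by
    refine lt_of_le_of_lt (lintegral_mono fun z => ?_) hf2
    exact ENNReal.rpow_le_rpow (enorm_indicator_le_enorm_self _ _) zero_le_two
  set f₁ := S.indicator f with hf₁
  set f₂ := Sᶜ.indicator f with hf₂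
  have hf₁m : Measurable f₁ := hf.indicator hSm
  have hf₂m : Measurable f₂ := hf.indicator hSm.compl
  have hff : f = fun z => f₁ z + f₂ z := by
    ext z
    exact (congrFun (indicator_self_add_compl S f) z).symm
  have hb2 : ∀ w ∈ tube (m + 2), ‖f₂ w‖ₑ ≤ ENNReal.ofReal (c * t) *
      ENNReal.ofReal (wt (-γ) 0 (imP w)) := by
    intro w hw
    by_cases hwS : w ∈ S
    · simp [hf₂, hwS]
    · rw [hf₂, indicator_of_mem (by exact hwS), ← ENNReal.ofReal_mul (by positivity), ← ofReal_norm]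
      refine ENNReal.ofReal_le_ofReal ?_
      have h1 : h w ≤ c * t := not_lt.1 hwS
      have h2 := wt_pos γ 0 (show imP w ∈ cone (m + 2) from hw)
      have h3 := wt_pos (-γ) 0 (show imP w ∈ cone (m + 2) from hw)
      have h4 := wt_mul_wt γ 0 (-γ) 0 (show imP w ∈ cone (m + 2) from hw)
      rw [add_neg_cancel, add_zero, wt_zero, Real.rpow_zero] at h4
      simp only [hh, norm_mul, norm_real, Real.norm_of_nonneg h2.le] at h1
      calc ‖f w‖ = wt γ 0 (imP w) * ‖f w‖ * wt (-γ) 0 (imP w) := by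
            rw [mul_right_comm, h4, one_mul]
        _ ≤ _ := by gcongr
  have hT2 : ∀ z ∈ tube (m + 2),
      ‖(wt γ 0 (imP z) : ℂ) * ((lor (imP z) : ℂ) * Iop m ν a f₂ z)‖ ≤ t / 2 := by
    intro z hz
    have h1 := hJ f₂ _ ENNReal.ofReal_ne_top hb2 z hz
    have h2 := (enorm_integral_le_lintegral_enorm _).trans h1
    change ‖Iop m ν a f₂ z‖ₑ ≤ _ at h2
    have h3 := enorm_wt_rpow γ 1 zero_le_one (show imP z ∈ cone (m + 2) from hz)
    rw [ENNReal.rpow_one, mul_one, mul_one] at h3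
    have h4 : (wt γ 0 (imP z) : ℂ) * ((lor (imP z) : ℂ) * Iop m ν a f₂ z)
        = (wt γ 1 (imP z) : ℂ) * Iop m ν a f₂ z := by
      have := wt_mul_rpow γ 0 1 (show imP z ∈ cone (m + 2) from hz)
      rw [zero_add, Real.rpow_one] at this
      rw [← this]; push_cast; ring
    have h5 := wt_mul_wt γ 1 (-γ) (-1) (show imP z ∈ cone (m + 2) from hz)
    rw [add_neg_cancel, add_neg_cancel, wt_zero, Real.rpow_zero] at h5
    have h6 : ‖(wt γ 1 (imP z) : ℂ) * Iop m ν a f₂ z‖ₑ ≤ ENNReal.ofReal (t / 2) := by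
      rw [enorm_mul, h3]
      calc _ ≤ ENNReal.ofReal (wt γ 1 (imP z)) * (ENNReal.ofReal (c * t) *
            (J * ENNReal.ofReal (wt (-γ) (-1) (imP z)))) := mul_le_mul_right h2 _
        _ = ENNReal.ofReal (wt γ 1 (imP z)) * ENNReal.ofReal (wt (-γ) (-1) (imP z)) *
            (ENNReal.ofReal t * (ENNReal.ofReal c * J)) := by
              rw [ENNReal.ofReal_mul hc0.le]; ring
        _ ≤ 1 * (ENNReal.ofReal t * ENNReal.ofReal 2⁻¹) := by
              rw [← ENNReal.ofReal_mul (wt_pos _ _ (show imP z ∈ cone (m + 2) from hz)).le, h5,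
                ENNReal.ofReal_one]
              exact mul_le_mul_right (mul_le_mul_right hcJ _) _
        _ = ENNReal.ofReal (t / 2) := by rw [one_mul, ← ENNReal.ofReal_mul ht.le]; rfl
    rw [h4, ← ENNReal.ofReal_le_ofReal_iff (by positivity), ofReal_norm]
    exact h6
  have hsub : σ {z | t < g z} ≤ σ {z | ENNReal.ofReal ((t / 2) ^ 2) ≤
      ‖(wt γ 0 (imP z) : ℂ) * ((lor (imP z) : ℂ) * Iop m ν a f₁ z)‖ₑ ^ (2 : ℝ)} := by
    refine measure_mono_ae ((ae_wM _ _).mono fun z hz (h1 : t < g z) => ?_)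
    change _ ≤ _
    rw [← ofReal_norm_sq]
    refine ENNReal.ofReal_le_ofReal (pow_le_pow_left₀ (by positivity) ?_ 2)
    have h2 : (wt γ 0 (imP z) : ℂ) * ((lor (imP z) : ℂ) * Iop m ν a f z)
        = (wt γ 0 (imP z) : ℂ) * ((lor (imP z) : ℂ) * Iop m ν a f₁ z)
          + (wt γ 0 (imP z) : ℂ) * ((lor (imP z) : ℂ) * Iop m ν a f₂ z) := by
      conv_lhs => rw [hff]
      rw [Iop_add ((hL2 f₁ hf₁m (hind _)).1 z hz) ((hL2 f₂ hf₂m (hind _)).1 z hz)]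
      ring
    simp only [hg, h2] at h1
    have h3 := h1.trans_le (norm_add_le _ _)
    linarith [hT2 z hz]
  have h1 := mul_meas_ge_le_lintegral₀ (μ := σ) ((hTm f₁ hf₁m (hind _)).enorm.pow_const (2 : ℝ))
    (ENNReal.ofReal ((t / 2) ^ 2))
  have h2 : ENNReal.ofReal (t ^ 2) = 4 * ENNReal.ofReal ((t / 2) ^ 2) := by
    rw [show (4 : ℝ≥0∞) = ENNReal.ofReal 4 by norm_num, ← ENNReal.ofReal_mul (by norm_num)]
    congr 1; ring
  rw [h2]
  have h3 : ∫⁻ z, ‖f₁ z‖ₑ ^ (2 : ℝ) ∂(wM m (-ρ) (ν - hN m))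
      = ∫⁻ z in S, ENNReal.ofReal (h z ^ 2) ∂σ := by
    rw [← hσ2, ← lintegral_indicator hSm]
    refine lintegral_congr fun z => ?_
    by_cases hz : z ∈ S
    · rw [hf₁, indicator_of_mem hz, indicator_of_mem hz, hh, ofReal_norm_sq]
    · rw [hf₁, indicator_of_notMem hz, indicator_of_notMem hz]
      simp
  calc _ ≤ 4 * (ENNReal.ofReal ((t / 2) ^ 2) * σ {z | ENNReal.ofReal ((t / 2) ^ 2) ≤
      ‖(wt γ 0 (imP z) : ℂ) * ((lor (imP z) : ℂ) * Iop m ν a f₁ z)‖ₑ ^ (2 : ℝ)}) := by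
        rw [mul_comm, mul_assoc]
        gcongr
    _ ≤ 4 * (C₂ * ∫⁻ z in S, ENNReal.ofReal (h z ^ 2) ∂σ) := by
        rw [← h3]
        refine mul_le_mul_right (h1.trans ?_) _
        rw [hσ2]
        exact (hL2 f₁ hf₁m (hind _)).2.2
    _ = _ := by ring

end lp

section
variable {m : ℕ}

/-- A power of the kernel annihilated by the Box operator limits the exponents for which the
Hardy inequality can hold. -/
theorem lt_of_hardy {ν p : ℝ} (hp : 2 < p) (hν : hN m - 1 < ν) (hH : hardy (m + 2) p ν) :
    (hN m - 2) * (p - 2) < ν + 2 := by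
  by_contra! h
  have hN1 := hN_ge m
  have hw := ie_mem (m := m)
  obtain ⟨J, hJt, hJ⟩ := exists_lintegral_lk_eq (m := m) (s := 0) (t := ν - hN m)
    (a := (hN m - 1) * p) (by nlinarith) (by nlinarith) (by nlinarith) (by linarith) (by linarith)
  obtain ⟨C, -, hC⟩ := hH
  have hp0 : 0 < p := by linarith
  have hF := differentiableOn_lk (n := m + 2) (hN m - 1) hw
  have hlt : lpInt (m + 2) p ν (fun z => lk (hN m - 1) z (ie m)) < ⊤ := by
    rw [lpInt_eq ν hp0.le, lintegral_lk_rpow 0 (ν - hN m) _ p hw, hJ _ hw]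
    exact ENNReal.mul_lt_top hJt.lt_top ENNReal.ofReal_lt_top
  have h0 := hC _ ⟨hF, hlt⟩
  have hbox : ∀ z ∈ tube (m + 2), BoxOp (fun z => lk (hN m - 1) z (ie m)) z = 0 := by
    intro z hz
    rw [BoxOp_lk _ hz hw, hN]
    push_cast
    ring
  rw [lpInt_eq ν hp0.le, lpInt_eq ν hp0.le] at h0
  have h1 : ∫⁻ z, ‖(lor (imP z) : ℂ) * BoxOp (fun z => lk (hN m - 1) z (ie m)) z‖ₑ ^ p
      ∂(wM m 0 (ν - hN m)) = 0 := by
    rw [lintegral_eq_zero_of_ae_eq_zero]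
    filter_upwards [ae_wM (m := m) 0 (ν - hN m)] with z hz
    simp [hbox z hz, hp0]
  rw [h1, mul_zero, nonpos_iff_eq_zero, lintegral_eq_zero_iff' ((A2.aesm hF).enorm.pow_const p)]
    at h0
  have h2 : ∀ᵐ z ∂(volume.restrict (tube (m + 2))), False := by
    rw [← ae_wM_iff 0 (ν - hN m)]
    filter_upwards [h0, ae_wM (m := m) 0 (ν - hN m)] with z hz hzt
    have h3 := lk_ne (hN m - 1) hzt hw
    simp only [Pi.zero_apply, ENNReal.rpow_eq_zero_iff] at hz
    simp [h3, hp0] at hz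
  have h4 : (volume : Measure (Fin (m + 2) → ℂ)) (tube (m + 2)) = 0 := by
    simpa [ae_iff] using h2
  exact (tube_isOpen.measure_pos volume ⟨ie m, hw⟩).ne' h4

end

section
variable {m : ℕ}

lemma wM_lt_top_of_isCompact (s t : ℝ) {K : Set (Fin (m + 2) → ℂ)} (hK : IsCompact K)
    (hKt : K ⊆ tube (m + 2)) : wM m s t K < ⊤ := by
  obtain ⟨M, hM⟩ := hK.exists_bound_of_continuousOn
    ((continuousOn_wt s t).comp imP_continuous.continuousOn fun z hz => hKt hz)
  have h : wM m s t K = ∫⁻ z in K, ENNReal.ofReal (wt s t (imP z)) := by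
    rw [← setLIntegral_one, ← lintegral_indicator hK.measurableSet, lintegral_wM,
      ← lintegral_indicator measurable_tube, ← lintegral_indicator hK.measurableSet]
    refine lintegral_congr fun z => ?_
    by_cases hz : z ∈ K
    · rw [indicator_of_mem (hKt hz), indicator_of_mem hz, indicator_of_mem hz, mul_one]
    · simp [indicator_of_notMem hz]
  rw [h]
  calc _ ≤ ∫⁻ z in K, ENNReal.ofReal M := by
        refine setLIntegral_mono' hK.measurableSet fun z hz => ?_
        exact ENNReal.ofReal_le_ofReal ((le_abs_self _).trans (hM z hz))
    _ < ⊤ := by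
        rw [setLIntegral_const]
        exact ENNReal.mul_lt_top ENNReal.ofReal_lt_top hK.measure_lt_top

lemma lintegral_rpow_lt_top_of_isCompact (s t : ℝ) {q : ℝ} (hq : 0 < q)
    {K : Set (Fin (m + 2) → ℂ)} (hK : IsCompact K) (hKt : K ⊆ tube (m + 2))
    {f : (Fin (m + 2) → ℂ) → ℂ} {M : ℝ} (hM : ∀ z, ‖f z‖ ≤ M) (hf : ∀ z ∉ K, f z = 0) :
    ∫⁻ z, ‖f z‖ₑ ^ q ∂(wM m s t) < ⊤ := by
  calc ∫⁻ z, ‖f z‖ₑ ^ q ∂(wM m s t)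
      ≤ ∫⁻ z, K.indicator (fun _ => ENNReal.ofReal M ^ q) z ∂(wM m s t) := by
        refine lintegral_mono fun z => ?_
        by_cases hz : z ∈ K
        · rw [indicator_of_mem hz, ← ofReal_norm]
          exact ENNReal.rpow_le_rpow (ENNReal.ofReal_le_ofReal (hM z)) hq.le
        · simp [hf z hz, hq]
    _ < ⊤ := by
        rw [lintegral_indicator hK.measurableSet, setLIntegral_const]
        exact ENNReal.mul_lt_top (ENNReal.rpow_lt_top_of_nonneg hq.le ENNReal.ofReal_ne_top)
          (wM_lt_top_of_isCompact s t hK hKt)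

/-- Projections of bounded functions with compact support in the tube are in `L^p`. -/
lemma lintegral_bergman_lt_top {ν p : ℝ} (hν : hN m - 1 < ν) (hp : 2 ≤ p)
    {K : Set (Fin (m + 2) → ℂ)} (hK : IsCompact K) (hKt : K ⊆ tube (m + 2))
    {f : (Fin (m + 2) → ℂ) → ℂ} (hfm : Measurable f) {M : ℝ} (hM : ∀ z, ‖f z‖ ≤ M)
    (hf : ∀ z ∉ K, f z = 0) :
    ∫⁻ z, ‖∫ w, f w * (starRingEnd ℂ) (bk m 0 (ν - hN m) z w) ∂(wM m 0 (ν - hN m))‖ₑ ^ p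
      ∂(wM m 0 (ν - hN m)) < ⊤ := by
  have hN1 := hN_ge m
  have hp0 : 0 < p := by linarith
  set μ := wM m 0 (ν - hN m) with hμ
  obtain ⟨c, -, hc⟩ := exists_bk_eq_lk hν
  obtain ⟨J, hJ, hJK⟩ := exists_lintegral_lintegral_lk (m := m) (s := 0) (t := ν - hN m)
    (a := (ν + hN m) * p) (by nlinarith) (by nlinarith) (by nlinarith) (by linarith) (by linarith)
  set q := p.conjExponent with hq
  have hpq : p.HolderConjugate q := Real.HolderConjugate.conjExponent (by linarith)
  set I := (∫⁻ w, ‖f w‖ₑ ^ q ∂μ) ^ (p / q) with hI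
  have hIt : I ≠ ⊤ := ENNReal.rpow_ne_top_of_nonneg (div_nonneg hp0.le hpq.symm.nonneg)
    (lintegral_rpow_lt_top_of_isCompact _ _ hpq.symm.pos hK hKt hM hf).ne
  have key : ∀ z ∈ tube (m + 2),
      ‖∫ w, f w * (starRingEnd ℂ) (bk m 0 (ν - hN m) z w) ∂μ‖ₑ ^ p
        ≤ ‖(c : ℂ)‖ₑ ^ p * I * ∫⁻ w, K.indicator 1 w * ‖lk ((ν + hN m) * p) z w‖ₑ ∂μ := by
    intro z hz
    have h1 : ‖∫ w, f w * (starRingEnd ℂ) (bk m 0 (ν - hN m) z w) ∂μ‖ₑ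
        ≤ ‖(c : ℂ)‖ₑ * ∫⁻ w, (K.indicator 1 w * ‖lk (ν + hN m) z w‖ₑ) * ‖f w‖ₑ ∂μ := by
      rw [← lintegral_const_mul' _ _ enorm_ne_top]
      refine (enorm_integral_le_lintegral_enorm _).trans (lintegral_mono_ae ?_)
      filter_upwards [ae_wM (m := m) 0 (ν - hN m)] with w hw
      rw [enorm_mul, RCLike.enorm_conj, hc w hw z hz, enorm_mul, enorm_lk_comm _ hw hz]
      by_cases hwK : w ∈ K
      · rw [indicator_of_mem hwK, Pi.one_apply, one_mul]
        exact le_of_eq (by ring)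
      · simp [hf w hwK]
    have hlm : AEMeasurable (fun w => K.indicator 1 w * ‖lk (ν + hN m) z w‖ₑ) μ := by
      refine AEMeasurable.mul (measurable_one.indicator hK.measurableSet).aemeasurable ?_
      refine AEMeasurable.congr (aesm_lk_left (a := ν + hN m) (s := 0) (t := ν - hN m) hz).enorm ?_
      filter_upwards [ae_wM (m := m) 0 (ν - hN m)] with w hw using enorm_lk_comm _ hw hz
    have h2 := ENNReal.lintegral_mul_le_Lp_mul_Lq μ hpq hlm hfm.enorm.aemeasurable
    have h3 := ENNReal.rpow_le_rpow (h1.trans (mul_le_mul_right h2 _)) hp0.le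
    refine h3.trans (le_of_eq ?_)
    rw [ENNReal.mul_rpow_of_nonneg _ _ hp0.le, ENNReal.mul_rpow_of_nonneg _ _ hp0.le,
      ← ENNReal.rpow_mul, ← ENNReal.rpow_mul, one_div_mul_cancel hp0.ne', ENNReal.rpow_one,
      one_div_mul_eq_div, ← hI, mul_assoc, mul_comm I]
    congr 2
    refine lintegral_congr_ae ?_
    filter_upwards [ae_wM (m := m) 0 (ν - hN m)] with w hw
    rw [ENNReal.mul_rpow_of_nonneg _ _ hp0.le, enorm_lk_rpow _ _ hz hw]
    by_cases hwK : w ∈ K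
    · simp [indicator_of_mem hwK]
    · simp [indicator_of_notMem hwK, hp0]
  calc _ ≤ ∫⁻ z, ‖(c : ℂ)‖ₑ ^ p * I *
        ∫⁻ w, K.indicator 1 w * ‖lk ((ν + hN m) * p) z w‖ₑ ∂μ ∂μ :=
        lintegral_mono_ae ((ae_wM _ _).mono key)
    _ < ⊤ := by
        have hct : ‖(c : ℂ)‖ₑ ^ p * I ≠ ⊤ :=
          ENNReal.mul_ne_top (ENNReal.rpow_ne_top_of_nonneg hp0.le enorm_ne_top) hIt
        rw [lintegral_const_mul' _ _ hct, hJK 0 (ν - hN m) _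
          (measurable_one.indicator hK.measurableSet).aemeasurable,
          lintegral_indicator_one hK.measurableSet]
        exact ENNReal.mul_lt_top hct.lt_top (ENNReal.mul_lt_top hJ.lt_top
          (wM_lt_top_of_isCompact _ _ hK hKt))

/-- The projection bound on bounded functions with compact support in the tube. -/
theorem exists_lintegral_bergman_le {ν p : ℝ} (hν : hN m - 1 < ν) (hp : 2 < p)
    (hH : hardy (m + 2) p ν) :
    ∃ C : ℝ≥0∞, C ≠ ⊤ ∧ ∀ (K : Set (Fin (m + 2) → ℂ)) (f : (Fin (m + 2) → ℂ) → ℂ) (M : ℝ),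
      IsCompact K → K ⊆ tube (m + 2) → Measurable f → (∀ z, ‖f z‖ ≤ M) → (∀ z ∉ K, f z = 0) →
      ∃ g, A2 m 0 (ν - hN m) g ∧ (∀ z ∈ tube (m + 2), g z =
        ∫ w, f w * (starRingEnd ℂ) (bk m 0 (ν - hN m) z w) ∂(wM m 0 (ν - hN m))) ∧
        ∫⁻ z, ‖g z‖ₑ ^ p ∂(wM m 0 (ν - hN m)) ≤ C * ∫⁻ z, ‖f z‖ₑ ^ p ∂(wM m 0 (ν - hN m)) := by
  have hp0 : 0 < p := by linarith
  obtain ⟨ρ, -, -, C₁, hC₁, hI⟩ := exists_lintegral_Iop_rpow_le hν hp (lt_of_hardy hp hν hH)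
  obtain ⟨C, -, hC⟩ := hH
  obtain ⟨d, -, hd⟩ := exists_BoxOp_bk hν
  obtain ⟨c, -, hc⟩ := exists_bk_eq_lk (m := m) (ν := ν + 1) (by linarith)
  set μ := wM m 0 (ν - hN m) with hμ
  have hdc : ‖((d * c : ℝ) : ℂ)‖ₑ ^ p ≠ ⊤ := ENNReal.rpow_ne_top_of_nonneg hp0.le enorm_ne_top
  refine ⟨ENNReal.ofReal C * (‖((d * c : ℝ) : ℂ)‖ₑ ^ p * C₁), ENNReal.mul_ne_top
    ENNReal.ofReal_ne_top (ENNReal.mul_ne_top hdc hC₁),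
    fun K f M hK hKt hfm hM hf => ?_⟩
  have hf2 : MemLp f 2 μ := by
    refine ⟨hfm.aestronglyMeasurable, ?_⟩
    rw [eLpNorm_two]
    exact ENNReal.rpow_lt_top_of_nonneg (by norm_num)
      (lintegral_rpow_lt_top_of_isCompact _ _ two_pos hK hKt hM hf).ne
  obtain ⟨g, hg, hgu, hgL⟩ := (BF_inner hf2).repr
  have hg' : ∀ z ∈ tube (m + 2), g z =
      ∫ w, f w * (starRingEnd ℂ) (bk m 0 (ν - hN m) z w) ∂μ := by
    intro z hz
    rw [hgu z hz, ← integral_mul_conj_symm]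
  refine ⟨g, hg, hg', ?_⟩
  have hbox : ∀ z ∈ tube (m + 2), BoxOp g z = ((d * c : ℝ) : ℂ) * Iop m ν (ν + 1 + hN m) f z := by
    intro z hz
    obtain ⟨h, hh, hhu, hhL⟩ := (BF_BoxOp 0 (ν - hN m) hz).repr
    rw [hhL g hg, integral_mul_conj_symm, ← hgL h hh, ← integral_mul_conj_symm, Iop,
      ← integral_const_mul]
    refine integral_congr_ae ?_
    filter_upwards [ae_wM (m := m) 0 (ν - hN m)] with w hw
    rw [hhu w hw, Complex.conj_conj, hd z hz w hw, hc z hz w hw]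
    push_cast
    ring
  have hgp : lpInt (m + 2) p ν g < ⊤ := by
    rw [lpInt_eq ν hp0.le]
    refine lt_of_eq_of_lt (lintegral_congr_ae ?_)
      (lintegral_bergman_lt_top hν hp.le hK hKt hfm hM hf)
    filter_upwards [ae_wM (m := m) 0 (ν - hN m)] with z hz
    rw [hg' z hz]
  have h1 := hC g ⟨hg.holo, hgp⟩
  rw [lpInt_eq ν hp0.le, lpInt_eq ν hp0.le] at h1
  refine h1.trans ?_
  rw [mul_assoc, mul_assoc]
  refine mul_le_mul_right ?_ _
  have h2 : ∫⁻ z, ‖(lor (imP z) : ℂ) * BoxOp g z‖ₑ ^ p ∂μ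
      = ‖((d * c : ℝ) : ℂ)‖ₑ ^ p *
        ∫⁻ z, ‖(lor (imP z) : ℂ) * Iop m ν (ν + 1 + hN m) f z‖ₑ ^ p ∂μ := by
    rw [← lintegral_const_mul' _ _ hdc]
    refine lintegral_congr_ae ?_
    filter_upwards [ae_wM (m := m) 0 (ν - hN m)] with z hz
    rw [hbox z hz, ← ENNReal.mul_rpow_of_nonneg _ _ hp0.le, ← enorm_mul]
    congr 2
    ring
  rw [h2]
  exact mul_le_mul_right (hI f hfm
    (lintegral_rpow_lt_top_of_isCompact _ _ two_pos hK hKt hM hf)) _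

end

section
variable {m : ℕ}

/-- A compact exhaustion of the tube. -/
def exh (m : ℕ) (k : ℕ) : Set (Fin (m + 2) → ℂ) :=
  Metric.closedBall 0 k ∩ {z | (1 : ℝ) / (k + 1) ≤ lor (imP z) ∧ 0 ≤ imP z 0}

lemma exh_subset (k : ℕ) : exh m k ⊆ tube (m + 2) := by
  rintro z ⟨-, h1, h2⟩
  have h3 : (0 : ℝ) < lor (imP z) := lt_of_lt_of_le (by positivity) h1
  refine ⟨h3, h2.lt_of_ne fun h0 => ?_⟩
  rw [lor, ← h0] at h3
  have h4 : 0 ≤ ∑ i, imP z i ^ 2 := Finset.sum_nonneg fun _ _ => sq_nonneg _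
  linarith

lemma isCompact_exh (k : ℕ) : IsCompact (exh m k) := by
  refine (isCompact_closedBall _ _).inter_right ?_
  exact (isClosed_le continuous_const (lor_continuous.comp imP_continuous)).inter
    (isClosed_le continuous_const ((continuous_apply 0).comp imP_continuous))

lemma eventually_mem_exh {z : Fin (m + 2) → ℂ} (hz : z ∈ tube (m + 2)) :
    ∀ᶠ k in Filter.atTop, z ∈ exh m k := by
  have h1 : ∀ᶠ k : ℕ in Filter.atTop, ‖z‖ ≤ k :=
    tendsto_natCast_atTop_atTop.eventually_ge_atTop _
  have h2 : ∀ᶠ k : ℕ in Filter.atTop, (1 : ℝ) / (k + 1) < lor (imP z) :=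
    tendsto_one_div_add_atTop_nhds_zero_nat.eventually_lt_const hz.1
  filter_upwards [h1, h2] with k hk1 hk2
  exact ⟨by simpa using hk1, hk2.le, hz.2.le⟩

/-- Bounded functions with compact support in the tube suffice. -/
lemma lintegral_bergman_le_of_forall {ν p : ℝ} (hp0 : 0 < p) {C : ℝ≥0∞}
    (hC : ∀ (K : Set (Fin (m + 2) → ℂ)) (f : (Fin (m + 2) → ℂ) → ℂ) (M : ℝ),
      IsCompact K → K ⊆ tube (m + 2) → Measurable f → (∀ z, ‖f z‖ ≤ M) → (∀ z ∉ K, f z = 0) →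
      ∃ g, A2 m 0 (ν - hN m) g ∧ (∀ z ∈ tube (m + 2), g z =
        ∫ w, f w * (starRingEnd ℂ) (bk m 0 (ν - hN m) z w) ∂(wM m 0 (ν - hN m))) ∧
        ∫⁻ z, ‖g z‖ₑ ^ p ∂(wM m 0 (ν - hN m)) ≤ C * ∫⁻ z, ‖f z‖ₑ ^ p ∂(wM m 0 (ν - hN m)))
    {f g : (Fin (m + 2) → ℂ) → ℂ} (hfm : Measurable f) (hf : MemLp f 2 (wM m 0 (ν - hN m)))
    (hg : ∀ z ∈ tube (m + 2), g z =
        ∫ w, f w * (starRingEnd ℂ) (bk m 0 (ν - hN m) z w) ∂(wM m 0 (ν - hN m))) :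
    ∫⁻ z, ‖g z‖ₑ ^ p ∂(wM m 0 (ν - hN m)) ≤ C * ∫⁻ z, ‖f z‖ₑ ^ p ∂(wM m 0 (ν - hN m)) := by
  set μ := wM m 0 (ν - hN m) with hμ
  set S : ℕ → Set (Fin (m + 2) → ℂ) := fun k => exh m k ∩ {z | ‖f z‖ ≤ k} with hS
  have hSm : ∀ k, MeasurableSet (S k) := fun k =>
    (isCompact_exh k).measurableSet.inter (measurableSet_le hfm.norm measurable_const)
  have hSev : ∀ z ∈ tube (m + 2), ∀ᶠ k in Filter.atTop, z ∈ S k := fun z hz =>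
    (eventually_mem_exh hz).and
      ((tendsto_natCast_atTop_atTop (R := ℝ)).eventually_ge_atTop ‖f z‖)
  have hle : ∀ k z, ‖(S k).indicator f z‖ ≤ ‖f z‖ := fun k z => norm_indicator_le_norm_self _ _
  have hex := fun k => hC (exh m k) ((S k).indicator f) k (isCompact_exh k) (exh_subset k)
    (hfm.indicator (hSm k))
    (fun z => by
      by_cases hz : z ∈ S k
      · rw [indicator_of_mem hz]; exact hz.2
      · rw [indicator_of_notMem hz]; simp)
    (fun z hz => indicator_of_notMem (fun h => hz h.1) _)
  choose G hGA hGz hGp using hex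
  have hlim : ∀ z ∈ tube (m + 2), Filter.Tendsto (fun k => G k z) Filter.atTop (nhds (g z)) := by
    intro z hz
    rw [hg z hz]
    simp only [hGz _ z hz]
    refine tendsto_integral_of_dominated_convergence
      (fun w => ‖f w * (starRingEnd ℂ) (bk m 0 (ν - hN m) z w)‖) (fun k => ?_)
      (integrable_mul_conj hf (A2_bk z).memLp).norm (fun k => ?_) ?_
    · exact (hfm.indicator (hSm k)).aestronglyMeasurable.mul (aesm_conj (A2_bk z).memLp.1)
    · refine Filter.Eventually.of_forall fun w => ?_
      rw [norm_mul, norm_mul]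
      exact mul_le_mul_of_nonneg_right (hle k w) (norm_nonneg _)
    · filter_upwards [ae_wM (m := m) 0 (ν - hN m)] with w hw
      refine tendsto_const_nhds.congr' ?_
      filter_upwards [hSev w hw] with k hk
      rw [indicator_of_mem hk]
  calc ∫⁻ z, ‖g z‖ₑ ^ p ∂μ
      = ∫⁻ z, Filter.liminf (fun k => ‖G k z‖ₑ ^ p) Filter.atTop ∂μ := by
        refine lintegral_congr_ae ?_
        filter_upwards [ae_wM (m := m) 0 (ν - hN m)] with z hz
        exact (((ENNReal.continuous_rpow_const.tendsto _).comp (hlim z hz).enorm).liminf_eq).symm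
    _ ≤ Filter.liminf (fun k => ∫⁻ z, ‖G k z‖ₑ ^ p ∂μ) Filter.atTop :=
        lintegral_liminf_le' fun k => (hGA k).memLp.1.enorm.pow_const p
    _ ≤ Filter.liminf (fun _ : ℕ => C * ∫⁻ z, ‖f z‖ₑ ^ p ∂μ) Filter.atTop := by
        refine Filter.liminf_le_liminf (Filter.Eventually.of_forall fun k => (hGp k).trans ?_)
        refine mul_le_mul_right (lintegral_mono fun z => ENNReal.rpow_le_rpow ?_ hp0.le) _
        rw [← ofReal_norm, ← ofReal_norm]
        exact ENNReal.ofReal_le_ofReal (hle k z)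
    _ = _ := Filter.liminf_const _

lemma lpNorm_le_of_lintegral_le {ν p : ℝ} (hp0 : 0 < p) {C : ℝ≥0∞}
    {f g : (Fin (m + 2) → ℂ) → ℂ}
    (h : ∫⁻ z, ‖g z‖ₑ ^ p ∂(wM m 0 (ν - hN m)) ≤ C * ∫⁻ z, ‖f z‖ₑ ^ p ∂(wM m 0 (ν - hN m))) :
    _root_.lpNorm (m + 2) p ν g ≤ C ^ (1 / p) * _root_.lpNorm (m + 2) p ν f := by
  rw [_root_.lpNorm, _root_.lpNorm, lpInt_eq ν hp0.le, lpInt_eq ν hp0.le,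
    ← ENNReal.mul_rpow_of_nonneg _ _ (by positivity)]
  exact ENNReal.rpow_le_rpow h (by positivity)

lemma memLp_of_lpInt_lt_top {ν : ℝ} {f : (Fin (m + 2) → ℂ) → ℂ}
    (hf : AEStronglyMeasurable f (dV (m + 2) ν)) (h : lpInt (m + 2) 2 ν f < ⊤) :
    MemLp f 2 (wM m 0 (ν - hN m)) := by
  rw [dV_eq] at hf
  rw [lpInt_eq ν zero_le_two] at h
  refine ⟨hf, ?_⟩
  rw [eLpNorm_two]
  exact ENNReal.rpow_lt_top_of_nonneg (by norm_num) h.ne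

lemma projBounded_two (ν : ℝ) : projBounded (m + 2) 2 ν := by
  refine ⟨1, one_pos, fun f g hf hf2 _ hfg => ?_⟩
  have hg := (memA_two_iff ν g).1 hfg.1
  have hfL := memLp_of_lpInt_lt_top hf hf2
  have h1 := hfg.2 g hfg.1
  rw [dV_eq] at h1
  set μ := wM m 0 (ν - hN m) with hμ
  have h2 : eLpNorm g 2 μ ≤ eLpNorm f 2 μ := by
    have h3 : ‖∫ z, g z * (starRingEnd ℂ) (g z) ∂μ‖ₑ = eLpNorm g 2 μ * eLpNorm g 2 μ := by
      have e1 : ∀ z, g z * (starRingEnd ℂ) (g z) = ((‖g z‖ ^ 2 : ℝ) : ℂ) := fun z => by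
        rw [Complex.mul_conj, Complex.normSq_eq_norm_sq]
      simp only [e1]
      rw [integral_complex_ofReal, ← ofReal_norm, norm_real, Real.norm_of_nonneg
        (integral_nonneg fun _ => by positivity),
        ofReal_integral_eq_lintegral_ofReal (hg.memLp.integrable_norm_pow two_ne_zero)
        (Filter.Eventually.of_forall fun _ => by positivity), eLpNorm_two,
        ← ENNReal.rpow_add_of_nonneg _ _ (by norm_num) (by norm_num)]
      norm_num
      refine lintegral_congr fun z => ?_
      rw [← ofReal_norm]
    have h4 := enorm_integral_mul_conj_le (μ := μ) hfL.1 hg.memLp.1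
    rw [h1, h3] at h4
    by_cases h0 : eLpNorm g 2 μ = 0
    · simp [h0]
    · exact (ENNReal.mul_le_mul_iff_right h0 hg.memLp.2.ne).1 h4
  have h5 := lpNorm_le_of_lintegral_le (m := m) (ν := ν) (p := 2) two_pos (C := 1) (f := f) (g := g) (by
    rw [eLpNorm_two, eLpNorm_two] at h2
    rw [one_mul]
    exact (ENNReal.rpow_le_rpow_iff (by norm_num)).1 h2)
  simpa using h5

/-- The Hardy inequality implies boundedness of the Bergman projection. -/
theorem projBounded_of_hardy {ν p : ℝ} (hp : 2 ≤ p) (hν : hN m - 1 < ν)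
    (hH : hardy (m + 2) p ν) : projBounded (m + 2) p ν := by
  rcases hp.eq_or_lt with rfl | hp
  · exact projBounded_two ν
  have hp0 : 0 < p := by linarith
  obtain ⟨C, hC, h⟩ := exists_lintegral_bergman_le hν hp hH
  have hC' : C ^ (1 / p) ≠ ⊤ := ENNReal.rpow_ne_top_of_nonneg (by positivity) hC
  refine ⟨(C ^ (1 / p)).toReal + 1, by positivity, fun f g hf hf2 _ hfg => ?_⟩
  have hg := (memA_two_iff ν g).1 hfg.1
  have hfL := memLp_of_lpInt_lt_top hf hf2
  have hae := hfL.1.aemeasurable.ae_eq_mk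
  have h1 := lintegral_bergman_le_of_forall hp0 h (g := g) hfL.1.aemeasurable.measurable_mk
    (hfL.ae_eq hae) fun z hz => by
      rw [hg.repro hz]
      have h2 := hfg.2 _ ((memA_two_iff ν _).2 (A2_bk z))
      rw [dV_eq] at h2
      rw [← h2]
      refine integral_congr_ae ?_
      filter_upwards [hae] with w hw
      rw [← hw]
  have h3 : ∫⁻ z, ‖g z‖ₑ ^ p ∂(wM m 0 (ν - hN m)) ≤ C * ∫⁻ z, ‖f z‖ₑ ^ p ∂(wM m 0 (ν - hN m)) := by
    refine h1.trans (le_of_eq ?_)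
    congr 1
    refine lintegral_congr_ae ?_
    filter_upwards [hae] with w hw
    rw [← hw]
  refine (lpNorm_le_of_lintegral_le hp0 h3).trans (mul_le_mul_left ?_ _)
  rw [← ENNReal.ofReal_toReal hC', ENNReal.toReal_ofReal ENNReal.toReal_nonneg]
  exact ENNReal.ofReal_le_ofReal (by linarith)

theorem projBounded_iff_hardy (hm : 1 ≤ m) {ν p : ℝ} (hp : 2 ≤ p) (hν : hN m - 1 < ν) :
    projBounded (m + 2) p ν ↔ hardy (m + 2) p ν := by
  have h : (3 : ℝ) / 2 ≤ hN m := by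
    have : (1 : ℝ) ≤ m := by exact_mod_cast hm
    rw [hN]; push_cast; linarith
  exact ⟨hardy_of_projBounded hp hν (by linarith), projBounded_of_hardy hp hν⟩

end

/-- Theorem: boundedness of `P_ν` on `L^p_ν` ⇔ Hardy inequality.
Let `ν > n/2 − 1` and `2 ≤ p < ∞`. Then the Bergman projection `P_ν` admits a bounded
extension to `L^p_ν` if and only if the Hardy inequality holds for `(p, ν)`. -/
theorem bergman_bounded_iff_hardy (n : ℕ) [NeZero n] (hn : 3 ≤ n) (ν p : ℝ)
    (hν : (n : ℝ) / 2 - 1 < ν) (hp : 2 ≤ p) :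
    projBounded n p ν ↔ hardy n p ν := by
  obtain ⟨m, rfl⟩ : ∃ m, n = m + 2 := ⟨n - 2, by omega⟩
  refine projBounded_iff_hardy (by omega) hp ?_
  rwa [hN]
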